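/- arXiv:1701.07956 — 8 statements merged into one kernel-verified Lean document; each statement's English description precedes it below -/
import Mathlib

section
/- For every ε, δ ∈ (0,1), every m ≥ 2, and every natural number k with k ≥ 32·(ln 8 + ln m − ln ε − ln δ)/ε², every n-player m-action game (with payoffs in [0,1]) admits a profile of mixed strategies (x_1,…,x_n), each x_i a k-uniform distribution on [m], which is an (ε,δ)-weak approximate Nash equilibrium. -/
open Finset

/-- Expected payoff of payoff function `u` under the mixed strategy profile `x`,
where `x i b` is the probability that player `i` plays action `b`. -/
noncomputable def expPay {n m : ℕ} (u : (Fin n → Fin m) → ℝ) (x : Fin n → Fin m → ℝ) : ℝ :=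
  ∑ a : Fin n → Fin m, (∏ i, x i (a i)) * u a

/-- The pure strategy playing action `b` with probability one. -/
def pureStrat {m : ℕ} (b : Fin m) : Fin m → ℝ := fun b' => if b' = b then 1 else 0

/-- `p` is a mixed strategy, i.e. a probability distribution on `Fin m`. -/
def IsMixed {m : ℕ} (p : Fin m → ℝ) : Prop := (∀ b, 0 ≤ p b) ∧ ∑ b, p b = 1


def ScDom {I X L : Type} [LinearOrder L] (r : I → X → L) (B : Finset X) : Prop :=
  ∀ x, ∃ i, ∀ b ∈ B, r i x ≤ r i b

theorem sc_pivot {I X L : Type} [Fintype I] [DecidableEq I] [Fintype X] [DecidableEq X]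
    [LinearOrder L] (r : I → X → L) (hr : ∀ i, Function.Injective (r i))
    (B : Finset X) (hB : ScDom r B) (hc : B.card + 1 = Fintype.card I) (hne : B.Nonempty)
    (H : ∀ i, ∃ x, ∀ l, l ≠ i → ∃ b ∈ B, r l b < r l x) :
    ∃ p q : X, p ≠ q ∧ ∀ x, (x ∉ B ∧ ScDom r (insert x B)) ↔ (x = p ∨ x = q) := by
  have hmin : ∀ i, ∃ b ∈ B, ∀ b' ∈ B, r i b ≤ r i b' := fun i => B.exists_min_image (r i) hne
  choose μ hμB hμ using hmin
  have hsurj : ∀ b ∈ B, ∃ i, μ i = b := by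
    intro b hb
    obtain ⟨i, hi⟩ := hB b
    exact ⟨i, hr i (le_antisymm (hμ i b hb) (hi _ (hμB i)))⟩
  obtain ⟨i, -, j, -, hij, hμij⟩ := Finset.exists_ne_map_eq_of_card_lt_of_maps_to
    (s := (univ : Finset I)) (t := B) (f := μ) (by rw [card_univ]; omega) (fun l _ => hμB l)
  have hQ : ∀ p, ∃ y, (∀ l, l ≠ p → r l (μ l) < r l y) ∧
      ∀ z, (∀ l, l ≠ p → r l (μ l) < r l z) → r p z ≤ r p y := by
    classical
    intro p
    obtain ⟨x, hx⟩ := H p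
    obtain ⟨y, hy, hy2⟩ := (univ.filter (fun z => ∀ l, l ≠ p → r l (μ l) < r l z)).exists_max_image
      (r p) ⟨x, by
        simp only [mem_filter, mem_univ, true_and]
        intro l hl
        obtain ⟨b, hb, hbx⟩ := hx l hl
        exact lt_of_le_of_lt (hμ l b hb) hbx⟩
    simp only [mem_filter, mem_univ, true_and] at hy hy2
    exact ⟨y, hy, hy2⟩
  choose y hyQ hymax using hQ
  have hylow : ∀ p, ∀ b ∈ B, r p (y p) ≤ r p b := by
    intro p
    obtain ⟨l, hl⟩ := hB (y p)
    by_cases h : l = p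
    · subst h; exact hl
    · exact absurd (hl _ (hμB l)) (not_le.mpr (hyQ p l h))
  have F1 : ∀ p q, p ≠ q → μ p = μ q → y p ∉ B := by
    intro p q hpq hm hyB
    obtain ⟨l, hl⟩ := hsurj _ hyB
    by_cases h : l = p
    · subst h
      have := hyQ l q hpq.symm
      rw [← hl, hm] at this
      exact lt_irrefl _ this
    · have := hyQ p l h
      rw [← hl] at this
      exact lt_irrefl _ this
  have F2 : ∀ p, ScDom r (insert (y p) B) := by
    intro p z
    by_contra hcon
    push Not at hcon
    have hz : ∀ l, l ≠ p → r l (μ l) < r l z := by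
      intro l hl
      obtain ⟨b, hb, hbz⟩ := hcon l
      rcases mem_insert.mp hb with h | h
      · subst h; exact (hyQ p l hl).trans hbz
      · exact lt_of_le_of_lt (hμ l b h) hbz
    have h1 := hymax p z hz
    obtain ⟨b, hb, hbz⟩ := hcon p
    rcases mem_insert.mp hb with h | h
    · subst h; exact absurd h1 (not_le.mpr hbz)
    · exact absurd (h1.trans (hylow p b h)) (not_le.mpr hbz)
  refine ⟨y i, y j, ?_, ?_⟩
  · intro h
    have h1 := hylow i _ (hμB i)
    have h2 := hyQ j i hij
    rw [← h] at h2
    exact absurd h1 (not_le.mpr h2)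
  · intro x
    constructor
    · rintro ⟨hxB, hD⟩
      obtain ⟨p, hp⟩ := hD x
      have hlb : ∀ b : B, ∃ l, ∀ b' ∈ insert x B, r l (b : X) ≤ r l b' := fun b => hD b
      choose lb hlb using hlb
      have hlbμ : ∀ b : B, μ (lb b) = b := fun b =>
        hr (lb b) (le_antisymm (hμ _ _ b.2) (hlb b _ (mem_insert_of_mem (hμB _))))
      have hlbp : ∀ b : B, lb b ≠ p := by
        intro b h
        have h1 := hlb b x (mem_insert_self _ _)
        have h2 := hp b (mem_insert_of_mem b.2)
        rw [h] at h1
        have := hr p (le_antisymm h1 h2)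
        exact hxB (this ▸ b.2)
      have himg : (univ : Finset B).image lb = univ.erase p := by
        apply Finset.eq_of_subset_of_card_le
        · intro l hl
          obtain ⟨b, -, rfl⟩ := mem_image.mp hl
          simp [hlbp b]
        · rw [card_image_of_injective, card_univ, Fintype.card_coe, card_erase_of_mem (mem_univ _),
            card_univ]
          · omega
          · intro b b' h
            apply Subtype.ext
            rw [← hlbμ b, ← hlbμ b', h]
      have hall : ∀ l, l ≠ p → ∃ b : B, lb b = l := by
        intro l hl
        have : l ∈ (univ : Finset B).image lb := by rw [himg]; simp [hl]
        obtain ⟨b, -, h⟩ := mem_image.mp this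
        exact ⟨b, h⟩
      have hxQ : ∀ l, l ≠ p → r l (μ l) < r l x := by
        intro l hl
        obtain ⟨b, rfl⟩ := hall l hl
        rw [hlbμ]
        refine lt_of_le_of_ne (hlb b x (mem_insert_self _ _)) ?_
        intro h
        exact hxB ((hr _ h) ▸ b.2)
      have hpij : p = i ∨ p = j := by
        by_contra hcon
        push Not at hcon
        obtain ⟨b, hb⟩ := hall i hcon.1.symm
        obtain ⟨b', hb'⟩ := hall j hcon.2.symm
        apply hij
        rw [← hb, ← hb']
        congr 1
        apply Subtype.ext
        rw [← hlbμ b, ← hlbμ b', hb, hb', hμij]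
      have hxy : x = y p := by
        apply hr p
        apply le_antisymm (hymax p x hxQ)
        obtain ⟨l, hl⟩ := hD (y p)
        by_cases h : l = p
        · subst h; exact hl x (mem_insert_self _ _)
        · exact absurd (hl _ (mem_insert_of_mem (hμB l))) (not_le.mpr (hyQ p l h))
      rcases hpij with h | h
      · left; rw [hxy, h]
      · right; rw [hxy, h]
    · rintro (h | h)
      · subst h; exact ⟨F1 i j hij hμij, F2 i⟩
      · subst h; exact ⟨F1 j i hij.symm hμij.symm, F2 j⟩

theorem sc_exists {I X L : Type} [Fintype I] [DecidableEq I] [Fintype X] [DecidableEq X]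
    [LinearOrder L] (r : I → X → L) (hr : ∀ i, Function.Injective (r i))
    (s : I → X) (col : X → I) (hcol : ∀ i, col (s i) = i)
    (h1 : ∀ i x, r i (s i) ≤ r i x)
    (h2 : ∀ i j x, j ≠ i → (∀ l, x ≠ s l) → r i x < r i (s j))
    (t0 : X) (ht0 : ∀ l, t0 ≠ s l) (i0 : I) :
    ∃ B : Finset X, ScDom r B ∧ B.image col = univ := by
  classical
  by_contra hno
  push Not at hno
  let D : Finset (Finset X) := univ.filter fun B => ScDom r B ∧ B.image col = univ.erase i0 ∧
    B.card + 1 = Fintype.card I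
  let R : Finset (Finset X) := univ.filter fun B => ScDom r B ∧ B.card = Fintype.card I
  let P : Finset X → Finset X := fun B => univ.filter fun x => x ∉ B ∧ ScDom r (insert x B)
  let Q : Finset X → Finset X := fun B => univ.filter fun x => x ∈ B ∧ B.erase x ∈ D
  have hcount : ∑ B ∈ D, (P B).card = ∑ B ∈ R, (Q B).card := by
    rw [← card_sigma, ← card_sigma]
    refine card_nbij' (fun z => ⟨insert z.2 z.1, z.2⟩) (fun z => ⟨z.1.erase z.2, z.2⟩) ?_ ?_ ?_ ?_
    · rintro ⟨B, x⟩ h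
      simp only [D, R, P, Q, coe_sigma, Set.mem_sigma_iff, mem_coe, mem_filter, mem_univ, true_and] at h ⊢
      obtain ⟨⟨a, b, c⟩, d, e⟩ := h
      refine ⟨⟨e, ?_⟩, mem_insert_self _ _, ?_⟩
      · rw [card_insert_of_notMem d, c]
      · rw [erase_insert d]; exact ⟨a, b, c⟩
    · rintro ⟨B, x⟩ h
      simp only [D, R, P, Q, coe_sigma, Set.mem_sigma_iff, mem_coe, mem_filter, mem_univ, true_and] at h ⊢
      obtain ⟨⟨a, b⟩, d, e⟩ := h
      refine ⟨e, notMem_erase _ _, ?_⟩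
      rw [insert_erase d]; exact a
    · rintro ⟨B, x⟩ h
      simp only [D, R, P, Q, coe_sigma, Set.mem_sigma_iff, mem_coe, mem_filter, mem_univ, true_and] at h ⊢
      rw [erase_insert h.2.1]
    · rintro ⟨B, x⟩ h
      simp only [D, R, P, Q, coe_sigma, Set.mem_sigma_iff, mem_coe, mem_filter, mem_univ, true_and] at h ⊢
      rw [insert_erase h.2.1]
  -- rooms are even
  have hR : ∀ B ∈ R, Even (Q B).card := by
    intro B hB
    simp only [R, mem_filter, mem_univ, true_and] at hB
    by_cases hQ : (Q B).Nonempty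
    · obtain ⟨x, hx⟩ := hQ
      simp only [Q, D, mem_filter, mem_univ, true_and] at hx
      obtain ⟨hxB, -, himg, hcard⟩ := hx
      have hinj : Set.InjOn col (B.erase x : Finset X) := by
        rw [← card_image_iff, himg, card_erase_of_mem (mem_univ _), card_univ]; omega
      have hcx : col x ≠ i0 := by
        intro h
        apply hno B hB.1
        rw [← insert_erase hxB, image_insert, himg, h, insert_erase (mem_univ _)]
      have : col x ∈ (B.erase x).image col := by rw [himg]; simp [hcx]
      obtain ⟨x', hx', hcc⟩ := mem_image.mp this
      have hx'' := mem_erase.mp hx'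
      have : Q B = {x, x'} := by
        ext z
        simp only [Q, D, mem_filter, mem_univ, true_and, mem_insert, mem_singleton]
        have hdom : ∀ z, ScDom r (B.erase z) := by
          intro z y
          obtain ⟨i, hi⟩ := hB.1 y
          exact ⟨i, fun b hb => hi b (mem_of_mem_erase hb)⟩
        constructor
        · rintro ⟨hzB, -, hzi, -⟩
          by_contra hcon
          push Not at hcon
          have hz1 : z ∈ B.erase x := mem_erase.mpr ⟨hcon.1, hzB⟩
          have : col z ∈ (B.erase z).image col := by
            rw [hzi, ← himg]; exact mem_image_of_mem _ hz1
          obtain ⟨w, hw, hwz⟩ := mem_image.mp this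
          have hw' := mem_erase.mp hw
          by_cases hwx : w = x
          · subst hwx
            exact hcon.2 (hinj hz1 hx' (by rw [← hwz, hcc]))
          · exact hw'.1 (hinj (mem_erase.mpr ⟨hwx, hw'.2⟩) hz1 hwz)
        · rintro (h | h)
          · subst h; exact ⟨hxB, hdom _, himg, hcard⟩
          · subst h
            refine ⟨hx''.2, hdom _, ?_, ?_⟩
            · rw [← himg]
              ext l
              simp only [mem_image, mem_erase]
              constructor
              · rintro ⟨w, ⟨hw1, hw2⟩, rfl⟩
                by_cases hwx : w = x
                · subst hwx; exact ⟨z, ⟨hx''.1, hx''.2⟩, hcc⟩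
                · exact ⟨w, ⟨hwx, hw2⟩, rfl⟩
              · rintro ⟨w, ⟨hw1, hw2⟩, rfl⟩
                by_cases hwx : w = z
                · subst hwx; exact ⟨x, ⟨hx''.1.symm, hxB⟩, hcc.symm⟩
                · exact ⟨w, ⟨hwx, hw2⟩, rfl⟩
            · rw [card_erase_of_mem hx''.2]; rw [card_erase_of_mem hxB] at hcard; exact hcard
      rw [this, card_pair hx''.1.symm]
      exact even_two
    · rw [not_nonempty_iff_eq_empty.mp hQ]; simp
  have hsinj : Function.Injective s := fun a b h => by rw [← hcol a, h, hcol]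
  let B0 : Finset X := (univ.erase i0).image s
  have hB0mem : ∀ x, x ∈ B0 ↔ ∃ j, j ≠ i0 ∧ s j = x := by
    intro x; simp [B0]
  have hB0D : B0 ∈ D := by
    simp only [D, mem_filter, mem_univ, true_and]
    refine ⟨?_, ?_, ?_⟩
    · intro x
      by_cases hx : ∃ l, x = s l
      · obtain ⟨l, rfl⟩ := hx
        exact ⟨l, fun b _ => h1 l b⟩
      · push Not at hx
        refine ⟨i0, fun b hb => ?_⟩
        obtain ⟨j, hj, rfl⟩ := (hB0mem b).mp hb
        exact (h2 i0 j x hj hx).le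
    · simp only [B0, image_image]
      rw [show col ∘ s = id from funext hcol, image_id]
    · simp only [B0]
      rw [card_image_of_injective _ hsinj, card_erase_add_one (mem_univ _), card_univ]
  have hD0 : (P B0).card = 1 := by
    obtain ⟨t, ht, htmax⟩ := (univ.filter fun x => ∀ l, x ≠ s l).exists_max_image (r i0)
      ⟨t0, by simpa using ht0⟩
    simp only [mem_filter, mem_univ, true_and] at ht htmax
    rw [card_eq_one]
    refine ⟨t, ?_⟩
    ext x
    simp only [P, mem_filter, mem_univ, true_and, mem_singleton]
    constructor
    · rintro ⟨hx, hd⟩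
      obtain ⟨i, hi⟩ := hd t
      have hii : i = i0 := by
        by_contra h
        have := hi (s i) (mem_insert_of_mem ((hB0mem _).mpr ⟨i, h, rfl⟩))
        exact ht i (hr i (le_antisymm this (h1 i t)))
      subst hii
      have htx := hi x (mem_insert_self _ _)
      apply hr i
      refine le_antisymm (htmax x ?_) htx
      intro l hl
      by_cases h : l = i
      · subst h hl
        exact ht l (hr l (le_antisymm htx (h1 l t)))
      · exact hx ((hB0mem _).mpr ⟨l, h, hl.symm⟩)
    · intro h
      subst h
      refine ⟨fun h => ?_, ?_⟩
      · obtain ⟨j, _, hj⟩ := (hB0mem _).mp h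
        exact ht j hj.symm
      · intro z
        by_cases hz : ∃ l, z = s l
        · obtain ⟨l, rfl⟩ := hz
          exact ⟨l, fun b _ => h1 l b⟩
        · push Not at hz
          refine ⟨i0, fun b hb => ?_⟩
          rcases mem_insert.mp hb with h | h
          · subst h; exact htmax z hz
          · obtain ⟨j, hj, rfl⟩ := (hB0mem b).mp h
            exact (h2 i0 j z hj hz).le
  have hD1 : ∀ B ∈ D.erase B0, Even (P B).card := by
    intro B hB
    obtain ⟨hne, hBD⟩ := mem_erase.mp hB
    simp only [D, mem_filter, mem_univ, true_and] at hBD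
    obtain ⟨hdom, himg, hcard⟩ := hBD
    have ht : ∃ t ∈ B, ∀ l, t ≠ s l := by
      by_contra hcon
      push Not at hcon
      apply hne
      have hsub : B ⊆ B0 := by
        intro b hb
        obtain ⟨l, rfl⟩ := hcon b hb
        rw [hB0mem]
        refine ⟨l, ?_, rfl⟩
        have := mem_image_of_mem col hb
        rw [himg, hcol] at this
        exact (mem_erase.mp this).1
      apply eq_of_subset_of_card_le hsub
      simp only [D, mem_filter, mem_univ, true_and] at hB0D
      omega
    obtain ⟨t, htB, ht⟩ := ht
    obtain ⟨p, q, hpq, h⟩ := sc_pivot r hr B hdom hcard ⟨t, htB⟩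
      (fun i => ⟨s i, fun l hl => ⟨t, htB, h2 l i t hl.symm ht⟩⟩)
    have : P B = {p, q} := by
      ext x
      simp only [P, mem_filter, mem_univ, true_and, mem_insert, mem_singleton]
      exact h x
    rw [this, card_pair hpq]; exact even_two
  have hodd : Odd (∑ B ∈ D, (P B).card) := by
    rw [← add_sum_erase D _ hB0D, hD0]
    exact Odd.add_even odd_one (Finset.even_sum _ hD1)
  rw [hcount] at hodd
  exact (Nat.not_even_iff_odd.mpr hodd) (Finset.even_sum _ hR)

theorem sc_grid {ι : Type} [Fintype ι] [DecidableEq ι] [Nonempty ι] (N : ℕ)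
    (c : (ι → ℕ) → ι) :
    ∃ (A : Set (ι → ℕ)) (C : Finset ι), (∀ a ∈ A, ∑ i, a i = N) ∧
      (∀ i ∈ C, ∃ a ∈ A, c a = i) ∧
      ∀ t : ι → ℕ, ∑ i, t i = N → ∃ i ∈ C, ∀ a ∈ A, t i ≤ a i := by
  classical
  let T := ↥(Finset.piAntidiag (univ : Finset ι) N)
  have hT : ∀ t : T, ∑ i, t.1 i = N := fun t => (mem_piAntidiag.mp t.2).1
  have hTi : ∀ t : T, ∀ i, t.1 i ≤ N := fun t i => by
    have h := single_le_sum (f := t.1) (fun _ _ => Nat.zero_le _) (mem_univ i)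
    exact h.trans (hT t).le
  let eT := Fintype.equivFin T
  let eI := Fintype.equivFin ι
  let r : ι → T ⊕ ι → ℕ ×ₗ ℕ := fun i x => match x with
    | Sum.inl t => toLex (t.1 i + 1, (eT t : ℕ))
    | Sum.inr j => if j = i then toLex (0, 0) else toLex (N + 2, (eI j : ℕ))
  have i0 : ι := Classical.arbitrary ι
  have hex : ∃ t : ι → ℕ, ∑ i, t i = N := ⟨fun i => if i = i0 then N else 0, by simp⟩
  obtain ⟨t0, ht0⟩ := hex
  let t0' : T := ⟨t0, mem_piAntidiag.mpr ⟨ht0, fun i _ => mem_univ i⟩⟩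
  obtain ⟨B, hB, himg⟩ := sc_exists (I := ι) (X := T ⊕ ι) (L := ℕ ×ₗ ℕ) r (by
      intro i x y h
      rcases x with t | j <;> rcases y with t' | j' <;> simp only [r] at h
      · have := (Prod.ext_iff.mp (toLex.injective h)).2
        simp only at this
        rw [eT.injective (Fin.ext this)]
      · have := hTi t i
        split_ifs at h <;>
        · have := (Prod.ext_iff.mp (toLex.injective h)).1
          simp only at this
          omega
      · have := hTi t' i
        split_ifs at h <;>
        · have := (Prod.ext_iff.mp (toLex.injective h)).1
          simp only at this
          omega
      · split_ifs at h with h1 h2 h2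
        · rw [h1, h2]
        · have := (Prod.ext_iff.mp (toLex.injective h)).1
          simp only at this
          omega
        · have := (Prod.ext_iff.mp (toLex.injective h)).1
          simp only at this
          omega
        · have := (Prod.ext_iff.mp (toLex.injective h)).2
          simp only at this
          rw [eI.injective (Fin.ext this)])
    Sum.inr (fun x => match x with | Sum.inl t => c t.1 | Sum.inr j => j) (fun i => rfl)
    (by
      intro i x
      rcases x with t | j <;> simp only [r, if_true]
      · rw [Prod.Lex.toLex_le_toLex]; left; simp
      · split_ifs with h
        · exact le_refl _
        · rw [Prod.Lex.toLex_le_toLex]; left; simp)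
    (by
      intro i j x hj hx
      rcases x with t | j'
      · simp only [r, if_neg hj]
        rw [Prod.Lex.toLex_lt_toLex]; left
        have := hTi t i
        simp only; omega
      · exact absurd rfl (hx j'))
    (Sum.inl t0') (fun l => by simp) i0
  refine ⟨{a | ∃ t : T, Sum.inl t ∈ B ∧ t.1 = a}, univ.filter (fun i => Sum.inr i ∉ B), ?_, ?_, ?_⟩
  · rintro a ⟨t, -, rfl⟩; exact hT t
  · intro i hi
    simp only [mem_filter, mem_univ, true_and] at hi
    have : i ∈ B.image (fun x => match x with | Sum.inl t => c t.1 | Sum.inr j => j) := by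
      rw [himg]; exact mem_univ i
    obtain ⟨x, hx, hxi⟩ := mem_image.mp this
    rcases x with t | j
    · exact ⟨t.1, ⟨t, hx, rfl⟩, hxi⟩
    · simp only at hxi; subst hxi; exact absurd hx hi
  · intro t ht
    let t' : T := ⟨t, mem_piAntidiag.mpr ⟨ht, fun i _ => mem_univ i⟩⟩
    obtain ⟨i, hi⟩ := hB (Sum.inl t')
    refine ⟨i, ?_, ?_⟩
    · simp only [mem_filter, mem_univ, true_and]
      intro h
      have := hi _ h
      simp only [r, if_true] at this
      rw [Prod.Lex.toLex_le_toLex] at this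
      simp at this
    · rintro a ⟨s, hs, rfl⟩
      have := hi _ hs
      simp only [r] at this
      rw [Prod.Lex.toLex_le_toLex] at this
      simp only [t'] at this
      omega

theorem sc_grid2 {ι : Type} [Fintype ι] [DecidableEq ι] [Nonempty ι] (N : ℕ)
    (c : (ι → ℕ) → ι) :
    ∃ (p : ι → ℕ), ∑ i, p i = N ∧ ∀ i, p i ≤ Fintype.card ι ∨ ∃ a : ι → ℕ, ∑ i, a i = N ∧ c a = i ∧
      ∀ j, a j ≤ p j + Fintype.card ι ∧ p j ≤ a j + Fintype.card ι := by
  classical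
  obtain ⟨A, C, hA, hC, hd⟩ := sc_grid N c
  have i0 : ι := Classical.arbitrary ι
  have hCne : C.Nonempty := by
    obtain ⟨i, hi, -⟩ := hd (fun i => if i = i0 then N else 0) (by simp)
    exact ⟨i, hi⟩
  obtain ⟨i1, hi1⟩ := hCne
  obtain ⟨p, hpA, -⟩ := hC i1 hi1
  have hmin : ∀ i, ∃ m, (∃ a ∈ A, a i = m) ∧ ∀ a ∈ A, m ≤ a i := by
    intro i
    have hex : ∃ m, ∃ a ∈ A, a i = m := ⟨p i, p, hpA, rfl⟩
    exact ⟨Nat.find hex, Nat.find_spec hex, fun a ha => Nat.find_min' hex ⟨a, ha, rfl⟩⟩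
  choose m hm hmle using hmin
  have hsum : N < ∑ i ∈ C, (m i + 1) := by
    by_contra hcon
    push Not at hcon
    obtain ⟨i, hiC, hi⟩ := hd (fun i => (if i ∈ C then m i + 1 else 0) +
      if i = i1 then N - ∑ i ∈ C, (m i + 1) else 0) (by
        rw [sum_add_distrib, sum_ite_mem, univ_inter]; rw [sum_ite_eq' univ i1, if_pos (mem_univ _)]; omega)
    obtain ⟨a, ha, hai⟩ := hm i
    have := hi a ha
    simp only [hiC, if_true] at this
    omega
  rw [sum_add_distrib, sum_const, smul_eq_mul, mul_one] at hsum
  have hCc : C.card ≤ Fintype.card ι := card_le_univ C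
  have hin : ∀ a ∈ A, ∀ i ∈ C, a i ≤ m i + Fintype.card ι := by
    intro a ha i hi
    have h1 : ∑ j ∈ C, a j ≤ N := by
      rw [← hA a ha]; exact sum_le_sum_of_subset (subset_univ _)
    have h2 := add_sum_erase C a hi
    have h3 := add_sum_erase C m hi
    have h4 : ∑ j ∈ C.erase i, m j ≤ ∑ j ∈ C.erase i, a j := sum_le_sum fun j _ => hmle j a ha
    omega
  have hout : ∀ a ∈ A, ∀ i, i ∉ C → a i ≤ Fintype.card ι := by
    intro a ha i hi
    have h1 : a i + ∑ j ∈ C, a j ≤ N := by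
      rw [← hA a ha, ← sum_insert hi]; exact sum_le_sum_of_subset (subset_univ _)
    have h4 : ∑ j ∈ C, m j ≤ ∑ j ∈ C, a j := sum_le_sum fun j _ => hmle j a ha
    omega
  refine ⟨p, hA p hpA, fun i => ?_⟩
  by_cases hi : i ∈ C
  · right
    obtain ⟨a, ha, hai⟩ := hC i hi
    refine ⟨a, hA a ha, hai, fun j => ?_⟩
    by_cases hj : j ∈ C
    · have := hin a ha j hj
      have := hin p hpA j hj
      have := hmle j a ha
      have := hmle j p hpA
      omega
    · have := hout a ha j hj
      have := hout p hpA j hj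
      omega
  · left; exact hout p hpA i hi

theorem simplex_approx {ι : Type} [Fintype ι] [Nonempty ι]
    (f : (ι → ℝ) → (ι → ℝ)) (hf : ContinuousOn f (stdSimplex ℝ ι))
    (hmap : ∀ x ∈ stdSimplex ℝ ι, f x ∈ stdSimplex ℝ ι) (η : ℝ) (hη : 0 < η) :
    ∃ p ∈ stdSimplex ℝ ι, ∀ i, p i - f p i ≤ η := by
  classical
  have huc := (isCompact_stdSimplex ℝ ι).uniformContinuousOn_of_continuous hf
  rw [Metric.uniformContinuousOn_iff] at huc
  obtain ⟨d, hd, huc⟩ := huc (η / 2) (by linarith)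
  obtain ⟨N, hN⟩ := exists_nat_gt ((Fintype.card ι : ℝ) / min d (η / 2))
  have hmin : 0 < min d (η / 2) := lt_min hd (by linarith)
  have hN0 : (0 : ℝ) < N := lt_of_le_of_lt (by positivity) hN
  have hcN : (Fintype.card ι : ℝ) / N < min d (η / 2) := by
    rw [div_lt_iff₀ hmin] at hN
    rw [div_lt_iff₀ hN0]; linarith
  have hcd := hcN.trans_le (min_le_left _ _)
  have hce := hcN.trans_le (min_le_right _ _)
  let g : (ι → ℕ) → (ι → ℝ) := fun a i => (a i : ℝ) / N
  have hg : ∀ a : ι → ℕ, ∑ i, a i = N → g a ∈ stdSimplex ℝ ι := by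
    intro a ha
    refine ⟨fun i => by positivity, ?_⟩
    simp only [g]
    rw [← sum_div, ← Nat.cast_sum, ha, div_self hN0.ne']
  have hcol : ∀ a : ι → ℕ, ∃ i, ∑ i, a i = N → g a i ≤ f (g a) i := by
    intro a
    by_cases ha : ∑ i, a i = N
    · by_contra hcon
      push Not at hcon
      have h1 := (hg a ha).2
      have h2 := (hmap _ (hg a ha)).2
      have : ∑ i, f (g a) i < ∑ i, g a i :=
        sum_lt_sum_of_nonempty univ_nonempty fun i _ => (hcon i).2
      linarith
    · exact ⟨Classical.arbitrary ι, fun h => absurd h ha⟩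
  choose c hc using hcol
  obtain ⟨p, hp, hpi⟩ := sc_grid2 N c
  refine ⟨g p, hg p hp, fun i => ?_⟩
  rcases hpi i with h | ⟨a, ha, hai, hclose⟩
  · have h1 := (hmap _ (hg p hp)).1 i
    have h2 : g p i ≤ (Fintype.card ι : ℝ) / N := by
      simp only [g]; gcongr
    linarith
  · have hcl : ∀ j, |g p j - g a j| ≤ (Fintype.card ι : ℝ) / N := by
      intro j
      obtain ⟨h1, h2⟩ := hclose j
      have h1' : (a j : ℝ) ≤ p j + Fintype.card ι := by exact_mod_cast h1
      have h2' : (p j : ℝ) ≤ a j + Fintype.card ι := by exact_mod_cast h2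
      simp only [g]
      rw [← sub_div, abs_div, abs_of_pos hN0]
      gcongr
      rw [abs_le]; constructor <;> linarith
    have hdist : dist (g p) (g a) < d := by
      rw [dist_pi_lt_iff hd]
      intro j
      rw [Real.dist_eq]
      exact (hcl j).trans_lt hcd
    have h3 := huc _ (hg p hp) _ (hg a ha) hdist
    rw [dist_pi_lt_iff (by linarith)] at h3
    have h4 := h3 i
    rw [Real.dist_eq, abs_lt] at h4
    have h5 := abs_le.mp (hcl i)
    have h6 := hc a ha
    rw [hai] at h6
    linarith [h5.1, h5.2, h4.1, h4.2]

theorem simplex_brouwer {ι : Type} [Fintype ι] [Nonempty ι]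
    (f : (ι → ℝ) → (ι → ℝ)) (hf : ContinuousOn f (stdSimplex ℝ ι))
    (hmap : ∀ x ∈ stdSimplex ℝ ι, f x ∈ stdSimplex ℝ ι) :
    ∃ p ∈ stdSimplex ℝ ι, f p = p := by
  have hfi : ∀ i, ContinuousOn (fun p => f p i) (stdSimplex ℝ ι) := fun i =>
    (continuous_apply i).comp_continuousOn hf
  let φ : (ι → ℝ) → ℝ := fun p => univ.sup' univ_nonempty (fun i => p i - f p i)
  have hφ : ContinuousOn φ (stdSimplex ℝ ι) := by
    apply ContinuousOn.finset_sup'_apply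
    intro i _
    exact (continuous_apply i).continuousOn.sub (hfi i)
  obtain ⟨p0, hp0, -⟩ := simplex_approx f hf hmap 1 one_pos
  obtain ⟨p, hp, hpm⟩ := (isCompact_stdSimplex ℝ ι).exists_isMinOn ⟨p0, hp0⟩ hφ
  have hle : φ p ≤ 0 := by
    apply le_of_forall_pos_le_add
    intro η hη
    obtain ⟨q, hq, hqi⟩ := simplex_approx f hf hmap η hη
    have h1 : φ p ≤ φ q := hpm hq
    have h2 : φ q ≤ η := sup'_le _ _ fun i _ => hqi i
    linarith
  have hall : ∀ i, p i ≤ f p i := by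
    intro i
    have : p i - f p i ≤ φ p := le_sup' (fun i => p i - f p i) (mem_univ i)
    linarith
  refine ⟨p, hp, ?_⟩
  have hs : ∑ i, p i = ∑ i, f p i := by rw [hp.2, (hmap p hp).2]
  have := (sum_eq_sum_iff_of_le (fun i _ => hall i)).mp hs
  funext i
  exact (this i (mem_univ i)).symm

theorem prod_update_eval {n m : ℕ} (x : Fin n → Fin m → ℝ) (i : Fin n) (q : Fin m → ℝ)
    (a : Fin n → Fin m) :
    ∏ j, (Function.update x i q) j (a j) = q (a i) * ∏ j ∈ univ.erase i, x j (a j) := by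
  rw [← mul_prod_erase univ _ (mem_univ i), Function.update_self]
  congr 1
  apply prod_congr rfl
  intro j hj
  rw [Function.update_of_ne (mem_erase.mp hj).1]

theorem expPay_expand {n m : ℕ} (u : (Fin n → Fin m) → ℝ) (x : Fin n → Fin m → ℝ) (i : Fin n) :
    expPay u x = ∑ b, x i b * expPay u (Function.update x i (pureStrat b)) := by
  unfold expPay
  simp_rw [mul_sum]
  rw [sum_comm]
  apply sum_congr rfl
  intro a _
  simp_rw [prod_update_eval]
  rw [← mul_prod_erase univ _ (mem_univ i)]
  simp [pureStrat, mul_assoc]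

theorem expPay_continuous {n m : ℕ} (u : (Fin n → Fin m) → ℝ) :
    Continuous (fun x : Fin n → Fin m → ℝ => expPay u x) := by
  unfold expPay
  fun_prop

theorem nash_exists (n m : ℕ) (hn : 0 < n) (hm : 0 < m) (u : Fin n → (Fin n → Fin m) → ℝ) :
    ∃ x : Fin n → Fin m → ℝ, (∀ i, IsMixed (x i)) ∧
      ∀ i b, expPay (u i) (Function.update x i (pureStrat b)) ≤ expPay (u i) x := by
  have hnR : (0 : ℝ) < n := by exact_mod_cast hn
  have hmR : (0 : ℝ) < m := by exact_mod_cast hm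
  have : Nonempty (Fin n × Fin m) := ⟨(⟨0, hn⟩, ⟨0, hm⟩)⟩
  let G : (Fin n → Fin m → ℝ) → Fin n → Fin m → ℝ := fun x i b =>
    max 0 (expPay (u i) (Function.update x i (pureStrat b)) - expPay (u i) x)
  have hG0 : ∀ x i b, 0 ≤ G x i b := fun x i b => le_max_left _ _
  have hGc : ∀ i b, Continuous (fun x => G x i b) := by
    intro i b
    refine continuous_const.max (Continuous.sub ?_ (expPay_continuous (u i)))
    exact (expPay_continuous (u i)).comp (continuous_id.update i continuous_const)
  let F : (Fin n → Fin m → ℝ) → Fin n → Fin m → ℝ := fun x i b =>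
    (x i b + G x i b) / (1 + ∑ b', G x i b')
  have hden : ∀ x i, 0 < 1 + ∑ b', G x i b' := fun x i => by
    have : 0 ≤ ∑ b', G x i b' := sum_nonneg fun b _ => hG0 x i b
    linarith
  have hFm : ∀ x, (∀ i, IsMixed (x i)) → ∀ i, IsMixed (F x i) := by
    intro x hx i
    refine ⟨fun b => div_nonneg (add_nonneg ((hx i).1 b) (hG0 x i b)) (hden x i).le, ?_⟩
    simp only [F]
    rw [← sum_div, sum_add_distrib, (hx i).2, div_self (hden x i).ne']
  have hFc : ∀ i b, Continuous (fun x => F x i b) := by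
    intro i b
    refine Continuous.div ?_ ?_ (fun x => (hden x i).ne')
    · have hxc : Continuous (fun x : Fin n → Fin m → ℝ => x i b) := by fun_prop
      exact hxc.add (hGc i b)
    · exact continuous_const.add (continuous_finsetSum _ fun b _ => hGc i b)
  let s : (Fin n × Fin m → ℝ) → Fin n → ℝ := fun y i => ∑ b, y (i, b)
  let R : (Fin n × Fin m → ℝ) → Fin n → Fin m → ℝ := fun y i b =>
    (y (i, b) + max 0 (1 / n - s y i) / m) / max (s y i) (1 / n)
  have hmx : ∀ y i, 0 < max (s y i) (1 / (n : ℝ)) := fun y i =>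
    lt_of_lt_of_le (by positivity) (le_max_right _ _)
  have hRc : Continuous R := by
    refine continuous_pi fun i => continuous_pi fun b => ?_
    refine Continuous.div ?_ ?_ (fun y => (hmx y i).ne')
    · simp only [s]; fun_prop
    · simp only [s]; fun_prop
  have hRm : ∀ y ∈ stdSimplex ℝ (Fin n × Fin m), ∀ i, IsMixed (R y i) := by
    intro y hy i
    refine ⟨fun b => div_nonneg (add_nonneg (hy.1 _)
      (div_nonneg (le_max_left _ _) hmR.le)) (hmx y i).le, ?_⟩
    simp only [R]
    rw [← sum_div, div_eq_one_iff_eq (hmx y i).ne', sum_add_distrib, sum_const, card_univ,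
      Fintype.card_fin, nsmul_eq_mul, mul_div_cancel₀ _ hmR.ne']
    change s y i + _ = _
    rcases le_total (s y i) (1 / n) with h | h
    · rw [max_eq_right h, max_eq_right (by linarith)]; ring
    · rw [max_eq_left h, max_eq_left (by linarith)]; ring
  obtain ⟨y, hy, hfix⟩ := simplex_brouwer (ι := Fin n × Fin m)
    (fun y z => F (R y) z.1 z.2 / n)
    (by
      apply Continuous.continuousOn
      refine continuous_pi fun z => ?_
      exact ((hFc z.1 z.2).comp hRc).div_const _)
    (by
      intro y hy
      have h := hFm (R y) (hRm y hy)
      refine ⟨fun z => div_nonneg ((h z.1).1 z.2) hnR.le, ?_⟩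
      rw [Fintype.sum_prod_type]
      simp_rw [← sum_div]
      simp only [(h _).2]
      simp [hnR.ne'])
  have hfix' : ∀ i b, F (R y) i b / n = y (i, b) := fun i b => congrFun hfix (i, b)
  have hs : ∀ i, s y i = 1 / n := by
    intro i
    simp only [s]
    simp_rw [← hfix']
    rw [← sum_div, (hFm (R y) (hRm y hy) i).2]
  have hR : ∀ i b, R y i b = F (R y) i b := by
    intro i b
    have h1 : R y i b = y (i, b) * n := by
      simp only [R]
      rw [hs i]
      simp
    rw [h1, ← hfix', div_mul_cancel₀ _ hnR.ne']
  have hmix := hRm y hy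
  generalize R y = x at hR hmix
  refine ⟨x, hmix, fun i b => ?_⟩
  -- some action in the support does not improve
  obtain ⟨b0, hb0, hb0'⟩ : ∃ b0, 0 < x i b0 ∧
      expPay (u i) (Function.update x i (pureStrat b0)) ≤ expPay (u i) x := by
    by_contra hcon
    push Not at hcon
    have h1 := expPay_expand (u i) x i
    have h2 : expPay (u i) x = ∑ b, x i b * expPay (u i) x := by
      rw [← sum_mul, (hmix i).2, one_mul]
    have h3 : ∃ b, 0 < x i b := by
      by_contra h
      push Not at h
      have : ∑ b, x i b ≤ 0 := sum_nonpos fun b _ => h b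
      rw [(hmix i).2] at this
      linarith
    obtain ⟨b1, hb1⟩ := h3
    have : ∑ b, x i b * expPay (u i) x <
        ∑ b, x i b * expPay (u i) (Function.update x i (pureStrat b)) := by
      apply sum_lt_sum
      · intro b _
        rcases ((hmix i).1 b).eq_or_lt with h | h
        · rw [← h]; simp
        · exact (mul_lt_mul_of_pos_left (hcon b h) h).le
      · exact ⟨b1, mem_univ _, mul_lt_mul_of_pos_left (hcon b1 hb1) hb1⟩
    linarith
  have hg : G x i b0 = 0 := max_eq_left (by linarith)
  have h1 := hR i b0
  simp only [F] at h1
  rw [hg, add_zero, eq_div_iff (hden x i).ne'] at h1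
  have h2 : ∑ b', G x i b' = 0 := by
    have : x i b0 * ∑ b', G x i b' = 0 := by linarith
    rcases mul_eq_zero.mp this with h | h
    · exact absurd h hb0.ne'
    · exact h
  have h3 := (sum_eq_zero_iff_of_nonneg (fun b _ => hG0 x i b)).mp h2 b (mem_univ _)
  have h4 : expPay (u i) (Function.update x i (pureStrat b)) - expPay (u i) x ≤ G x i b :=
    le_max_right _ _
  linarith

theorem sum_prod_mixed {n m : ℕ} (x : Fin n → Fin m → ℝ) (hx : ∀ i, IsMixed (x i)) :
    ∑ a : Fin n → Fin m, ∏ i, x i (a i) = 1 := by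
  have := prod_univ_sum (fun _ : Fin n => (univ : Finset (Fin m))) x
  rw [Fintype.piFinset_univ] at this
  rw [← this]
  exact prod_eq_one fun i _ => (hx i).2

theorem expPay_update {n m : ℕ} (u : (Fin n → Fin m) → ℝ) (x : Fin n → Fin m → ℝ) (i : Fin n)
    (hx : ∑ b, x i b = 1) (b : Fin m) :
    expPay u (Function.update x i (pureStrat b)) =
      expPay (fun a => u (Function.update a i b)) x := by
  rw [expPay_expand (fun a => u (Function.update a i b)) x i]
  have key : ∀ c, expPay (fun a => u (Function.update a i b)) (Function.update x i (pureStrat c))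
      = expPay u (Function.update x i (pureStrat b)) := by
    intro c
    unfold expPay
    simp_rw [prod_update_eval, pureStrat, ite_mul, one_mul, zero_mul]
    rw [← sum_filter, ← sum_filter]
    refine sum_bij' (fun a _ => Function.update a i b) (fun a _ => Function.update a i c) ?_ ?_ ?_ ?_ ?_
    · intro a _; simp
    · intro a _; simp
    · intro a ha
      simp only [mem_filter, mem_univ, true_and] at ha
      simp [← ha]
    · intro a ha
      simp only [mem_filter, mem_univ, true_and] at ha
      simp [← ha]
    · intro a _
      congr 1
      apply prod_congr rfl
      intro j hj
      rw [Function.update_of_ne (mem_erase.mp hj).1]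
  simp_rw [key]
  rw [← sum_mul, hx, one_mul]

noncomputable def empDist {n m k : ℕ} (s : Fin n → Fin k → Fin m) : Fin n → Fin m → ℝ :=
  fun i b => (∑ t, if s i t = b then (1 : ℝ) else 0) / k

theorem empDist_mixed {n m k : ℕ} (hk : 0 < k) (s : Fin n → Fin k → Fin m) (i : Fin n) :
    IsMixed (empDist s i) := by
  have hkR : (0 : ℝ) < k := by exact_mod_cast hk
  constructor
  · intro b
    refine div_nonneg (sum_nonneg fun t _ => ?_) hkR.le
    split_ifs <;> norm_num
  · simp only [empDist]
    rw [← sum_div, sum_comm]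
    simp [hkR.ne']

theorem empDist_pay {n m k : ℕ} (v : (Fin n → Fin m) → ℝ) (s : Fin n → Fin k → Fin m) :
    expPay v (empDist s) = (∑ τ : Fin n → Fin k, v (fun i => s i (τ i))) / (k : ℝ) ^ n := by
  unfold expPay empDist
  have h1 : ∀ a : Fin n → Fin m, ∏ i, ((∑ t, if s i t = a i then (1 : ℝ) else 0) / k) =
      (∑ τ : Fin n → Fin k, if (fun i => s i (τ i)) = a then (1 : ℝ) else 0) / (k : ℝ) ^ n := by
    intro a
    rw [prod_div_distrib, prod_const, card_univ, Fintype.card_fin]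
    congr 1
    have := prod_univ_sum (fun _ : Fin n => (univ : Finset (Fin k)))
      (fun i t => if s i t = a i then (1 : ℝ) else 0)
    rw [Fintype.piFinset_univ] at this
    rw [this]
    apply sum_congr rfl
    intro τ _
    rw [prod_ite_zero]
    simp [funext_iff]
  simp_rw [h1, div_mul_eq_mul_div]
  rw [← sum_div]
  congr 1
  simp_rw [sum_mul]
  rw [sum_comm]
  apply sum_congr rfl
  intro τ _
  simp

theorem shift_sum {n k : ℕ} [NeZero k] (g : (Fin n → Fin k) → ℝ) :
    ∑ σ : Fin n → Fin k, ∑ t : Fin k, g (fun i => t + σ i) = k * ∑ τ, g τ := by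
  rw [sum_comm]
  have : ∀ t : Fin k, ∑ σ : Fin n → Fin k, g (fun i => t + σ i) = ∑ τ, g τ := by
    intro t
    exact Equiv.sum_comp (Equiv.addLeft (fun _ : Fin n => t)) g
  simp [this]

theorem sample_mgf {n m k : ℕ} [NeZero k] (x : Fin n → Fin m → ℝ) (h : (Fin n → Fin m) → ℝ)
    (σ : Fin n → Fin k) :
    ∑ s : Fin n → Fin k → Fin m, (∏ i, ∏ t, x i (s i t)) *
        Real.exp (∑ t, h (fun i => s i (t + σ i))) =
      (∑ a : Fin n → Fin m, (∏ i, x i (a i)) * Real.exp (h a)) ^ k := by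
  let e : (Fin n → Fin k → Fin m) ≃ (Fin k → Fin n → Fin m) :=
    { toFun := fun s t i => s i (t + σ i)
      invFun := fun z i t => z (t - σ i) i
      left_inv := fun s => by funext i t; simp
      right_inv := fun z => by funext t i; simp }
  have h1 : (∑ a : Fin n → Fin m, (∏ i, x i (a i)) * Real.exp (h a)) ^ k =
      ∑ z : Fin k → Fin n → Fin m, ∏ t, ((∏ i, x i (z t i)) * Real.exp (h (z t))) := by
    have := prod_univ_sum (fun _ : Fin k => (univ : Finset (Fin n → Fin m)))
      (fun _ a => (∏ i, x i (a i)) * Real.exp (h a))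
    rw [Fintype.piFinset_univ, prod_const, card_univ, Fintype.card_fin] at this
    exact this
  rw [h1, ← Equiv.sum_comp e]
  apply sum_congr rfl
  intro s _
  rw [prod_mul_distrib, Real.exp_sum, prod_comm]
  congr 1
  rw [prod_comm]
  rw [prod_comm (s := univ) (t := univ) (f := fun t i => x i (e s t i))]
  apply prod_congr rfl
  intro i _
  exact (Equiv.prod_comp (Equiv.addRight (σ i)) (fun t => x i (s i t))).symm

theorem sample_total {n m k : ℕ} [NeZero k] (x : Fin n → Fin m → ℝ) (hx : ∀ i, IsMixed (x i)) :
    ∑ s : Fin n → Fin k → Fin m, (∏ i, ∏ t, x i (s i t)) = 1 := by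
  have := sample_mgf (k := k) x (fun _ => 0) (fun _ => 0)
  simpa [sum_prod_mixed x hx] using this

theorem one_mgf {n m : ℕ} (x : Fin n → Fin m → ℝ) (hx : ∀ i, IsMixed (x i))
    (v : (Fin n → Fin m) → ℝ) (hv : ∀ a, v a ∈ Set.Icc (0:ℝ) 1) (θ : ℝ) (hθ : |θ| ≤ 1) :
    ∑ a : Fin n → Fin m, (∏ i, x i (a i)) * Real.exp (θ * (v a - expPay v x)) ≤
      Real.exp (θ ^ 2) := by
  have hP : ∀ a : Fin n → Fin m, 0 ≤ ∏ i, x i (a i) := fun a => prod_nonneg fun i _ => (hx i).1 _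
  have hT := sum_prod_mixed x hx
  have hμ0 : 0 ≤ expPay v x := sum_nonneg fun a _ => mul_nonneg (hP a) (hv a).1
  have hμ1 : expPay v x ≤ 1 := by
    rw [← hT]
    exact sum_le_sum fun a _ => mul_le_of_le_one_right (hP a) (hv a).2
  have hb : ∀ a, Real.exp (θ * (v a - expPay v x)) ≤ 1 + θ * (v a - expPay v x) + θ ^ 2 := by
    intro a
    have h1 : |v a - expPay v x| ≤ 1 := by
      rw [abs_le]; constructor <;> linarith [(hv a).1, (hv a).2]
    have h2 : |θ * (v a - expPay v x)| ≤ 1 := by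
      rw [abs_mul]; exact mul_le_one₀ hθ (abs_nonneg _) h1
    have h3 := (abs_le.mp (Real.abs_exp_sub_one_sub_id_le h2)).2
    have h4 : (θ * (v a - expPay v x)) ^ 2 ≤ θ ^ 2 := by
      rw [mul_pow]
      exact mul_le_of_le_one_right (sq_nonneg _) ((sq_le_one_iff_abs_le_one _).mpr h1)
    linarith
  calc _ ≤ ∑ a : Fin n → Fin m, (∏ i, x i (a i)) * (1 + θ * (v a - expPay v x) + θ ^ 2) :=
        sum_le_sum fun a _ => mul_le_mul_of_nonneg_left (hb a) (hP a)
    _ = ∑ a : Fin n → Fin m, ((1 - θ * expPay v x + θ ^ 2) * (∏ i, x i (a i)) +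
          θ * ((∏ i, x i (a i)) * v a)) := sum_congr rfl fun a _ => by ring
    _ = 1 + θ ^ 2 := by
        rw [sum_add_distrib, ← mul_sum, ← mul_sum, hT]
        change _ + θ * expPay v x = _
        ring
    _ ≤ _ := by linarith [Real.add_one_le_exp (θ ^ 2)]

theorem sample_conc {n m k : ℕ} [NeZero k] (x : Fin n → Fin m → ℝ) (hx : ∀ i, IsMixed (x i))
    (v : (Fin n → Fin m) → ℝ) (hv : ∀ a, v a ∈ Set.Icc (0:ℝ) 1) (θ : ℝ) (hθ : |θ| ≤ 1) :
    ∑ s : Fin n → Fin k → Fin m, (∏ i, ∏ t, x i (s i t)) *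
        Real.exp (k * θ * (expPay v (empDist s) - expPay v x)) ≤ Real.exp (k * θ ^ 2) := by
  have hkR : (0 : ℝ) < k := by exact_mod_cast Nat.pos_of_ne_zero (NeZero.ne k)
  have hkn : (0 : ℝ) < (k : ℝ) ^ n := by positivity
  have hW : ∀ s : Fin n → Fin k → Fin m, 0 ≤ ∏ i, ∏ t, x i (s i t) := fun s =>
    prod_nonneg fun i _ => prod_nonneg fun t _ => (hx i).1 _
  have hw1 : ∑ _σ : Fin n → Fin k, ((k : ℝ) ^ n)⁻¹ = 1 := by
    simp [hkR.ne']
  let h : (Fin n → Fin m) → ℝ := fun a => θ * (v a - expPay v x)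
  have hexp : ∀ s : Fin n → Fin k → Fin m, k * θ * (expPay v (empDist s) - expPay v x) =
      ∑ σ : Fin n → Fin k, ((k : ℝ) ^ n)⁻¹ • ∑ t, h (fun i => s i (t + σ i)) := by
    intro s
    have h1 := shift_sum (n := n) (k := k) (fun τ => v (fun i => s i (τ i)))
    rw [empDist_pay]
    simp only [h, smul_eq_mul]
    simp_rw [← mul_sum, sum_sub_distrib]
    rw [h1]
    simp only [sum_const, card_univ, Fintype.card_fin, Fintype.card_fun, nsmul_eq_mul]
    push_cast
    field_simp
  have hJ : ∀ s : Fin n → Fin k → Fin m,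
      Real.exp (k * θ * (expPay v (empDist s) - expPay v x)) ≤
      ∑ σ : Fin n → Fin k, ((k : ℝ) ^ n)⁻¹ * Real.exp (∑ t, h (fun i => s i (t + σ i))) := by
    intro s
    rw [hexp s]
    exact convexOn_exp.map_sum_le (fun _ _ => by positivity) hw1 (fun _ _ => Set.mem_univ _)
  calc _ ≤ ∑ s : Fin n → Fin k → Fin m, (∏ i, ∏ t, x i (s i t)) *
        ∑ σ : Fin n → Fin k, ((k : ℝ) ^ n)⁻¹ * Real.exp (∑ t, h (fun i => s i (t + σ i))) :=
        sum_le_sum fun s _ => mul_le_mul_of_nonneg_left (hJ s) (hW s)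
    _ = ∑ σ : Fin n → Fin k, ((k : ℝ) ^ n)⁻¹ * ∑ s : Fin n → Fin k → Fin m,
          (∏ i, ∏ t, x i (s i t)) * Real.exp (∑ t, h (fun i => s i (t + σ i))) := by
        simp_rw [mul_sum]
        rw [sum_comm]
        exact sum_congr rfl fun σ _ => sum_congr rfl fun s _ => by ring
    _ = (∑ a : Fin n → Fin m, (∏ i, x i (a i)) * Real.exp (h a)) ^ k := by
        simp_rw [sample_mgf x h]
        rw [← sum_mul, hw1, one_mul]
    _ ≤ (Real.exp (θ ^ 2)) ^ k := by
        refine pow_le_pow_left₀ ?_ (one_mgf x hx v hv θ hθ) k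
        exact sum_nonneg fun a _ => mul_nonneg (prod_nonneg fun i _ => (hx i).1 _)
          (Real.exp_pos _).le
    _ = _ := by rw [← Real.exp_nat_mul]

/-- The numerical estimate. -/
theorem numeric_bound (ε δ : ℝ) (hε : ε ∈ Set.Ioo (0:ℝ) 1) (hδ : δ ∈ Set.Ioo (0:ℝ) 1)
    (m : ℕ) (hm : 2 ≤ m) (k : ℕ)
    (hk : 32 * (Real.log 8 + Real.log m - Real.log ε - Real.log δ) / ε ^ 2 ≤ (k : ℝ)) :
    0 < k ∧ (m + 1) * Real.exp (-(k * ε ^ 2 / 16)) ≤ δ := by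
  obtain ⟨hε0, hε1⟩ := hε
  obtain ⟨hδ0, hδ1⟩ := hδ
  have hmR : (2 : ℝ) ≤ m := by exact_mod_cast hm
  have l1 : 0 < Real.log 8 := Real.log_pos (by norm_num)
  have l2 : 0 < Real.log m := Real.log_pos (by linarith)
  have l3 : Real.log ε < 0 := Real.log_neg hε0 hε1
  have l4 : Real.log δ < 0 := Real.log_neg hδ0 hδ1
  set L := Real.log 8 + Real.log m - Real.log ε - Real.log δ with hL
  have hL0 : 0 < L := by linarith
  have he2 : 0 < ε ^ 2 := by positivity
  constructor
  · have : (0 : ℝ) < k := lt_of_lt_of_le (by positivity) hk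
    exact_mod_cast this
  · rw [div_le_iff₀ he2] at hk
    have h1 : Real.exp (-(k * ε ^ 2 / 16)) ≤ Real.exp (-L) := by
      apply Real.exp_le_exp.mpr; linarith
    have h2 : Real.exp (-L) = ε * δ / (8 * m) := by
      rw [hL, show -(Real.log 8 + Real.log m - Real.log ε - Real.log δ) =
        (Real.log ε + Real.log δ) - (Real.log 8 + Real.log m) by ring, Real.exp_sub, Real.exp_add,
        Real.exp_add, Real.exp_log hε0, Real.exp_log hδ0, Real.exp_log (by norm_num),
        Real.exp_log (by linarith)]
    calc (m + 1) * Real.exp (-(k * ε ^ 2 / 16)) ≤ (m + 1) * (ε * δ / (8 * m)) := by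
          rw [← h2]; gcongr
      _ ≤ (8 * m) * (1 * δ / (8 * m)) := by gcongr; linarith
      _ = δ := by field_simp

/-- Every `n`-player `m`-action game with payoffs in `[0,1]` admits a profile of `k`-uniform
mixed strategies that is an `(ε,δ)`-weak approximate Nash equilibrium, provided
`k ≥ 32(ln 8 + ln m − ln ε − ln δ)/ε²`. -/
theorem stmt0 (ε δ : ℝ) (hε : ε ∈ Set.Ioo (0:ℝ) 1) (hδ : δ ∈ Set.Ioo (0:ℝ) 1)
    (m : ℕ) (hm : 2 ≤ m) (k : ℕ)
    (hk : 32 * (Real.log 8 + Real.log m - Real.log ε - Real.log δ) / ε ^ 2 ≤ (k : ℝ))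
    (n : ℕ) (u : Fin n → (Fin n → Fin m) → ℝ)
    (hu : ∀ i a, u i a ∈ Set.Icc (0:ℝ) 1) :
    ∃ x : Fin n → Fin m → ℝ,
      (∀ i, IsMixed (x i)) ∧
      (∀ i b, ∃ c : ℕ, x i b = (c : ℝ) / k) ∧
      ∃ S : Finset (Fin n), (1 - δ) * n ≤ S.card ∧
        ∀ i ∈ S, ∀ b : Fin m,
          expPay (u i) (Function.update x i (pureStrat b)) - ε ≤ expPay (u i) x := by
  classical
  obtain ⟨hk0, hnum⟩ := numeric_bound ε δ hε hδ m hm k hk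
  have : NeZero k := ⟨hk0.ne'⟩
  obtain ⟨hε0, hε1⟩ := hε
  have hfreq : ∀ s : Fin n → Fin k → Fin m, ∀ i b, ∃ c : ℕ, empDist s i b = (c : ℝ) / k := by
    intro s i b
    exact ⟨(univ.filter fun t => s i t = b).card, by simp [empDist]⟩
  rcases Nat.eq_zero_or_pos n with hn | hn
  · subst hn
    exact ⟨fun i => i.elim0, fun i => i.elim0, fun i => i.elim0, univ, by simp, fun i => i.elim0⟩
  obtain ⟨x, hx, hnash⟩ := nash_exists n m hn (by omega) u
  let W : (Fin n → Fin k → Fin m) → ℝ := fun s => ∏ i, ∏ t, x i (s i t)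
  have hW : ∀ s, 0 ≤ W s := fun s =>
    prod_nonneg fun i _ => prod_nonneg fun t _ => (hx i).1 _
  have hW1 : ∑ s, W s = 1 := sample_total x hx
  let bad : (Fin n → Fin k → Fin m) → Fin n → Prop := fun s i =>
    ∃ b, expPay (u i) (empDist s) <
      expPay (u i) (Function.update (empDist s) i (pureStrat b)) - ε
  have hbad : ∀ i, ∑ s, W s * (if bad s i then 1 else 0) ≤ δ := by
    intro i
    let v : Fin m → (Fin n → Fin m) → ℝ := fun b a => u i (Function.update a i b)
    have hθ : |ε / 4| ≤ 1 := by rw [abs_le]; constructor <;> linarith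
    have hθ' : |-(ε / 4)| ≤ 1 := by rw [abs_neg]; exact hθ
    have c1 := fun b => sample_conc (k := k) x hx (v b) (fun a => hu i _) (ε / 4) hθ
    have c2 := sample_conc (k := k) x hx (u i) (hu i) (-(ε / 4)) hθ'
    let Z : ℝ := Real.exp (-(k * ε ^ 2 / 8))
    have hZ : 0 < Z := Real.exp_pos _
    have hpt : ∀ s, (if bad s i then (1 : ℝ) else 0) ≤
        ∑ b, Z * Real.exp (k * (ε / 4) * (expPay (v b) (empDist s) - expPay (v b) x)) +
        Z * Real.exp (k * (-(ε / 4)) * (expPay (u i) (empDist s) - expPay (u i) x)) := by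
      intro s
      have hpos : ∀ b, 0 ≤ Z * Real.exp (k * (ε / 4) *
          (expPay (v b) (empDist s) - expPay (v b) x)) := fun b => by positivity
      have hpos2 : 0 ≤ Z * Real.exp (k * (-(ε / 4)) *
          (expPay (u i) (empDist s) - expPay (u i) x)) := by positivity
      split_ifs with hb
      · obtain ⟨b, hb⟩ := hb
        rw [expPay_update _ _ _ (empDist_mixed hk0 s i).2] at hb
        have hn := hnash i b
        rw [expPay_update _ _ _ (hx i).2] at hn
        change _ < expPay (v b) (empDist s) - ε at hb
        change expPay (v b) x ≤ _ at hn
        have hkε : (0 : ℝ) < k * (ε / 4) := by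
          have : (0 : ℝ) < k := by exact_mod_cast hk0
          positivity
        by_cases hcase : ε / 2 ≤ expPay (v b) (empDist s) - expPay (v b) x
        · have h1 := single_le_sum (fun b _ => hpos b) (mem_univ b)
          have h2 : 1 ≤ Z * Real.exp (k * (ε / 4) *
              (expPay (v b) (empDist s) - expPay (v b) x)) := by
            simp only [Z]
            rw [← Real.exp_add]
            apply Real.one_le_exp
            have := mul_le_mul_of_nonneg_left hcase hkε.le
            linarith
          linarith
        · push Not at hcase
          have h0 : 0 ≤ ∑ b, Z * Real.exp (k * (ε / 4) *
              (expPay (v b) (empDist s) - expPay (v b) x)) := sum_nonneg fun b _ => hpos b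
          have h2 : 1 ≤ Z * Real.exp (k * (-(ε / 4)) *
              (expPay (u i) (empDist s) - expPay (u i) x)) := by
            simp only [Z]
            rw [← Real.exp_add]
            apply Real.one_le_exp
            have h3 : ε / 2 ≤ -(expPay (u i) (empDist s) - expPay (u i) x) := by linarith
            have := mul_le_mul_of_nonneg_left h3 hkε.le
            linarith
          linarith
      · exact add_nonneg (sum_nonneg fun b _ => hpos b) hpos2
    have hZe : Z * Real.exp (k * (ε / 4) ^ 2) = Real.exp (-(k * ε ^ 2 / 16)) := by
      simp only [Z]
      rw [← Real.exp_add]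
      congr 1
      ring
    calc ∑ s, W s * (if bad s i then (1 : ℝ) else 0)
        ≤ ∑ s, W s * (∑ b, Z * Real.exp (k * (ε / 4) *
            (expPay (v b) (empDist s) - expPay (v b) x)) +
          Z * Real.exp (k * (-(ε / 4)) * (expPay (u i) (empDist s) - expPay (u i) x))) :=
          sum_le_sum fun s _ => mul_le_mul_of_nonneg_left (hpt s) (hW s)
      _ = ∑ b, Z * (∑ s, W s * Real.exp (k * (ε / 4) *
            (expPay (v b) (empDist s) - expPay (v b) x))) +
          Z * ∑ s, W s * Real.exp (k * (-(ε / 4)) *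
            (expPay (u i) (empDist s) - expPay (u i) x)) := by
          simp_rw [mul_add, sum_add_distrib, mul_sum]
          rw [sum_comm]
          congr 1
          · exact sum_congr rfl fun b _ => sum_congr rfl fun s _ => by ring
          · exact sum_congr rfl fun s _ => by ring
      _ ≤ ∑ _b : Fin m, Z * Real.exp (k * (ε / 4) ^ 2) + Z * Real.exp (k * (-(ε / 4)) ^ 2) :=
          add_le_add (sum_le_sum fun b _ => mul_le_mul_of_nonneg_left (c1 b) hZ.le)
            (mul_le_mul_of_nonneg_left c2 hZ.le)
      _ = (m + 1) * Real.exp (-(k * ε ^ 2 / 16)) := by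
          rw [neg_sq, hZe]
          simp
          ring
      _ ≤ δ := hnum
  have hcnt : ∃ s, ((univ.filter fun i => bad s i).card : ℝ) ≤ δ * n := by
    by_contra hcon
    push Not at hcon
    have h1 : ∑ s, W s * ((univ.filter fun i => bad s i).card : ℝ) ≤ δ * n := by
      have : ∀ s, W s * ((univ.filter fun i => bad s i).card : ℝ) =
          ∑ i, W s * (if bad s i then (1 : ℝ) else 0) := by
        intro s
        rw [← mul_sum, sum_boole]
      simp_rw [this]
      rw [sum_comm]
      calc _ ≤ ∑ _i : Fin n, δ := sum_le_sum fun i _ => hbad i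
        _ = δ * n := by simp; ring
    have h2 : ∃ s, 0 < W s := by
      by_contra h
      push Not at h
      have : ∑ s, W s ≤ 0 := sum_nonpos fun s _ => h s
      linarith
    obtain ⟨s0, hs0⟩ := h2
    have h3 : ∑ s, W s * (δ * n) < ∑ s, W s * ((univ.filter fun i => bad s i).card : ℝ) :=
      sum_lt_sum (fun s _ => mul_le_mul_of_nonneg_left (hcon s).le (hW s))
        ⟨s0, mem_univ _, mul_lt_mul_of_pos_left (hcon s0) hs0⟩
    rw [← sum_mul, hW1, one_mul] at h3
    linarith
  obtain ⟨s, hs⟩ := hcnt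
  refine ⟨empDist s, empDist_mixed hk0 s, hfreq s, univ.filter fun i => ¬ bad s i, ?_, ?_⟩
  · have h1 := card_filter_add_card_filter_not (s := (univ : Finset (Fin n))) (fun i => bad s i)
    rw [card_univ, Fintype.card_fin] at h1
    have h2 : ((univ.filter fun i => bad s i).card : ℝ) +
        ((univ.filter fun i => ¬ bad s i).card : ℝ) = n := by exact_mod_cast h1
    linarith
  · intro i hi b
    simp only [mem_filter, mem_univ, true_and, bad, not_exists, not_lt] at hi
    exact hi b
end

section
/- Let (Ω_1,μ_1),…,(Ω_n,μ_n) be discrete probability spaces, let μ = μ_1 × ⋯ × μ_n be the product measure on Ω = Ω_1 × ⋯ × Ω_n, let ε̂ > 0, let k ∈ ℕ, and let f : Ω → [0,1]. For each i, let μ_i^{(k)} be the (random) empirical distribution of k i.i.d. samples from μ_i, with the sampling independent across the coordinates i. Then the probability that |E_{μ_1^{(k)} × ⋯ × μ_n^{(k)}}[f] − E_μ[f]| > ε̂ is at most (4/ε̂)·e^{−(ε̂²/8)·k}. -/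
open Finset

/-- Average form of the empirical expectation. -/
lemma emp_eq (n k : ℕ) (Ω : Fin n → Type) [∀ i, Fintype (Ω i)] [∀ i, DecidableEq (Ω i)]
    (f : ((i : Fin n) → Ω i) → ℝ) (X : (i : Fin n) → Fin k → Ω i) :
    (∑ ω : (i : Fin n) → Ω i,
      (∏ i, ((Finset.univ.filter fun j => X i j = ω i).card : ℝ) / k) * f ω)
      = ∑ j : Fin n → Fin k, ((k:ℝ)⁻¹) ^ n * f (fun i => X i (j i)) := by
  have h1 : ∀ ω : (i : Fin n) → Ω i,
      (∏ i, ((Finset.univ.filter fun j => X i j = ω i).card : ℝ) / k)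
        = ∑ j : Fin n → Fin k, if (fun i => X i (j i)) = ω then ((k:ℝ)⁻¹) ^ n else 0 := by
    intro ω
    have h2 : ∀ i, ((Finset.univ.filter fun j => X i j = ω i).card : ℝ) / k
        = ∑ j : Fin k, if X i j = ω i then (k:ℝ)⁻¹ else 0 := by
      intro i
      rw [← Finset.sum_filter, Finset.sum_const, nsmul_eq_mul, div_eq_mul_inv]
    simp_rw [h2]
    rw [Finset.prod_univ_sum, Fintype.piFinset_univ]
    refine Finset.sum_congr rfl fun j _ => ?_
    split_ifs with h
    · subst h
      simp
    · have : ∃ i, X i (j i) ≠ ω i := by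
        by_contra hc
        push Not at hc
        exact h (funext hc)
      obtain ⟨i, hi⟩ := this
      exact Finset.prod_eq_zero (Finset.mem_univ i) (by simp [hi])
  simp_rw [h1, Finset.sum_mul]
  rw [Finset.sum_comm]
  refine Finset.sum_congr rfl fun j _ => ?_
  simp

/-- The product weights sum to one. -/
lemma prod_sum_one (n : ℕ) (Ω : Fin n → Type) [∀ i, Fintype (Ω i)]
    (μ : (i : Fin n) → Ω i → ℝ) (hμ1 : ∀ i, ∑ ω, μ i ω = 1) :
    ∑ ω : (i : Fin n) → Ω i, ∏ i, μ i (ω i) = 1 := by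
  have := Finset.prod_univ_sum (fun i : Fin n => (Finset.univ : Finset (Ω i))) μ
  rw [Fintype.piFinset_univ] at this
  rw [← this]
  simp [hμ1]

/-- Independence of the diagonal samples. -/
lemma diag_indep (n k : ℕ) (Ω : Fin n → Type) [∀ i, Fintype (Ω i)]
    (μ : (i : Fin n) → Ω i → ℝ) (h : ((i : Fin n) → Ω i) → ℝ) :
    ∑ X : (i : Fin n) → Fin k → Ω i,
        (∏ i, ∏ j, μ i (X i j)) * ∏ t, h (fun i => X i t)
      = (∑ ω : (i : Fin n) → Ω i, (∏ i, μ i (ω i)) * h ω) ^ k := by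
  have := Finset.prod_univ_sum (fun _ : Fin k => (Finset.univ : Finset ((i : Fin n) → Ω i)))
    (fun _ ω => (∏ i, μ i (ω i)) * h ω)
  rw [Fintype.piFinset_univ] at this
  rw [Finset.prod_const, Finset.card_univ, Fintype.card_fin] at this
  rw [this]
  refine Fintype.sum_equiv (Equiv.piComm fun (i : Fin n) (_ : Fin k) => Ω i) _ _ fun X => ?_
  rw [Finset.prod_mul_distrib, Finset.prod_comm]
  rfl

/-- Shifted version of the independence of diagonals. -/
lemma shift_indep (n k : ℕ) [NeZero k] (Ω : Fin n → Type) [∀ i, Fintype (Ω i)]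
    (μ : (i : Fin n) → Ω i → ℝ) (h : ((i : Fin n) → Ω i) → ℝ) (s : Fin n → Fin k) :
    ∑ X : (i : Fin n) → Fin k → Ω i,
        (∏ i, ∏ j, μ i (X i j)) * ∏ t, h (fun i => X i (t + s i))
      = (∑ ω : (i : Fin n) → Ω i, (∏ i, μ i (ω i)) * h ω) ^ k := by
  rw [← diag_indep]
  refine Fintype.sum_equiv
    (Equiv.piCongrRight fun i => Equiv.arrowCongr (Equiv.addRight (s i)).symm (Equiv.refl (Ω i)))
    _ _ fun X => ?_
  congr 1
  refine Finset.prod_congr rfl fun i _ => ?_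
  exact (Equiv.prod_comp (Equiv.addRight (s i)) fun j => μ i (X i j)).symm

/-- Crude Hoeffding lemma. -/
lemma crude_hoeffding {α : Type} [Fintype α] (p g : α → ℝ) (hp0 : ∀ a, 0 ≤ p a)
    (hp1 : ∑ a, p a = 1) (hg : ∀ a, g a ∈ Set.Icc (0:ℝ) 1) (r : ℝ) :
    ∑ a, p a * Real.exp (r * (g a - ∑ b, p b * g b)) ≤ Real.exp (r ^ 2 / 2) := by
  set m := ∑ b, p b * g b with hm
  have hm0 : 0 ≤ m := Finset.sum_nonneg fun a _ => mul_nonneg (hp0 a) (hg a).1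
  have hm1 : m ≤ 1 := by
    rw [← hp1]
    exact Finset.sum_le_sum fun a _ => mul_le_of_le_one_right (hp0 a) (hg a).2
  have key : ∀ y : ℝ, -1 ≤ y → y ≤ 1 →
      Real.exp (r * y) ≤ Real.cosh r + y * Real.sinh r := by
    intro y h1 h2
    have := convexOn_exp.2 (Set.mem_univ r) (Set.mem_univ (-r))
      (show 0 ≤ (1 + y) / 2 by linarith) (show 0 ≤ (1 - y) / 2 by linarith) (by ring)
    simp only [smul_eq_mul] at this
    rw [Real.cosh_eq, Real.sinh_eq]
    calc Real.exp (r * y) = Real.exp ((1 + y) / 2 * r + (1 - y) / 2 * -r) := by ring_nf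
      _ ≤ _ := this
      _ = _ := by ring
  calc ∑ a, p a * Real.exp (r * (g a - m))
      ≤ ∑ a, p a * (Real.cosh r + (g a - m) * Real.sinh r) :=
        Finset.sum_le_sum fun a _ => mul_le_mul_of_nonneg_left
          (key _ (by linarith [(hg a).1]) (by linarith [(hg a).2])) (hp0 a)
    _ = ∑ a, (p a * (Real.cosh r - m * Real.sinh r) + (p a * g a) * Real.sinh r) :=
        Finset.sum_congr rfl fun a _ => by ring
    _ = Real.cosh r := by
        rw [Finset.sum_add_distrib, ← Finset.sum_mul, ← Finset.sum_mul, hp1, ← hm]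
        ring
    _ ≤ _ := Real.cosh_le_exp_half_sq r

/-- Moment generating function bound for the empirical deviation. -/
lemma emp_mgf (n k : ℕ) [NeZero k] (Ω : Fin n → Type) [∀ i, Fintype (Ω i)]
    (μ : (i : Fin n) → Ω i → ℝ) (hμ0 : ∀ i ω, 0 ≤ μ i ω) (hμ1 : ∀ i, ∑ ω, μ i ω = 1)
    (f : ((i : Fin n) → Ω i) → ℝ) (hf : ∀ ω, f ω ∈ Set.Icc (0:ℝ) 1) (r : ℝ) :
    ∑ X : (i : Fin n) → Fin k → Ω i,
        (∏ i, ∏ j, μ i (X i j)) *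
          Real.exp (k * r * ((∑ j : Fin n → Fin k, ((k:ℝ)⁻¹) ^ n * f (fun i => X i (j i))) -
                ∑ ω : (i : Fin n) → Ω i, (∏ i, μ i (ω i)) * f ω))
      ≤ Real.exp (k * (r ^ 2 / 2)) := by
  have hk : (k:ℝ) ≠ 0 := Nat.cast_ne_zero.2 (NeZero.ne k)
  set m := ∑ ω : (i : Fin n) → Ω i, (∏ i, μ i (ω i)) * f ω with hm
  have hw1 : ∑ _j : Fin n → Fin k, ((k:ℝ)⁻¹) ^ n = 1 := by
    simp [Finset.sum_const, ← mul_pow, hk]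
  have hw0 : 0 ≤ ((k:ℝ)⁻¹) ^ n := by positivity
  have hW0 : ∀ X : (i : Fin n) → Fin k → Ω i, 0 ≤ ∏ i, ∏ j, μ i (X i j) := fun X =>
    Finset.prod_nonneg fun i _ => Finset.prod_nonneg fun j _ => hμ0 _ _
  have hav : ∀ X : (i : Fin n) → Fin k → Ω i,
      k * r * ((∑ j : Fin n → Fin k, ((k:ℝ)⁻¹) ^ n * f (fun i => X i (j i))) - m)
      = ∑ j : Fin n → Fin k, ((k:ℝ)⁻¹) ^ n *
          ∑ t : Fin k, r * (f (fun i => X i (t + j i)) - m) := by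
    intro X
    have h1 : ∀ t : Fin k, ∑ j : Fin n → Fin k, ((k:ℝ)⁻¹) ^ n * f (fun i => X i (t + j i))
        = ∑ j : Fin n → Fin k, ((k:ℝ)⁻¹) ^ n * f (fun i => X i (j i)) := fun t =>
      Equiv.sum_comp (Equiv.addLeft (fun _ : Fin n => t))
        (fun j : Fin n → Fin k => ((k:ℝ)⁻¹) ^ n * f (fun i => X i (j i)))
    simp_rw [Finset.mul_sum]
    rw [Finset.sum_comm]
    have h2 : ∀ t : Fin k, ∑ j : Fin n → Fin k,
        ((k:ℝ)⁻¹) ^ n * (r * (f (fun i => X i (t + j i)) - m))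
        = r * ((∑ j : Fin n → Fin k, ((k:ℝ)⁻¹) ^ n * f (fun i => X i (j i))) - m) := by
      intro t
      rw [← h1 t]
      calc _ = ∑ j : Fin n → Fin k, (r * (((k:ℝ)⁻¹) ^ n * f (fun i => X i (t + j i)))
            - ((k:ℝ)⁻¹) ^ n * (r * m)) := Finset.sum_congr rfl fun j _ => by ring
        _ = _ := by
          rw [Finset.sum_sub_distrib, ← Finset.mul_sum, ← Finset.sum_mul, hw1]
          ring
    rw [Finset.sum_congr rfl fun t _ => h2 t]
    simp only [Finset.sum_const, Finset.card_univ, Fintype.card_fin, nsmul_eq_mul]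
    ring
  have hjen : ∀ X : (i : Fin n) → Fin k → Ω i,
      Real.exp (k * r * ((∑ j : Fin n → Fin k, ((k:ℝ)⁻¹) ^ n * f (fun i => X i (j i))) - m))
      ≤ ∑ j : Fin n → Fin k, ((k:ℝ)⁻¹) ^ n *
          ∏ t : Fin k, Real.exp (r * (f (fun i => X i (t + j i)) - m)) := by
    intro X
    rw [hav X]
    simp_rw [← Real.exp_sum]
    have := convexOn_exp.map_sum_le (t := (Finset.univ : Finset (Fin n → Fin k)))
      (w := fun _ => ((k:ℝ)⁻¹) ^ n)
      (p := fun j => ∑ t : Fin k, r * (f (fun i => X i (t + j i)) - m))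
      (fun _ _ => hw0) hw1 (fun _ _ => Set.mem_univ _)
    simpa only [smul_eq_mul] using this
  calc _ ≤ ∑ X : (i : Fin n) → Fin k → Ω i, (∏ i, ∏ j, μ i (X i j)) *
        ∑ j : Fin n → Fin k, ((k:ℝ)⁻¹) ^ n *
          ∏ t : Fin k, Real.exp (r * (f (fun i => X i (t + j i)) - m)) :=
        Finset.sum_le_sum fun X _ => mul_le_mul_of_nonneg_left (hjen X) (hW0 X)
    _ = ∑ j : Fin n → Fin k, ((k:ℝ)⁻¹) ^ n * ∑ X : (i : Fin n) → Fin k → Ω i,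
        (∏ i, ∏ j, μ i (X i j)) *
          ∏ t : Fin k, Real.exp (r * (f (fun i => X i (t + j i)) - m)) := by
        simp_rw [Finset.mul_sum]
        rw [Finset.sum_comm]
        exact Finset.sum_congr rfl fun j _ => Finset.sum_congr rfl fun X _ => by ring
    _ ≤ ∑ j : Fin n → Fin k, ((k:ℝ)⁻¹) ^ n * Real.exp (k * (r ^ 2 / 2)) := by
        refine Finset.sum_le_sum fun j _ => mul_le_mul_of_nonneg_left ?_ hw0
        rw [shift_indep n k Ω μ (fun ω => Real.exp (r * (f ω - m))) j, Real.exp_nat_mul]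
        refine pow_le_pow_left₀ (Finset.sum_nonneg fun ω _ => mul_nonneg
          (Finset.prod_nonneg fun i _ => hμ0 _ _) (Real.exp_pos _).le) ?_ k
        exact crude_hoeffding (fun ω : (i : Fin n) → Ω i => ∏ i, μ i (ω i)) f
          (fun ω => Finset.prod_nonneg fun i _ => hμ0 _ _) (prod_sum_one n Ω μ hμ1) hf r
    _ = _ := by rw [← Finset.sum_mul, hw1, one_mul]

/-- Concentration of the empirical product distribution (Babichenko–Barman–Peretz).
For discrete (finite) probability spaces `(Ω i, μ i)`, a function `f` with values in `[0,1]`,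
and `k` i.i.d. samples `X i 1, …, X i k` from each `μ i` (independent across coordinates),
the probability that the expectation of `f` under the product of the empirical distributions
deviates from its expectation under `μ = Π μ i` by more than `ε` is at most
`(4/ε)·exp(−(ε²/8)k)`.  Here the probability is written explicitly as a sum over all sample
realizations `X` weighted by their probability. -/
theorem stmt1 (n k : ℕ) (Ω : Fin n → Type) [∀ i, Fintype (Ω i)] [∀ i, DecidableEq (Ω i)]
    (μ : (i : Fin n) → Ω i → ℝ) (hμ0 : ∀ i ω, 0 ≤ μ i ω) (hμ1 : ∀ i, ∑ ω, μ i ω = 1)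
    (ε : ℝ) (hε : 0 < ε)
    (f : ((i : Fin n) → Ω i) → ℝ) (hf : ∀ ω, f ω ∈ Set.Icc (0:ℝ) 1) :
    ∑ X : (i : Fin n) → Fin k → Ω i,
        (∏ i, ∏ j, μ i (X i j)) *
          (if ε <
              |(∑ ω : (i : Fin n) → Ω i,
                  (∏ i, ((Finset.univ.filter fun j => X i j = ω i).card : ℝ) / k) * f ω) -
                ∑ ω : (i : Fin n) → Ω i, (∏ i, μ i (ω i)) * f ω|
            then (1:ℝ) else 0)
      ≤ 4 / ε * Real.exp (-(ε ^ 2 / 8) * k) := by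
  have hW0 : ∀ X : (i : Fin n) → Fin k → Ω i, 0 ≤ ∏ i, ∏ j, μ i (X i j) := fun X =>
    Finset.prod_nonneg fun i _ => Finset.prod_nonneg fun j _ => hμ0 _ _
  have hW1 : ∑ X : (i : Fin n) → Fin k → Ω i, ∏ i, ∏ j, μ i (X i j) = 1 := by
    have := diag_indep n k Ω μ (fun _ => 1)
    simpa [prod_sum_one n Ω μ hμ1] using this
  simp_rw [emp_eq n k Ω f]
  have hm0 : 0 ≤ ∑ ω : (i : Fin n) → Ω i, (∏ i, μ i (ω i)) * f ω :=
    Finset.sum_nonneg fun ω _ => mul_nonneg (Finset.prod_nonneg fun i _ => hμ0 _ _) (hf ω).1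
  have hm1 : ∑ ω : (i : Fin n) → Ω i, (∏ i, μ i (ω i)) * f ω ≤ 1 := by
    rw [← prod_sum_one n Ω μ hμ1]
    exact Finset.sum_le_sum fun ω _ =>
      mul_le_of_le_one_right (Finset.prod_nonneg fun i _ => hμ0 _ _) (hf ω).2
  have hR : 0 ≤ 4 / ε * Real.exp (-(ε ^ 2 / 8) * k) := by positivity
  rcases le_or_gt 1 ε with h1 | h1
  · refine le_trans (le_of_eq (Finset.sum_eq_zero fun X _ => ?_)) hR
    rw [if_neg, mul_zero]
    rw [not_lt]
    refine le_trans ?_ h1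
    have hA0 : 0 ≤ ∑ j : Fin n → Fin k, ((k:ℝ)⁻¹) ^ n * f (fun i => X i (j i)) :=
      Finset.sum_nonneg fun j _ => mul_nonneg (by positivity) (hf _).1
    have hA1 : ∑ j : Fin n → Fin k, ((k:ℝ)⁻¹) ^ n * f (fun i => X i (j i)) ≤ 1 := by
      calc _ ≤ ∑ j : Fin n → Fin k, ((k:ℝ)⁻¹) ^ n :=
            Finset.sum_le_sum fun j _ => mul_le_of_le_one_right (by positivity) (hf _).2
        _ = ((k:ℝ) * (k:ℝ)⁻¹) ^ n := by simp [Finset.sum_const, mul_pow]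
        _ ≤ 1 := pow_le_one₀ (by positivity) mul_inv_le_one
    rw [abs_le]
    constructor <;> linarith
  have h4 : 4 ≤ 4 / ε := by
    rw [le_div_iff₀ hε]
    linarith
  rcases Nat.eq_zero_or_pos k with hk | hk
  · calc _ ≤ ∑ X : (i : Fin n) → Fin k → Ω i, ∏ i, ∏ j, μ i (X i j) :=
          Finset.sum_le_sum fun X _ => mul_le_of_le_one_right (hW0 X) (by split_ifs <;> norm_num)
      _ = 1 := hW1
      _ ≤ 4 / ε * Real.exp (-(ε ^ 2 / 8) * k) := by
          simp only [hk, Nat.cast_zero, mul_zero, Real.exp_zero, mul_one]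
          linarith
  haveI : NeZero k := ⟨hk.ne'⟩
  have hp := emp_mgf n k Ω μ hμ0 hμ1 f hf ε
  have hn := emp_mgf n k Ω μ hμ0 hμ1 f hf (-ε)
  set m := ∑ ω : (i : Fin n) → Ω i, (∏ i, μ i (ω i)) * f ω with hm
  have hkpos : (0:ℝ) < k := Nat.cast_pos.2 hk
  have hmark : ∀ D : ℝ, (if ε < |D| then (1:ℝ) else 0) ≤
      Real.exp (-(k * ε ^ 2)) * (Real.exp (k * ε * D) + Real.exp (k * -ε * D)) := by
    intro D
    split_ifs with h
    · rw [mul_add, ← Real.exp_add, ← Real.exp_add]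
      rcases lt_abs.1 h with h | h
      · have : 1 ≤ Real.exp (-(k * ε ^ 2) + k * ε * D) := by
          rw [Real.one_le_exp_iff]
          have : 0 ≤ k * ε * (D - ε) := mul_nonneg (by positivity) (by linarith)
          linarith
        linarith [Real.exp_pos (-(k * ε ^ 2) + k * -ε * D)]
      · have : 1 ≤ Real.exp (-(k * ε ^ 2) + k * -ε * D) := by
          rw [Real.one_le_exp_iff]
          have : 0 ≤ k * ε * (-D - ε) := mul_nonneg (by positivity) (by linarith)
          linarith
        linarith [Real.exp_pos (-(k * ε ^ 2) + k * ε * D)]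
    · positivity
  calc _ ≤ ∑ X : (i : Fin n) → Fin k → Ω i, (∏ i, ∏ j, μ i (X i j)) *
        (Real.exp (-(k * ε ^ 2)) *
          (Real.exp (k * ε *
            ((∑ j : Fin n → Fin k, ((k:ℝ)⁻¹) ^ n * f (fun i => X i (j i))) - m))
          + Real.exp (k * -ε *
            ((∑ j : Fin n → Fin k, ((k:ℝ)⁻¹) ^ n * f (fun i => X i (j i))) - m)))) :=
        Finset.sum_le_sum fun X _ => mul_le_mul_of_nonneg_left (hmark _) (hW0 X)
    _ = Real.exp (-(k * ε ^ 2)) * (∑ X : (i : Fin n) → Fin k → Ω i, (∏ i, ∏ j, μ i (X i j)) *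
          Real.exp (k * ε *
            ((∑ j : Fin n → Fin k, ((k:ℝ)⁻¹) ^ n * f (fun i => X i (j i))) - m))
        + ∑ X : (i : Fin n) → Fin k → Ω i, (∏ i, ∏ j, μ i (X i j)) *
          Real.exp (k * -ε *
            ((∑ j : Fin n → Fin k, ((k:ℝ)⁻¹) ^ n * f (fun i => X i (j i))) - m))) := by
        rw [← Finset.sum_add_distrib, Finset.mul_sum]
        exact Finset.sum_congr rfl fun X _ => by ring
    _ ≤ Real.exp (-(k * ε ^ 2)) * (Real.exp (k * (ε ^ 2 / 2)) + Real.exp (k * ((-ε) ^ 2 / 2))) :=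
        mul_le_mul_of_nonneg_left (add_le_add hp hn) (Real.exp_pos _).le
    _ = 2 * Real.exp (-(ε ^ 2 / 2) * k) := by
        rw [neg_sq, ← two_mul, mul_left_comm, ← Real.exp_add]
        ring_nf
    _ ≤ 4 / ε * Real.exp (-(ε ^ 2 / 8) * k) := by
        refine mul_le_mul (by linarith) (Real.exp_le_exp.2 ?_) (Real.exp_pos _).le (by linarith)
        have : 0 ≤ ε ^ 2 * k := by positivity
        linarith
end

section
/- For every sufficiently large b ∈ ℕ there exists an n-player binary-action game with n = 2b + C(2b, b) players and a unique exact Nash equilibrium x, such that for every odd k < √(log₂ n)/8, no vertex of the 1/k-grid cube C^k_x containing x is a 0.1-Nash equilibrium. Moreover, in this game there are players who play a pure strategy in the exact equilibrium but who, in every 0.1-Nash equilibrium whose coordinates lie on the 1/k-grid, place probability at most 0.22 on that pure strategy. -/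
open Finset

/-- Expected payoff in a binary-action game, where a mixed strategy of player `i` is
identified with the probability `x i ∈ [0,1]` of playing the first action `0`. -/
noncomputable def expPay2 {n : ℕ} (u : (Fin n → Fin 2) → ℝ) (x : Fin n → ℝ) : ℝ :=
  ∑ a : Fin n → Fin 2, (∏ i, if a i = 0 then x i else 1 - x i) * u a

/-- `x` is a profile of mixed strategies in a binary-action game. -/
def InUnit {n : ℕ} (x : Fin n → ℝ) : Prop := ∀ i, x i ∈ Set.Icc (0:ℝ) 1

/-- `x` is an `ε`-Nash equilibrium of the binary-action game `u` : no player can gain more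
than `ε` by a unilateral deviation to a pure action (probability `1` or `0` on action `0`). -/
noncomputable def ENash2 {n : ℕ} (u : Fin n → (Fin n → Fin 2) → ℝ) (ε : ℝ)
    (x : Fin n → ℝ) : Prop :=
  ∀ i : Fin n, ∀ v : ℝ, (v = 0 ∨ v = 1) →
    expPay2 (u i) (Function.update x i v) ≤ expPay2 (u i) x + ε

/-- All coordinates of `y` lie on the grid `{0, 1/k, …, 1}`. -/
def OnGrid {n : ℕ} (k : ℕ) (y : Fin n → ℝ) : Prop :=
  ∀ i, ∃ c : ℕ, c ≤ k ∧ y i = (c : ℝ) / k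


section Helpers

variable {n : ℕ}

/-- Splitting the expectation along coordinate `i`. -/
noncomputable def restPay (F : (Fin n → Fin 2) → ℝ) (x : Fin n → ℝ) (i : Fin n) (c : Fin 2) : ℝ :=
  ∑ a : {j // j ≠ i} → Fin 2, (∏ j : {j // j ≠ i}, if a j = 0 then x j else 1 - x j) *
    F ((Equiv.funSplitAt i (Fin 2)).symm (c, a))

lemma expPay2_split (F : (Fin n → Fin 2) → ℝ) (x : Fin n → ℝ) (i : Fin n) :
    expPay2 F x = x i * restPay F x i 0 + (1 - x i) * restPay F x i 1 := by
  unfold expPay2 restPay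
  rw [← (Equiv.funSplitAt i (Fin 2)).symm.sum_comp, Fintype.sum_prod_type, Fin.sum_univ_two,
    Finset.mul_sum, Finset.mul_sum]
  congr 1
  · refine Finset.sum_congr rfl fun a _ => ?_
    rw [Fintype.prod_eq_mul_prod_subtype_ne _ i, ← mul_assoc]
    congr 2
    · simp [Equiv.funSplitAt, Equiv.piSplitAt]
    · refine Finset.prod_congr rfl fun j _ => ?_
      simp [Equiv.funSplitAt, Equiv.piSplitAt, j.2]
  · refine Finset.sum_congr rfl fun a _ => ?_
    rw [Fintype.prod_eq_mul_prod_subtype_ne _ i, ← mul_assoc]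
    congr 2
    · simp [Equiv.funSplitAt, Equiv.piSplitAt]
    · refine Finset.prod_congr rfl fun j _ => ?_
      simp [Equiv.funSplitAt, Equiv.piSplitAt, j.2]

lemma restPay_update (F : (Fin n → Fin 2) → ℝ) (x : Fin n → ℝ) (i : Fin n) (c : Fin 2) (v : ℝ) :
    restPay F (Function.update x i v) i c = restPay F x i c := by
  unfold restPay
  refine Finset.sum_congr rfl fun a _ => ?_
  congr 1
  refine Finset.prod_congr rfl fun j _ => ?_
  rw [Function.update_of_ne j.2]

lemma expPay2_prod (φ : Fin n → Fin 2 → ℝ) (x : Fin n → ℝ) :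
    expPay2 (fun a => ∏ i, φ i (a i)) x = ∏ i, (x i * φ i 0 + (1 - x i) * φ i 1) := by
  unfold expPay2
  have h : ∀ i, x i * φ i 0 + (1 - x i) * φ i 1
      = ∑ c : Fin 2, (if c = 0 then x i else 1 - x i) * φ i c := by
    intro i; simp [Fin.sum_univ_two]
  simp_rw [h]
  rw [Finset.prod_univ_sum, Fintype.piFinset_univ]
  refine Finset.sum_congr rfl fun a _ => ?_
  rw [Finset.prod_mul_distrib]

lemma expPay2_one (x : Fin n → ℝ) : expPay2 (fun _ => 1) x = 1 := by
  have := expPay2_prod (fun _ _ => 1) x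
  simpa using this

lemma expPay2_single (φ : Fin 2 → ℝ) (x : Fin n → ℝ) (i : Fin n) :
    expPay2 (fun a => φ (a i)) x = x i * φ 0 + (1 - x i) * φ 1 := by
  have := expPay2_prod (fun j c => if j = i then φ c else 1) x
  simp only [Finset.prod_ite_eq', Finset.mem_univ, if_true] at this
  rw [this, Finset.prod_eq_single i]
  · simp
  · intro j _ hj; simp [hj]
  · simp

lemma expPay2_pair (φ ψ : Fin 2 → ℝ) (x : Fin n → ℝ) (i j : Fin n) (hij : i ≠ j) :
    expPay2 (fun a => φ (a i) * ψ (a j)) x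
      = (x i * φ 0 + (1 - x i) * φ 1) * (x j * ψ 0 + (1 - x j) * ψ 1) := by
  have := expPay2_prod (fun l c => (if l = i then φ c else 1) * (if l = j then ψ c else 1)) x
  simp only [Finset.prod_mul_distrib, Finset.prod_ite_eq', Finset.mem_univ, if_true] at this
  rw [this, Finset.prod_eq_mul i j hij]
  · simp [hij, hij.symm]
  · intro l _ hl; simp [hl.1, hl.2]
  · simp
  · simp

lemma expPay2_sum {κ : Type*} (s : Finset κ) (F : κ → (Fin n → Fin 2) → ℝ) (x : Fin n → ℝ) :
    expPay2 (fun a => ∑ l ∈ s, F l a) x = ∑ l ∈ s, expPay2 (F l) x := by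
  unfold expPay2
  simp_rw [Finset.mul_sum]
  rw [Finset.sum_comm]

lemma expPay2_sub (F G : (Fin n → Fin 2) → ℝ) (x : Fin n → ℝ) :
    expPay2 (fun a => F a - G a) x = expPay2 F x - expPay2 G x := by
  unfold expPay2
  simp_rw [mul_sub]
  rw [Finset.sum_sub_distrib]

lemma expPay2_mul (F : (Fin n → Fin 2) → ℝ) (c : ℝ) (x : Fin n → ℝ) :
    expPay2 (fun a => F a * c) x = expPay2 F x * c := by
  unfold expPay2
  rw [Finset.sum_mul]
  simp_rw [mul_assoc]

lemma expPay2_mono {F G : (Fin n → Fin 2) → ℝ} {x : Fin n → ℝ} (hx : InUnit x)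
    (h : ∀ a, F a ≤ G a) : expPay2 F x ≤ expPay2 G x := by
  unfold expPay2
  refine Finset.sum_le_sum fun a _ => mul_le_mul_of_nonneg_left (h a) ?_
  refine Finset.prod_nonneg fun i _ => ?_
  have := hx i
  split_ifs
  · exact this.1
  · linarith [this.2]

/-- Product of indicators over an injective family of players. -/
lemma expPay2_prodInd {κ : Type*} [Fintype κ] (f : κ → Fin n) (hf : Function.Injective f)
    (x : Fin n → ℝ) :
    expPay2 (fun a => ∏ s, if a (f s) = 0 then (1:ℝ) else 0) x = ∏ s, x (f s) := by
  classical
  have := expPay2_prod (fun l c => if l ∈ Finset.univ.image f then (if c = 0 then (1:ℝ) else 0) else 1) x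
  have h1 : ∀ ψ : Fin n → ℝ, (∏ l, if l ∈ Finset.univ.image f then ψ l else 1) = ∏ s, ψ (f s) := by
    intro ψ
    rw [Finset.prod_ite_mem, Finset.univ_inter, Finset.prod_image (fun _ _ _ _ h => hf h)]
  simp only [h1] at this
  rw [this, ← h1]
  refine Finset.prod_congr rfl fun l _ => ?_
  by_cases hl : l ∈ Finset.univ.image f
  · rw [if_pos hl, if_pos hl, if_pos hl]; simp
  · rw [if_neg hl, if_neg hl, if_neg hl]; simp

/-- Second moment of a signed sum of centred indicators. -/
lemma secondMoment {κ : Type*} [Fintype κ] (f : κ → Fin n) (hf : Function.Injective f)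
    (σ : κ → ℝ) (hσ : ∀ j, σ j ^ 2 = 1) (x : Fin n → ℝ) :
    expPay2 (fun a => (∑ j, σ j * ((if a (f j) = 0 then (1:ℝ) else 0) - x (f j))) ^ 2) x
      ≤ Fintype.card κ / 4 := by
  classical
  have e1 : (fun a : Fin n → Fin 2 =>
      (∑ j, σ j * ((if a (f j) = 0 then (1:ℝ) else 0) - x (f j))) ^ 2)
      = fun a => ∑ j, ∑ l, (σ j * ((if a (f j) = 0 then (1:ℝ) else 0) - x (f j))) *
        (σ l * ((if a (f l) = 0 then (1:ℝ) else 0) - x (f l))) := by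
    funext a
    rw [sq, Finset.sum_mul_sum]
  rw [e1, expPay2_sum]
  have h2 : ∀ j, expPay2 (fun a => ∑ l, (σ j * ((if a (f j) = 0 then (1:ℝ) else 0) - x (f j))) *
        (σ l * ((if a (f l) = 0 then (1:ℝ) else 0) - x (f l)))) x ≤ 1 / 4 := by
    intro j
    rw [expPay2_sum, Finset.sum_eq_single j]
    · rw [expPay2_single (fun c => (σ j * ((if c = 0 then (1:ℝ) else 0) - x (f j))) *
        (σ j * ((if c = 0 then (1:ℝ) else 0) - x (f j)))) x (f j)]
      simp
      have := hσ j
      have e : x (f j) * (σ j * (1 - x (f j)) * (σ j * (1 - x (f j))))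
          + (1 - x (f j)) * (σ j * x (f j) * (σ j * x (f j)))
          = σ j ^ 2 * (x (f j) * (1 - x (f j))) := by ring
      rw [e, this]
      nlinarith [sq_nonneg (x (f j) - 1 / 2)]
    · intro l _ hl
      rw [expPay2_pair (fun c => σ j * ((if c = 0 then (1:ℝ) else 0) - x (f j)))
        (fun c => σ l * ((if c = 0 then (1:ℝ) else 0) - x (f l))) x (f j) (f l)
        (fun h => hl (hf h).symm)]
      simp
      left; ring
    · simp
  calc _ ≤ ∑ j : κ, (1 / 4 : ℝ) := Finset.sum_le_sum fun j _ => h2 j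
    _ = _ := by simp [div_eq_mul_inv]

/-- The game in which action `0` pays `g` and action `1` pays `1 - g`. -/
noncomputable def gameOf (g : Fin n → (Fin n → Fin 2) → ℝ) (i : Fin n) (a : Fin n → Fin 2) : ℝ :=
  if a i = 0 then g i a else 1 - g i a

lemma gameOf_pay (g : Fin n → (Fin n → Fin 2) → ℝ)
    (hg : ∀ i a c, g i (Function.update a i c) = g i a) (i : Fin n) (x : Fin n → ℝ) (v : ℝ) :
    expPay2 (gameOf g i) (Function.update x i v)
      = v * expPay2 (g i) x + (1 - v) * (1 - expPay2 (g i) x) := by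
  have hupd : ∀ (c : Fin 2) (a : {j // j ≠ i} → Fin 2), (Equiv.funSplitAt i (Fin 2)).symm (c, a)
      = Function.update ((Equiv.funSplitAt i (Fin 2)).symm (0, a)) i c := by
    intro c a
    funext j
    by_cases h : j = i
    · subst h; simp [Equiv.funSplitAt, Equiv.piSplitAt]
    · simp [Equiv.funSplitAt, Equiv.piSplitAt, h]
  have hR : ∀ c, restPay (g i) x i c = restPay (g i) x i 0 := by
    intro c
    unfold restPay
    refine Finset.sum_congr rfl fun a _ => ?_
    rw [hupd c a, hg]
  have hG : expPay2 (g i) x = restPay (g i) x i 0 := by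
    rw [expPay2_split _ x i, hR 1]; ring
  have hOne : restPay (fun _ => 1) x i 1 = 1 := by
    have h1 := expPay2_split (fun _ => 1) x i
    rw [expPay2_one] at h1
    have : restPay (fun _ => 1) x i 0 = restPay (fun _ => 1) x i 1 := rfl
    rw [this] at h1
    linarith
  have h0 : restPay (gameOf g i) x i 0 = restPay (g i) x i 0 := by
    unfold restPay gameOf
    refine Finset.sum_congr rfl fun a _ => ?_
    simp [Equiv.funSplitAt, Equiv.piSplitAt]
  have h1 : restPay (gameOf g i) x i 1 = 1 - restPay (g i) x i 1 := by
    rw [← hOne]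
    unfold restPay gameOf
    rw [← Finset.sum_sub_distrib]
    refine Finset.sum_congr rfl fun a _ => ?_
    rw [← mul_sub]
    simp [Equiv.funSplitAt, Equiv.piSplitAt]
  rw [expPay2_split _ _ i, restPay_update, restPay_update, h0, h1, hR 1, ← hG]
  simp

lemma nash_iff (g : Fin n → (Fin n → Fin 2) → ℝ)
    (hg : ∀ i a c, g i (Function.update a i c) = g i a) (ε : ℝ) (x : Fin n → ℝ) :
    ENash2 (gameOf g) ε x ↔ ∀ i, (1 - x i) * (2 * expPay2 (g i) x - 1) ≤ ε ∧
      x i * (1 - 2 * expPay2 (g i) x) ≤ ε := by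
  unfold ENash2
  refine forall_congr' fun i => ?_
  have hx := gameOf_pay g hg i x (x i)
  rw [Function.update_eq_self] at hx
  constructor
  · intro h
    have h0 := h 0 (Or.inl rfl)
    have h1 := h 1 (Or.inr rfl)
    rw [gameOf_pay g hg, hx] at h0 h1
    constructor <;> nlinarith
  · rintro ⟨h0, h1⟩ v (rfl | rfl) <;> rw [gameOf_pay g hg, hx] <;> nlinarith

end Helpers

/-- Roles of players: matching-pennies pairs, testers, final players. -/
abbrev PRole (b r : ℕ) : Type := (Fin b × Bool) ⊕ ((Fin b → Bool) ⊕ Fin r)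

/-- Sign attached to a boolean. -/
def sgnB (c : Bool) : ℝ := if c then 1 else -1

/-- Statistic of tester `s`. -/
noncomputable def statT {n b r : ℕ} (e : PRole b r ≃ Fin n) (s : Fin b → Bool)
    (a : Fin n → Fin 2) : ℝ :=
  ∑ j, sgnB (s j) * ((if a (e (Sum.inl (j, true))) = 0 then (1:ℝ) else 0) - 1 / 2)

/-- Payoff of action `0` for each role. -/
noncomputable def rolePay {n b r : ℕ} (e : PRole b r ≃ Fin n) :
    PRole b r → (Fin n → Fin 2) → ℝ
  | Sum.inl (j, true), a => if a (e (Sum.inl (j, false))) = 0 then 1 else 0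
  | Sum.inl (j, false), a => if a (e (Sum.inl (j, true))) = 0 then 0 else 1
  | Sum.inr (Sum.inl s), a => if statT e s a ≤ √(2 * b) then 1 else 0
  | Sum.inr (Sum.inr _), a => ∏ s : Fin b → Bool, if a (e (Sum.inr (Sum.inl s))) = 0 then 1 else 0

lemma rolePay_mem {n b r : ℕ} (e : PRole b r ≃ Fin n) (ρ : PRole b r) (a : Fin n → Fin 2) :
    rolePay e ρ a ∈ Set.Icc (0:ℝ) 1 := by
  rcases ρ with ⟨j, _ | _⟩ | s | f
  · simp only [rolePay]; split_ifs <;> simp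
  · simp only [rolePay]; split_ifs <;> simp
  · simp only [rolePay]; split_ifs <;> simp
  · simp only [rolePay]
    constructor
    · exact Finset.prod_nonneg fun s _ => by split_ifs <;> simp
    · exact Finset.prod_le_one (fun s _ => by split_ifs <;> simp) (fun s _ => by split_ifs <;> simp)

lemma rolePay_update {n b r : ℕ} (e : PRole b r ≃ Fin n) (ρ : PRole b r) (a : Fin n → Fin 2)
    (c : Fin 2) : rolePay e ρ (Function.update a (e ρ) c) = rolePay e ρ a := by
  rcases ρ with ⟨j, _ | _⟩ | s | f
  · simp [rolePay, Function.update_apply]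
  · simp [rolePay, Function.update_apply]
  · simp [rolePay, statT, Function.update_apply]
  · simp [rolePay, Function.update_apply]

lemma sgnB_sq (c : Bool) : sgnB c ^ 2 = 1 := by cases c <;> simp [sgnB]

lemma stat_center {n b r : ℕ} (e : PRole b r ≃ Fin n) (s : Fin b → Bool) (a : Fin n → Fin 2)
    (y : Fin n → ℝ) :
    ∑ j, sgnB (s j) * ((if a (e (Sum.inl (j, true))) = 0 then (1:ℝ) else 0)
      - y (e (Sum.inl (j, true)))) = statT e s a
      - ∑ j, sgnB (s j) * (y (e (Sum.inl (j, true))) - 1 / 2) := by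
  unfold statT
  rw [← Finset.sum_sub_distrib]
  refine Finset.sum_congr rfl fun j _ => ?_
  ring

lemma stat_moment {n b r : ℕ} (e : PRole b r ≃ Fin n) (s : Fin b → Bool) (y : Fin n → ℝ) :
    expPay2 (fun a => (statT e s a
      - ∑ j, sgnB (s j) * (y (e (Sum.inl (j, true))) - 1 / 2)) ^ 2) y ≤ b / 4 := by
  have := secondMoment (fun j : Fin b => e (Sum.inl (j, true)))
    (fun i j h => by simpa using h) (fun j => sgnB (s j)) (fun j => sgnB_sq _) y
  simp only [stat_center] at this
  simpa using this

lemma tester_good {n b r : ℕ} (hb : 0 < b) (e : PRole b r ≃ Fin n) (s : Fin b → Bool)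
    (y : Fin n → ℝ) (hy : InUnit y) (h : ∀ j, y (e (Sum.inl (j, true))) = 1 / 2) :
    7 / 8 ≤ expPay2 (rolePay e (Sum.inr (Sum.inl s))) y := by
  have hm := stat_moment e s y
  simp only [h, sub_self, mul_zero, Finset.sum_const_zero, sub_zero] at hm
  have hb' : (0:ℝ) < b := by exact_mod_cast hb
  have ht : √(2 * (b:ℝ)) ^ 2 = 2 * b := Real.sq_sqrt (by positivity)
  have ht0 : 0 ≤ √(2 * (b:ℝ)) := Real.sqrt_nonneg _
  have h1 : expPay2 (fun a => (1 - rolePay e (Sum.inr (Sum.inl s)) a) * (2 * b)) y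
      ≤ expPay2 (fun a => (statT e s a) ^ 2) y := by
    refine expPay2_mono hy fun a => ?_
    simp only [rolePay]
    split_ifs with hc
    · simp; positivity
    · push Not at hc
      rw [← ht]; nlinarith
  rw [expPay2_mul, expPay2_sub, expPay2_one] at h1
  nlinarith

lemma tester_bad {n b r : ℕ} (hb : 0 < b) (e : PRole b r ≃ Fin n) (s : Fin b → Bool)
    (y : Fin n → ℝ) (hy : InUnit y)
    (h : 2 * √(2 * (b:ℝ)) ≤ ∑ j, sgnB (s j) * (y (e (Sum.inl (j, true))) - 1 / 2)) :
    expPay2 (rolePay e (Sum.inr (Sum.inl s))) y ≤ 1 / 8 := by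
  have hm := stat_moment e s y
  set μ := ∑ j, sgnB (s j) * (y (e (Sum.inl (j, true))) - 1 / 2)
  have hb' : (0:ℝ) < b := by exact_mod_cast hb
  have ht : √(2 * (b:ℝ)) ^ 2 = 2 * b := Real.sq_sqrt (by positivity)
  have ht0 : 0 ≤ √(2 * (b:ℝ)) := Real.sqrt_nonneg _
  have h1 : expPay2 (fun a => (rolePay e (Sum.inr (Sum.inl s)) a) * (2 * b)) y
      ≤ expPay2 (fun a => (statT e s a - μ) ^ 2) y := by
    refine expPay2_mono hy fun a => ?_
    simp only [rolePay]
    split_ifs with hc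
    · rw [← ht]; nlinarith
    · simp; positivity
  rw [expPay2_mul] at h1
  nlinarith

lemma pay_base_true {n b r : ℕ} (e : PRole b r ≃ Fin n) (j : Fin b) (y : Fin n → ℝ) :
    expPay2 (rolePay e (Sum.inl (j, true))) y = y (e (Sum.inl (j, false))) := by
  have := expPay2_single (fun c => if c = 0 then (1:ℝ) else 0) y (e (Sum.inl (j, false)))
  simp at this
  exact this

lemma pay_base_false {n b r : ℕ} (e : PRole b r ≃ Fin n) (j : Fin b) (y : Fin n → ℝ) :
    expPay2 (rolePay e (Sum.inl (j, false))) y = 1 - y (e (Sum.inl (j, true))) := by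
  have := expPay2_single (fun c => if c = 0 then (0:ℝ) else 1) y (e (Sum.inl (j, true)))
  simp at this
  exact this

lemma pay_final {n b r : ℕ} (e : PRole b r ≃ Fin n) (f : Fin r) (y : Fin n → ℝ) :
    expPay2 (rolePay e (Sum.inr (Sum.inr f))) y = ∏ s, y (e (Sum.inr (Sum.inl s))) :=
  expPay2_prodInd (fun s : Fin b → Bool => e (Sum.inr (Sum.inl s)))
    (fun s s' h => by simpa using h) y

/-- The game. -/
noncomputable def theGame {n b r : ℕ} (e : PRole b r ≃ Fin n) : Fin n → (Fin n → Fin 2) → ℝ :=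
  gameOf (fun i => rolePay e (e.symm i))

lemma theGame_nash {n b r : ℕ} (e : PRole b r ≃ Fin n) (ε : ℝ) (x : Fin n → ℝ) :
    ENash2 (theGame e) ε x ↔ ∀ ρ, (1 - x (e ρ)) * (2 * expPay2 (rolePay e ρ) x - 1) ≤ ε ∧
      x (e ρ) * (1 - 2 * expPay2 (rolePay e ρ) x) ≤ ε := by
  unfold theGame
  rw [nash_iff]
  · rw [← e.forall_congr_right]
    simp
  · intro i a c
    have := rolePay_update e (e.symm i) a c
    simpa using this

/-- Equilibrium by role. -/
noncomputable def roleEq {b r : ℕ} : PRole b r → ℝ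
  | Sum.inl _ => 1 / 2
  | Sum.inr _ => 1

lemma mp_unique {p q : ℝ} (hp : p ∈ Set.Icc (0:ℝ) 1) (hq : q ∈ Set.Icc (0:ℝ) 1)
    (h1 : (1 - p) * (2 * q - 1) ≤ 0) (h2 : p * (1 - 2 * q) ≤ 0)
    (h3 : (1 - q) * (2 * (1 - p) - 1) ≤ 0) (h4 : q * (1 - 2 * (1 - p)) ≤ 0) :
    p = 1 / 2 ∧ q = 1 / 2 := by
  obtain ⟨hp0, hp1⟩ := hp
  obtain ⟨hq0, hq1⟩ := hq
  have hq' : q = 1 / 2 := by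
    rcases lt_trichotomy q (1 / 2) with h | h | h
    · have : p ≤ 0 := by by_contra hc; push Not at hc; nlinarith
      have : p = 0 := le_antisymm this hp0
      subst this; nlinarith
    · exact h
    · have : 1 ≤ p := by by_contra hc; push Not at hc; nlinarith
      have : p = 1 := le_antisymm hp1 this
      subst this; nlinarith
  subst hq'
  refine ⟨?_, rfl⟩
  linarith

lemma exact_values {n b r : ℕ} (hb : 0 < b) (e : PRole b r ≃ Fin n) (y : Fin n → ℝ)
    (hy : InUnit y) (h : ENash2 (theGame e) 0 y) : ∀ ρ, y (e ρ) = roleEq ρ := by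
  rw [theGame_nash] at h
  have hbase : ∀ j, y (e (Sum.inl (j, true))) = 1 / 2 ∧ y (e (Sum.inl (j, false))) = 1 / 2 := by
    intro j
    have ht := h (Sum.inl (j, true))
    have hf := h (Sum.inl (j, false))
    rw [pay_base_true] at ht
    rw [pay_base_false] at hf
    exact mp_unique (hy _) (hy _) ht.1 ht.2 hf.1 hf.2
  have htest : ∀ s, y (e (Sum.inr (Sum.inl s))) = 1 := by
    intro s
    have hg := tester_good hb e s y hy fun j => (hbase j).1
    have h1 := (h (Sum.inr (Sum.inl s))).1
    have h2 := (hy (e (Sum.inr (Sum.inl s)))).2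
    nlinarith
  intro ρ
  rcases ρ with ⟨j, _ | _⟩ | s | f
  · exact (hbase j).2
  · exact (hbase j).1
  · exact htest s
  · have h1 := (h (Sum.inr (Sum.inr f))).1
    rw [pay_final] at h1
    simp only [htest, Finset.prod_const_one] at h1
    have h2 := (hy (e (Sum.inr (Sum.inr f)))).2
    simp only [roleEq]
    linarith

lemma exact_nash {n b r : ℕ} (hb : 0 < b) (e : PRole b r ≃ Fin n) (y : Fin n → ℝ)
    (hy : InUnit y) (h : ∀ ρ, y (e ρ) = roleEq ρ) : ENash2 (theGame e) 0 y := by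
  rw [theGame_nash]
  intro ρ
  rcases ρ with ⟨j, _ | _⟩ | s | f
  · rw [pay_base_false, h, h]; norm_num [roleEq]
  · rw [pay_base_true, h, h]; norm_num [roleEq]
  · have hg := tester_good hb e s y hy fun j => h _
    rw [h]; simp only [roleEq]
    constructor <;> linarith
  · rw [pay_final, h]
    simp only [h, roleEq, Finset.prod_const_one]
    norm_num

lemma grid_inUnit {n k : ℕ} (hk : 0 < k) (y : Fin n → ℝ) (h : OnGrid k y) : InUnit y := by
  intro i
  obtain ⟨c, hc, e⟩ := h i
  have hk' : (0:ℝ) < k := by exact_mod_cast hk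
  have hc' : (c:ℝ) ≤ k := by exact_mod_cast hc
  rw [e]
  exact ⟨by positivity, (div_le_one hk').2 hc'⟩

lemma grid_far {k : ℕ} (hk : Odd k) (c : ℕ) : 1 / (2 * (k:ℝ)) ≤ |(c:ℝ) / k - 1 / 2| := by
  have hk0 : (0:ℝ) < k := by exact_mod_cast hk.pos
  have e : (c:ℝ) / k - 1 / 2 = (2 * c - k) / (2 * k) := by field_simp
  rw [e, abs_div, abs_of_pos (by positivity : (0:ℝ) < 2 * k)]
  refine div_le_div_of_nonneg_right ?_ (by positivity)
  have h : (1:ℤ) ≤ |2 * (c:ℤ) - k| := by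
    obtain ⟨m, rfl⟩ := hk
    apply Int.one_le_abs
    push_cast; omega
  exact_mod_cast h

lemma grid_final {n b r k : ℕ} (hb : 0 < b) (e : PRole b r ≃ Fin n) (hk : Odd k)
    (hkb : (k:ℝ) < √(2 * b) / 8) (y : Fin n → ℝ) (hgrid : OnGrid k y)
    (h : ENash2 (theGame e) 0.1 y) (f : Fin r) : y (e (Sum.inr (Sum.inr f))) ≤ 0.22 := by
  have hk0 : (0:ℝ) < k := by exact_mod_cast hk.pos
  have hy := grid_inUnit hk.pos y hgrid
  have ht : √(2 * (b:ℝ)) ^ 2 = 2 * b := Real.sq_sqrt (by positivity)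
  have ht0 : 0 ≤ √(2 * (b:ℝ)) := Real.sqrt_nonneg _
  rw [theGame_nash] at h
  set s : Fin b → Bool := fun j => decide (1 / 2 ≤ y (e (Sum.inl (j, true)))) with hs
  have hterm : ∀ j, 1 / (2 * (k:ℝ)) ≤ sgnB (s j) * (y (e (Sum.inl (j, true))) - 1 / 2) := by
    intro j
    obtain ⟨c, _, hc⟩ := hgrid (e (Sum.inl (j, true)))
    have h1 := grid_far hk c
    rw [← hc] at h1
    by_cases hh : 1 / 2 ≤ y (e (Sum.inl (j, true)))
    · rw [abs_of_nonneg (by linarith)] at h1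
      have : s j = true := by simp only [hs]; exact decide_eq_true hh
      rw [this]; simp only [sgnB, if_true]; linarith
    · rw [abs_of_neg (by push Not at hh; linarith)] at h1
      have : s j = false := by simp only [hs]; exact decide_eq_false hh
      rw [this]; simp only [sgnB]; norm_num; norm_num at h1; linarith
  have hsum : 2 * √(2 * (b:ℝ)) ≤ ∑ j, sgnB (s j) * (y (e (Sum.inl (j, true))) - 1 / 2) := by
    calc 2 * √(2 * (b:ℝ)) ≤ ∑ j : Fin b, 1 / (2 * (k:ℝ)) := by
          simp only [Finset.sum_const, Finset.card_univ, Fintype.card_fin, nsmul_eq_mul]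
          rw [mul_one_div, le_div_iff₀ (by positivity)]
          nlinarith
      _ ≤ _ := Finset.sum_le_sum fun j _ => hterm j
  have hbad := tester_bad hb e s y hy hsum
  have h1 := (h (Sum.inr (Sum.inl s))).2
  have h2 := hy (e (Sum.inr (Sum.inl s)))
  have h3 : y (e (Sum.inr (Sum.inl s))) ≤ 2 / 15 := by
    norm_num at h1
    nlinarith [h2.1]
  have h4 := (h (Sum.inr (Sum.inr f))).2
  rw [pay_final] at h4
  have h5 : ∏ s', y (e (Sum.inr (Sum.inl s'))) ≤ y (e (Sum.inr (Sum.inl s))) := by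
    classical
    rw [← Finset.mul_prod_erase _ _ (Finset.mem_univ s)]
    refine mul_le_of_le_one_right h2.1 ?_
    exact Finset.prod_le_one (fun s' _ => (hy _).1) (fun s' _ => (hy _).2)
  have h6 := hy (e (Sum.inr (Sum.inr f)))
  norm_num at h4 ⊢
  nlinarith [h6.1]

lemma pure_not_nash {n b r : ℕ} (hb : 0 < b) (e : PRole b r ≃ Fin n) (y : Fin n → ℝ)
    (hgrid : OnGrid 1 y) : ¬ ENash2 (theGame e) 0.1 y := by
  intro h
  rw [theGame_nash] at h
  have hp : ∀ i, y i = 0 ∨ y i = 1 := by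
    intro i
    obtain ⟨c, hc, hh⟩ := hgrid i
    rw [hh]
    interval_cases c <;> simp
  have ht := h (Sum.inl (⟨0, hb⟩, true))
  have hf := h (Sum.inl (⟨0, hb⟩, false))
  rw [pay_base_true] at ht
  rw [pay_base_false] at hf
  rcases hp (e (Sum.inl (⟨0, hb⟩, true))) with h1 | h1 <;>
  rcases hp (e (Sum.inl (⟨0, hb⟩, false))) with h2 | h2 <;>
  · rw [h1, h2] at ht hf
    obtain ⟨ht1, ht2⟩ := ht
    obtain ⟨hf1, hf2⟩ := hf
    linarith

lemma choose_lower {b : ℕ} (hb : 4 ≤ b) : 2 ^ b < Nat.choose (2 * b) b := by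
  have h1 := Nat.four_pow_lt_mul_centralBinom b hb
  have h2 : b < 2 ^ b := Nat.lt_two_pow_self
  have h3 : (4:ℕ) ^ b = 2 ^ b * 2 ^ b := by rw [← mul_pow]; norm_num
  rw [Nat.centralBinom_eq_two_mul_choose] at h1
  by_contra hc
  push Not at hc
  have : b * Nat.choose (2 * b) b ≤ 2 ^ b * 2 ^ b := Nat.mul_le_mul h2.le hc
  omega

lemma choose_upper {b : ℕ} (hb : 4 ≤ b) : 2 * b + Nat.choose (2 * b) b ≤ 4 ^ b := by
  have h := Nat.sum_range_choose (2 * b)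
  have h4 : (4:ℕ) ^ b = 2 ^ (2 * b) := by rw [pow_mul]; norm_num
  rw [h4, ← h]
  have h2 : ∑ m ∈ ({1, b} : Finset ℕ), (2 * b).choose m = 2 * b + Nat.choose (2 * b) b := by
    rw [Finset.sum_pair (by omega)]; simp
  rw [← h2]
  refine Finset.sum_le_sum_of_subset ?_
  intro m hm
  simp at hm ⊢
  omega

/-- For every sufficiently large `b` there is an `n`-player binary-action game,
`n = 2b + C(2b,b)`, with a unique exact Nash equilibrium `x` such that for every odd
`k < √(log₂ n)/8`: (i) no vertex of the `1/k`-grid cube containing `x` is a `0.1`-Nash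
equilibrium, and (ii) some player plays a pure strategy in `x` but places probability at
most `0.22` on that pure strategy in every `0.1`-Nash equilibrium lying on the grid. -/
theorem stmt3 :
    ∃ B : ℕ, ∀ b : ℕ, B ≤ b →
      ∃ u : Fin (2 * b + Nat.choose (2 * b) b) → ((Fin (2 * b + Nat.choose (2 * b) b) → Fin 2) → ℝ),
        (∀ i a, u i a ∈ Set.Icc (0:ℝ) 1) ∧
        ∃ x : Fin (2 * b + Nat.choose (2 * b) b) → ℝ,
          InUnit x ∧ ENash2 u 0 x ∧
          (∀ y, InUnit y → ENash2 u 0 y → y = x) ∧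
          ∀ k : ℕ, Odd k →
            (k : ℝ) < Real.sqrt (Real.logb 2 (2 * b + Nat.choose (2 * b) b)) / 8 →
            (∀ y, OnGrid k y → (∀ i, |y i - x i| ≤ 1 / k) → ¬ ENash2 u 0.1 y) ∧
            ∃ i : Fin (2 * b + Nat.choose (2 * b) b), ∃ q : Fin 2,
              (if q = 0 then x i else 1 - x i) = 1 ∧
              ∀ y, OnGrid k y → ENash2 u 0.1 y →
                (if q = 0 then y i else 1 - y i) ≤ 0.22 := by
  refine ⟨4, fun b hb => ?_⟩
  have hb0 : 0 < b := by omega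
  have hlow := choose_lower hb
  have hup := choose_upper hb
  obtain ⟨r, hr⟩ : ∃ r, Nat.choose (2 * b) b = 2 ^ b + (r + 1) :=
    ⟨Nat.choose (2 * b) b - 2 ^ b - 1, by omega⟩
  have hcard : Fintype.card (PRole b (r + 1))
      = Fintype.card (Fin (2 * b + Nat.choose (2 * b) b)) := by
    simp [hr]; omega
  let e : PRole b (r + 1) ≃ Fin (2 * b + Nat.choose (2 * b) b) := Fintype.equivOfCardEq hcard
  have hxU : InUnit (fun i => roleEq (e.symm i)) := by
    intro i
    change roleEq (e.symm i) ∈ Set.Icc (0:ℝ) 1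
    rcases e.symm i with ρ | ρ
    · simp only [roleEq]; constructor <;> norm_num
    · simp only [roleEq]; constructor <;> norm_num
  refine ⟨theGame e, ?_, fun i => roleEq (e.symm i), hxU, ?_, ?_, ?_⟩
  · intro i a
    have := rolePay_mem e (e.symm i) a
    unfold theGame gameOf
    split_ifs
    · exact this
    · exact ⟨by linarith [this.2], by linarith [this.1]⟩
  · exact exact_nash hb0 e _ hxU fun ρ => by simp
  · intro y hy h
    funext i
    have := exact_values hb0 e y hy h (e.symm i)
    simpa using this
  · intro k hk hkn
    have hlog : Real.logb 2 (2 * b + Nat.choose (2 * b) b) ≤ 2 * b := by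
      have hpos : (0:ℝ) < 2 * b + Nat.choose (2 * b) b := by positivity
      rw [Real.logb_le_iff_le_rpow (by norm_num) hpos]
      have h4 : (2:ℝ) ^ (2 * (b:ℝ)) = 4 ^ b := by
        rw [Real.rpow_mul (by norm_num), Real.rpow_natCast]; norm_num
      rw [h4]
      exact_mod_cast hup
    have hkb : (k:ℝ) < √(2 * b) / 8 := by
      have := Real.sqrt_le_sqrt hlog
      linarith
    refine ⟨?_, e (Sum.inr (Sum.inr 0)), 0, by simp [roleEq], ?_⟩
    · intro y hgrid hclose h
      by_cases hk1 : k = 1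
      · subst hk1
        exact pure_not_nash hb0 e y hgrid h
      · have hk3 : 3 ≤ k := by
          obtain ⟨m, rfl⟩ := hk
          omega
        have h1 := grid_final hb0 e hk hkb y hgrid h 0
        have h2 := hclose (e (Sum.inr (Sum.inr 0)))
        simp only [Equiv.symm_apply_apply, roleEq] at h2
        have h3 : 1 / (k:ℝ) ≤ 1 / 3 := by
          apply one_div_le_one_div_of_le (by norm_num)
          exact_mod_cast hk3
        have h4 := (abs_le.1 h2).1
        norm_num at h1
        linarith
    · intro y hgrid h
      simpa using grid_final hb0 e hk hkb y hgrid h 0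
end

section
/- Fix α ≥ 1. Suppose there exists a constant C > 0 such that every α-balanced matrix M ∈ {0,1}^{n×m} (for all n, m) satisfies disc(M) ≤ C·√t, where t is the sum of the first row of M. Then there exists a constant k = k(α) ∈ ℕ such that for every α-balanced matrix M ∈ {0,1}^{n×m}, the majority matching-pennies game defined by M has a 0.4-Nash equilibrium in mixed strategies in which every one of the n+m players plays his action 1 with probability either (k+1)/(2k) or (k−1)/(2k). -/
open Finset

/-- The pure action encoded by a Boolean: `true ↦ 1`, `false ↦ -1`. -/
def pm (b : Bool) : ℝ := if b then 1 else -1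

/-- Probability of the pure Boolean profile `b` when each coordinate `i` independently
plays `true` (i.e. action `1`) with probability `ρ i`. -/
noncomputable def prProf {n : ℕ} (ρ : Fin n → ℝ) (b : Fin n → Bool) : ℝ :=
  ∏ i, if b i then ρ i else 1 - ρ i

/-- Expected payoff of row player `i` in the majority matching-pennies game defined by `M`,
under the mixed profile `(ρ, σ)`: he receives the sign of the sum of his row. -/
noncomputable def expRow {n m : ℕ} (M : Fin n → Fin m → ℝ) (i : Fin n)
    (ρ : Fin n → ℝ) (σ : Fin m → ℝ) : ℝ :=
  ∑ b : Fin n → Bool, ∑ c : Fin m → Bool,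
    prProf ρ b * prProf σ c * Real.sign (pm (b i) * ∑ j, M i j * pm (c j))

/-- Expected payoff of column player `j` in the majority matching-pennies game defined by `M`,
under the mixed profile `(ρ, σ)`: he receives minus the sign of the sum of his column. -/
noncomputable def expCol {n m : ℕ} (M : Fin n → Fin m → ℝ) (j : Fin m)
    (ρ : Fin n → ℝ) (σ : Fin m → ℝ) : ℝ :=
  ∑ b : Fin n → Bool, ∑ c : Fin m → Bool,
    prProf ρ b * prProf σ c * (- Real.sign (pm (c j) * ∑ i, M i j * pm (b i)))

/-- The matrix `M` has entries in `{0,1}`. -/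
def Entries01 {n m : ℕ} (M : Fin n → Fin m → ℝ) : Prop := ∀ i j, M i j = 0 ∨ M i j = 1

/-- `M` is `α`-balanced: every ratio of two of the row sums and column sums lies in `[1/α, α]`. -/
def BalancedMat {n m : ℕ} (α : ℝ) (M : Fin n → Fin m → ℝ) : Prop :=
  (∀ i i', (∑ j, M i j) ≤ α * ∑ j, M i' j) ∧
  (∀ j j', (∑ i, M i j) ≤ α * ∑ i, M i j') ∧
  (∀ i j, (∑ j', M i j') ≤ α * ∑ i', M i' j) ∧
  (∀ i j, (∑ i', M i' j) ≤ α * ∑ j', M i j')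

/-- `(ρ, σ)` is an `ε`-Nash equilibrium of the majority matching-pennies game defined by `M`:
it is a profile of mixed strategies, and no player can gain more than `ε` by a unilateral
deviation to any mixed strategy. -/
def IsENashMMP {n m : ℕ} (M : Fin n → Fin m → ℝ) (ε : ℝ)
    (ρ : Fin n → ℝ) (σ : Fin m → ℝ) : Prop :=
  (∀ i, ρ i ∈ Set.Icc (0:ℝ) 1) ∧ (∀ j, σ j ∈ Set.Icc (0:ℝ) 1) ∧
  (∀ i, ∀ q ∈ Set.Icc (0:ℝ) 1, expRow M i (Function.update ρ i q) σ ≤ expRow M i ρ σ + ε) ∧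
  (∀ j, ∀ q ∈ Set.Icc (0:ℝ) 1, expCol M j ρ (Function.update σ j q) ≤ expCol M j ρ σ + ε)

/-- `N`-fold averaging over the two neighbours. -/
noncomputable def avg : ℕ → (ℤ → ℝ) → ℤ → ℝ
  | 0, f, x => f x
  | N + 1, f, x => (avg N f (x + 1) + avg N f (x - 1)) / 2

lemma avg_sub (N : ℕ) (f g : ℤ → ℝ) (x : ℤ) :
    avg N (fun z => f z - g z) x = avg N f x - avg N g x := by
  induction N generalizing x with
  | zero => rfl
  | succ N ih => simp only [avg, ih]; ring

lemma avg_add (N : ℕ) (f g : ℤ → ℝ) (x : ℤ) :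
    avg N (fun z => f z + g z) x = avg N f x + avg N g x := by
  induction N generalizing x with
  | zero => rfl
  | succ N ih => simp only [avg, ih]; ring

lemma avg_shift (N : ℕ) (f : ℤ → ℝ) (a x : ℤ) :
    avg N (fun z => f (z + a)) x = avg N f (x + a) := by
  induction N generalizing x with
  | zero => rfl
  | succ N ih =>
    simp only [avg, ih]
    rw [show x + 1 + a = x + a + 1 by ring, show x - 1 + a = x + a - 1 by ring]

lemma avg_odd (N : ℕ) (f : ℤ → ℝ) (hf : ∀ z, f (-z) = - f z) (x : ℤ) :
    avg N f (-x) = - avg N f x := by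
  induction N generalizing x with
  | zero => exact hf x
  | succ N ih =>
    simp only [avg]
    rw [show -x + 1 = -(x - 1) by ring, show -x - 1 = -(x + 1) by ring, ih, ih]; ring

noncomputable def dlt (z : ℤ) : ℝ := if z = 0 then 1 else 0

lemma avg_dlt (N : ℕ) :
    (∀ k : ℕ, avg N dlt (2 * k - N) = (N.choose k : ℝ) / 2 ^ N) ∧
    (∀ x : ℤ, (∀ k : ℕ, x ≠ 2 * k - N) → avg N dlt x = 0) := by
  induction N with
  | zero =>
    constructor
    · intro k
      cases k with
      | zero => simp [avg, dlt]
      | succ k =>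
        have : (2 * ((k + 1 : ℕ) : ℤ) - ((0 : ℕ) : ℤ)) ≠ 0 := by push_cast; omega
        simp only [avg, dlt, this, if_false]; simp
    · intro x hx
      have : x ≠ 0 := by simpa using hx 0
      simp [avg, dlt, this]
  | succ N ih =>
    obtain ⟨iha, ihb⟩ := ih
    constructor
    · intro k
      simp only [avg]
      have h1 : (2 * (k : ℤ) - ((N + 1 : ℕ) : ℤ) + 1) = 2 * k - N := by push_cast; ring
      rw [h1, iha]
      cases k with
      | zero =>
        rw [ihb _ (by intro k; push_cast; omega)]
        simp [pow_succ]; ring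
      | succ k =>
        have h2 : (2 * ((k + 1 : ℕ) : ℤ) - ((N + 1 : ℕ) : ℤ) - 1) = 2 * k - N := by push_cast; ring
        rw [h2, iha, Nat.choose_succ_succ]
        push_cast
        rw [pow_succ]; field_simp; ring
    · intro x hx
      simp only [avg]
      rw [ihb, ihb]
      · simp
      · intro k hk
        apply hx (k + 1); push_cast; omega
      · intro k hk
        apply hx k; push_cast; omega

lemma cb_bound (n : ℕ) : (n.centralBinom) ^ 2 * (2 * n + 1) ≤ 16 ^ n := by
  induction n with
  | zero => simp
  | succ n ih =>
    have h := Nat.succ_mul_centralBinom_succ n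
    have h3 : (n + 1) ^ 2 * ((n + 1).centralBinom ^ 2 * (2 * (n + 1) + 1))
        ≤ (n + 1) ^ 2 * 16 ^ (n + 1) := by
      calc (n + 1) ^ 2 * ((n + 1).centralBinom ^ 2 * (2 * (n + 1) + 1))
          = ((n + 1) * (n + 1).centralBinom) ^ 2 * (2 * n + 3) := by ring
        _ = (4 * (2 * n + 1) * (2 * n + 3)) * (n.centralBinom ^ 2 * (2 * n + 1)) := by
            rw [h]; ring
        _ ≤ (16 * (n + 1) ^ 2) * 16 ^ n := by
            apply Nat.mul_le_mul _ ih
            nlinarith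
        _ = _ := by ring
    exact Nat.le_of_mul_le_mul_left h3 (by positivity)

lemma choose_bound (N k : ℕ) : (N.choose k) ^ 2 * (N + 1) ≤ 4 ^ N := by
  have h0 : (N.choose k) ^ 2 * (N + 1) ≤ (N.choose (N / 2)) ^ 2 * (N + 1) := by
    gcongr; exact Nat.choose_le_middle k N
  refine h0.trans ?_
  rcases Nat.even_or_odd' N with ⟨n, rfl | rfl⟩
  · have := cb_bound n
    rw [Nat.centralBinom] at this
    rw [show 2 * n / 2 = n by omega, pow_mul]; simpa using this
  · have := cb_bound (n + 1)
    have h1 : (n + 1).centralBinom = 2 * (2 * n + 1).choose n := by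
      rw [Nat.centralBinom, show 2 * (n + 1) = (2 * n + 1) + 1 by ring, Nat.choose_succ_succ,
        Nat.choose_symm_half]; ring
    rw [h1] at this
    rw [show (2 * n + 1) / 2 = n by omega]
    have h2 : (4:ℕ) ^ (2 * n + 1) * 4 = 16 ^ (n + 1) := by
      rw [show (16:ℕ) = 4 ^ 2 by norm_num, ← pow_mul, ← pow_succ]; congr 1
    nlinarith [Nat.zero_le ((2 * n + 1).choose n ^ 2)]

lemma choose_bound' (N k : ℕ) : (N.choose k : ℝ) / 2 ^ N ≤ 1 / Real.sqrt (N + 1) := by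
  have h := choose_bound N k
  have h' : ((N.choose k : ℝ)) ^ 2 * (N + 1) ≤ 4 ^ N := by exact_mod_cast h
  have hs : 0 < Real.sqrt ((N:ℝ) + 1) := Real.sqrt_pos.mpr (by positivity)
  rw [div_le_div_iff₀ (by positivity) hs, one_mul]
  apply (sq_le_sq₀ (by positivity) (by positivity)).mp
  rw [mul_pow, Real.sq_sqrt (by positivity), ← pow_mul, mul_comm N 2, pow_mul]
  norm_num; exact h'

lemma avg_dlt_bound (N : ℕ) (x : ℤ) :
    0 ≤ avg N dlt x ∧ avg N dlt x ≤ 1 / Real.sqrt (N + 1) := by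
  by_cases h : ∃ k : ℕ, x = 2 * k - N
  · obtain ⟨k, rfl⟩ := h
    rw [(avg_dlt N).1]
    exact ⟨by positivity, choose_bound' N k⟩
  · push Not at h
    rw [(avg_dlt N).2 x h]
    exact ⟨le_rfl, by positivity⟩

noncomputable def sg (z : ℤ) : ℝ := Real.sign (z : ℝ)

lemma sg_neg (z : ℤ) : sg (-z) = - sg z := by
  simp [sg, Real.sign_neg]

lemma sg_step (z : ℤ) : sg (z + 1) - sg z = dlt z + dlt (z + 1) := by
  unfold sg dlt
  rcases lt_trichotomy z (-1) with h | h | h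
  · have h1 : ((z + 1 : ℤ) : ℝ) < 0 := by exact_mod_cast (by omega : z + 1 < 0)
    have h2 : (z : ℝ) < 0 := by exact_mod_cast (by omega : z < 0)
    rw [Real.sign_of_neg h1, Real.sign_of_neg h2, if_neg (by omega), if_neg (by omega)]; simp
  · subst h; norm_num
    rw [Real.sign_of_neg (by norm_num)]; simp
  · rcases eq_or_lt_of_le (show 0 ≤ z by omega) with h0 | h0
    · subst h0; norm_num
    · have h1 : 0 < ((z + 1 : ℤ) : ℝ) := by exact_mod_cast (by omega : 0 < z + 1)
      have h2 : 0 < (z : ℝ) := by exact_mod_cast h0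
      rw [Real.sign_of_pos h1, Real.sign_of_pos h2, if_neg (by omega), if_neg (by omega)]; simp

lemma avg_sg_nat (N f : ℕ) :
    |avg N sg f| ≤ 2 * f / Real.sqrt (N + 1) := by
  induction f with
  | zero =>
    have := avg_odd N sg sg_neg 0
    have h0 : avg N sg 0 = 0 := by simp at this; linarith
    simp [h0]
  | succ f ih =>
    have h : avg N sg (f + 1) - avg N sg f = avg N dlt f + avg N dlt (f + 1) := by
      rw [← avg_shift, ← avg_shift N dlt, ← avg_sub, ← avg_add]
      congr 1; funext z; exact sg_step z
    have h1 := avg_dlt_bound N f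
    have h2 := avg_dlt_bound N (f + 1)
    have h3 : 2 * ((f + 1 : ℕ) : ℝ) / Real.sqrt (N + 1)
        = 2 * f / Real.sqrt (N + 1) + 1 / Real.sqrt (N + 1) + 1 / Real.sqrt (N + 1) := by
      push_cast; ring
    rw [h3]
    push_cast
    rw [abs_le] at ih ⊢
    constructor <;> linarith

lemma avg_sg (N : ℕ) (f : ℤ) :
    |avg N sg f| ≤ 2 * |(f:ℝ)| / Real.sqrt (N + 1) := by
  rcases Int.eq_nat_or_neg f with ⟨n, rfl | rfl⟩
  · have := avg_sg_nat N n
    simpa using this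
  · rw [avg_odd N sg sg_neg, abs_neg]
    simpa using avg_sg_nat N n

/-- Mixture functional. -/
noncomputable def W (δ : ℝ) : (m : ℕ) → (Fin m → Bool) → (Fin m → ℤ) → (ℤ → ℕ → ℝ) →
    ℤ → ℕ → ℝ
  | 0, _, _, G, x, N => G x N
  | m + 1, v, χ, G, x, N =>
    if v 0 then (1 - δ) * W δ m (fun j => v j.succ) (fun j => χ j.succ) G x (N + 1)
      + δ * W δ m (fun j => v j.succ) (fun j => χ j.succ) G (x + χ 0) N
    else W δ m (fun j => v j.succ) (fun j => χ j.succ) G x N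

def pz (b : Bool) : ℤ := if b then 1 else -1

lemma sum_cons {m : ℕ} (F : (Fin (m + 1) → Bool) → ℝ) :
    ∑ c, F c = ∑ c : Fin m → Bool, F (Fin.cons true c)
      + ∑ c : Fin m → Bool, F (Fin.cons false c) := by
  rw [← (Fin.consEquiv (fun _ : Fin (m + 1) => Bool)).sum_comp, Fintype.sum_prod_type]
  simp [Fin.consEquiv]

lemma prProf_cons {m : ℕ} (σ : Fin (m + 1) → ℝ) (b : Bool) (c : Fin m → Bool) :
    prProf σ (Fin.cons b c) = (if b then σ 0 else 1 - σ 0) * prProf (fun j => σ j.succ) c := by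
  simp [prProf, Fin.prod_univ_succ]

lemma E_eq_W (δ : ℝ) (f : ℤ → ℝ) (m : ℕ) (v : Fin m → Bool) (χ : Fin m → ℤ)
    (hχ : ∀ j, χ j = 1 ∨ χ j = -1) (x : ℤ) (N : ℕ) :
    ∑ c : Fin m → Bool, prProf (fun j => (1 + δ * χ j) / 2) c *
      avg N f (x + ∑ j, if v j then pz (c j) else 0)
    = W δ m v χ (fun x N => avg N f x) x N := by
  induction m generalizing x N with
  | zero => simp [W, prProf]
  | succ m ih =>
    have ih' := ih (fun j => v j.succ) (fun j => χ j.succ) (fun j => hχ _)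
    rw [sum_cons]
    simp only [prProf_cons, Fin.sum_univ_succ, Fin.cons_zero, Fin.cons_succ, W]
    have hN := ih' x (N + 1)
    have hp := ih' (x + 1) N
    have hm := ih' (x - 1) N
    simp only [avg] at hN
    by_cases hv : v 0 = true
    · simp only [hv, if_true]
      have key : W δ m (fun j => v j.succ) (fun j => χ j.succ) (fun x N => avg N f x) x (N + 1)
        = (W δ m (fun j => v j.succ) (fun j => χ j.succ) (fun x N => avg N f x) (x + 1) N
          + W δ m (fun j => v j.succ) (fun j => χ j.succ) (fun x N => avg N f x) (x - 1) N) / 2 := by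
        rw [← hN, ← hp, ← hm, ← Finset.sum_add_distrib, Finset.sum_div]
        refine Finset.sum_congr rfl fun c _ => ?_
        rw [add_right_comm x 1, add_sub_right_comm]; ring_nf
      rw [key]
      have e1 : ∀ S : ℤ, x + (pz true + S) = x + 1 + S := by intro S; simp [pz]; ring
      have e2 : ∀ S : ℤ, x + (pz false + S) = x - 1 + S := by intro S; simp [pz]; ring
      simp only [e1, e2, mul_assoc, ← Finset.mul_sum, hp, hm]
      rcases hχ 0 with h | h
      · simp only [h, if_true]; push_cast; simp; ring
      · simp only [h]; rw [← sub_eq_add_neg]; push_cast; simp; ring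
    · simp only [hv, mul_assoc, ← Finset.mul_sum]
      simp only [zero_add, ih', Bool.false_eq_true, if_false, if_true]
      ring

lemma W_mono (δ : ℝ) (h0 : 0 ≤ δ) (h1 : δ ≤ 1) (G H : ℤ → ℕ → ℝ) (h : ∀ x N, |G x N| ≤ H x N)
    (m : ℕ) (v : Fin m → Bool) (χ : Fin m → ℤ) (x : ℤ) (N : ℕ) :
    |W δ m v χ G x N| ≤ W δ m v χ H x N := by
  induction m generalizing x N with
  | zero => exact h x N
  | succ m ih =>
    simp only [W]
    split_ifs
    · refine (abs_add_le _ _).trans ?_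
      rw [abs_mul, abs_mul, abs_of_nonneg h0, abs_of_nonneg (sub_nonneg.mpr h1)]
      have : 0 ≤ 1 - δ := by linarith
      gcongr <;> apply ih
    · apply ih

lemma W_lin (δ a b : ℝ) (G H : ℤ → ℕ → ℝ)
    (m : ℕ) (v : Fin m → Bool) (χ : Fin m → ℤ) (x : ℤ) (N : ℕ) :
    W δ m v χ (fun x N => a * G x N + b * H x N) x N
      = a * W δ m v χ G x N + b * W δ m v χ H x N := by
  induction m generalizing x N with
  | zero => rfl
  | succ m ih =>
    simp only [W]
    split_ifs
    · rw [ih, ih]; ring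
    · apply ih

lemma W_sq (δ : ℝ) (m : ℕ) (v : Fin m → Bool) (χ : Fin m → ℤ)
    (hχ : ∀ j, χ j = 1 ∨ χ j = -1) (x : ℤ) (N : ℕ) :
    W δ m v χ (fun x _ => (x:ℝ) ^ 2) x N
      = (x + δ * ∑ j, if v j then (χ j : ℝ) else 0) ^ 2
        + δ * (1 - δ) * ∑ j, if v j then (1:ℝ) else 0 := by
  induction m generalizing x N with
  | zero => simp [W]
  | succ m ih =>
    simp only [W, Fin.sum_univ_succ]
    split_ifs
    · rw [ih _ _ (fun j => hχ _), ih _ _ (fun j => hχ _)]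
      rcases hχ 0 with h | h <;> rw [h] <;> push_cast <;> ring
    · rw [ih _ _ (fun j => hχ _)]; simp

lemma W_inv (δ : ℝ) (h0 : 0 ≤ δ) (h1 : δ ≤ 1) (m : ℕ) (v : Fin m → Bool) (χ : Fin m → ℤ)
    (x : ℤ) (N : ℕ) :
    W δ m v χ (fun _ N => 1 / ((N:ℝ) + 1)) x N
      ≤ 1 / ((N:ℝ) + 1 + (1 - δ) / 2 * ∑ j, if v j then (1:ℝ) else 0) := by
  induction m generalizing x N with
  | zero => simp [W]
  | succ m ih =>
    simp only [W, Fin.sum_univ_succ]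
    split_ifs
    · have i1 := ih (fun j => v j.succ) (fun j => χ j.succ) x (N + 1)
      have i2 := ih (fun j => v j.succ) (fun j => χ j.succ) (x + χ 0) N
      have hr : 0 ≤ ∑ j : Fin m, if v j.succ then (1:ℝ) else 0 :=
        Finset.sum_nonneg fun j _ => by split_ifs <;> norm_num
      set r := ∑ j : Fin m, if v j.succ then (1:ℝ) else 0
      have hq : 0 ≤ 1 - δ := by linarith
      have hy : 1 ≤ (N:ℝ) + 1 + (1 - δ) / 2 * r := by
        have : 0 ≤ (1 - δ) / 2 * r := by positivity
        have : (0:ℝ) ≤ N := by positivity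
        linarith
      rw [show ((N + 1 : ℕ) : ℝ) + 1 + (1 - δ) / 2 * r = ((N:ℝ) + 1 + (1 - δ) / 2 * r) + 1 by
        push_cast; ring] at i1
      rw [show (N : ℝ) + 1 + (1 - δ) / 2 * (1 + r)
        = ((N:ℝ) + 1 + (1 - δ) / 2 * r) + (1 - δ) / 2 by ring]
      set y := (N:ℝ) + 1 + (1 - δ) / 2 * r
      calc _ ≤ (1 - δ) * (1 / (y + 1)) + δ * (1 / y) := by gcongr
        _ ≤ 1 / (y + (1 - δ) / 2) := by
          have : (1 - δ) * (1 / (y + 1)) + δ * (1 / y) = (y + δ) / (y * (y + 1)) := by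
            field_simp; ring
          rw [this, div_le_div_iff₀ (by positivity) (by positivity)]
          nlinarith [mul_nonneg hq (show 0 ≤ y - δ by linarith)]
    · simpa using ih (fun j => v j.succ) (fun j => χ j.succ) x N

lemma E_bound (δ B : ℝ) (h0 : 0 ≤ δ) (h1 : δ ≤ 1 / 2) (m : ℕ) (v : Fin m → Bool) (χ : Fin m → ℤ)
    (hχ : ∀ j, χ j = 1 ∨ χ j = -1)
    (hD : (∑ j, if v j then (χ j : ℝ) else 0) ^ 2 ≤ B * ∑ j, if v j then (1:ℝ) else 0)
    (hB0 : 0 ≤ B)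
    (hB : δ * (B + 1) ≤ 1 / 1000) :
    |∑ c : Fin m → Bool, prProf (fun j => (1 + δ * χ j) / 2) c *
      sg (∑ j, if v j then pz (c j) else 0)| ≤ 0.2 := by
  have hE := E_eq_W δ sg m v χ hχ 0 0
  simp only [zero_add, avg] at hE
  rw [hE]
  have hr : 0 ≤ ∑ j : Fin m, if v j then (1:ℝ) else 0 :=
    Finset.sum_nonneg fun j _ => by split_ifs <;> norm_num
  have hsq := W_sq δ m v χ hχ 0 0
  have hinv := W_inv δ h0 (by linarith) m v χ 0 0
  set r := ∑ j : Fin m, if v j then (1:ℝ) else 0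
  set D := ∑ j : Fin m, if v j then (χ j:ℝ) else 0
  refine (W_mono δ h0 (by linarith) _ (fun x N => (100 / (r + 1)) * ((x:ℝ) ^ 2)
    + ((r + 1) / 100) * (1 / ((N:ℝ) + 1))) ?_ m v χ 0 0).trans ?_
  · intro x N
    refine (avg_sg N x).trans ?_
    have hs : 0 < Real.sqrt ((N:ℝ) + 1) := Real.sqrt_pos.mpr (by positivity)
    have hs2 : Real.sqrt ((N:ℝ) + 1) ^ 2 = (N:ℝ) + 1 := Real.sq_sqrt (by positivity)
    rw [← hs2, ← sq_abs (x:ℝ)]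
    set s := Real.sqrt ((N:ℝ) + 1)
    have hL : 0 < 100 / (r + 1) := by positivity
    have : (r + 1) / 100 = (100 / (r + 1))⁻¹ := by rw [inv_div]
    rw [this]
    set L := 100 / (r + 1)
    have : L * |(x:ℝ)| ^ 2 + L⁻¹ * (1 / s ^ 2) - 2 * |(x:ℝ)| / s
        = L⁻¹ * (L * |(x:ℝ)| - 1 / s) ^ 2 := by
      field_simp; ring
    have h2 : 0 ≤ L⁻¹ * (L * |(x:ℝ)| - 1 / s) ^ 2 := by positivity
    have h6 : Real.sqrt (s ^ 2) = s := Real.sqrt_sq hs.le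
    rw [h6]
    linarith
  · rw [W_lin, hsq]
    have hi2 : W δ m v χ (fun _ N => 1 / ((N:ℝ) + 1)) 0 0 ≤ 4 / (r + 1) := by
      refine hinv.trans ?_
      have h5 : 0 ≤ (1 - δ) / 2 * r := mul_nonneg (by linarith) hr
      rw [div_le_div_iff₀ (by push_cast; linarith) (by positivity)]
      push_cast
      nlinarith
    have h3 : (r + 1) / 100 * W δ m v χ (fun _ N => 1 / ((N:ℝ) + 1)) 0 0 ≤ 0.04 := by
      calc _ ≤ (r + 1) / 100 * (4 / (r + 1)) := by gcongr
        _ = 0.04 := by field_simp; norm_num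
    have h4 : 100 / (r + 1) * ((((0:ℤ):ℝ) + δ * D) ^ 2 + δ * (1 - δ) * r) ≤ 0.1 := by
      rw [div_mul_eq_mul_div, div_le_iff₀ (by positivity)]
      push_cast
      have a1 : (0 + δ * D) ^ 2 ≤ δ * B * r := by
        calc (0 + δ * D) ^ 2 = δ * (δ * D ^ 2) := by ring
          _ ≤ δ * (1 * (B * r)) := by
            have : δ ≤ 1 := by linarith
            gcongr
          _ = _ := by ring
      have a2 : δ * (1 - δ) * r ≤ δ * 1 * r := by
        gcongr; linarith
      have a3 : (δ * (B + 1)) * r ≤ 1 / 1000 * r := by gcongr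
      nlinarith
    linarith

lemma sum_prProf_pm {n : ℕ} (ρ : Fin n → ℝ) (i : Fin n) :
    ∑ b, prProf ρ b * pm (b i) = 2 * ρ i - 1 := by
  have h : ∀ b : Fin n → Bool, prProf ρ b * pm (b i)
      = ∏ j, ((if b j then ρ j else 1 - ρ j) * (if j = i then pm (b j) else 1)) := by
    intro b
    rw [Finset.prod_mul_distrib, prProf]
    simp
  simp only [h]
  rw [← Fintype.prod_sum (fun (j : Fin n) (b : Bool) =>
    (if b then ρ j else 1 - ρ j) * (if j = i then pm b else 1))]
  rw [Finset.prod_eq_single i]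
  · simp [pm]; ring
  · intro j _ hj; simp [hj]
  · simp

lemma sign_pm (b : Bool) (s : ℝ) : Real.sign (pm b * s) = pm b * Real.sign s := by
  cases b <;> simp [pm, Real.sign_neg]

lemma expRow_eq {n m : ℕ} (M : Fin n → Fin m → ℝ) (i : Fin n) (ρ : Fin n → ℝ) (σ : Fin m → ℝ) :
    expRow M i ρ σ
      = (2 * ρ i - 1) * ∑ c : Fin m → Bool, prProf σ c * Real.sign (∑ j, M i j * pm (c j)) := by
  rw [← sum_prProf_pm, Finset.sum_mul_sum, expRow]
  refine Finset.sum_congr rfl fun b _ => Finset.sum_congr rfl fun c _ => ?_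
  rw [sign_pm]; ring

lemma expCol_eq {n m : ℕ} (M : Fin n → Fin m → ℝ) (j : Fin m) (ρ : Fin n → ℝ) (σ : Fin m → ℝ) :
    expCol M j ρ σ
      = -((2 * σ j - 1) * ∑ b : Fin n → Bool,
          prProf ρ b * Real.sign (∑ i, M i j * pm (b i))) := by
  rw [← sum_prProf_pm, Finset.sum_mul_sum, expCol, Finset.sum_comm, ← Finset.sum_neg_distrib]
  refine Finset.sum_congr rfl fun b _ => ?_
  rw [← Finset.sum_neg_distrib]
  refine Finset.sum_congr rfl fun c _ => ?_
  rw [sign_pm]; ring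

lemma row_bound (δ B : ℝ) (h0 : 0 ≤ δ) (h1 : δ ≤ 1 / 2) (m : ℕ) (u : Fin m → ℝ) (χ : Fin m → ℝ)
    (hu : ∀ j, u j = 0 ∨ u j = 1)
    (hχ : ∀ j, χ j = 1 ∨ χ j = -1)
    (hD : (∑ j, u j * χ j) ^ 2 ≤ B * ∑ j, u j)
    (hB0 : 0 ≤ B)
    (hB : δ * (B + 1) ≤ 1 / 1000) :
    |∑ c : Fin m → Bool, prProf (fun j => (1 + δ * χ j) / 2) c *
      Real.sign (∑ j, u j * pm (c j))| ≤ 0.2 := by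
  classical
  let v : Fin m → Bool := fun j => decide (u j = 1)
  let χ' : Fin m → ℤ := fun j => if χ j = 1 then 1 else -1
  have hχ' : ∀ j, χ' j = 1 ∨ χ' j = -1 := by
    intro j; by_cases h : χ j = 1 <;> simp [χ', h]
  have hc : ∀ j, (χ' j : ℝ) = χ j := by
    intro j
    rcases hχ j with h | h
    · simp [χ', h]
    · simp only [χ', h]; norm_num
  have e1 : ∀ j, (if v j then (χ' j : ℝ) else 0) = u j * χ j := by
    intro j
    rw [hc]
    rcases hu j with h | h <;> simp [v, h]
  have e2 : ∀ j, (if v j then (1 : ℝ) else 0) = u j := by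
    intro j
    rcases hu j with h | h <;> simp [v, h]
  have e3 : ∀ c : Fin m → Bool, sg (∑ j, if v j then pz (c j) else 0)
      = Real.sign (∑ j, u j * pm (c j)) := by
    intro c
    unfold sg
    congr 1
    push_cast
    refine Finset.sum_congr rfl fun j _ => ?_
    rcases hu j with h | h
    · simp [v, h]
    · cases hb : c j <;> simp [v, h, pz, pm]
  have := E_bound δ B h0 h1 m v χ' hχ' (by simpa only [e1, e2] using hD) hB0 hB
  simpa only [hc, e3] using this

/-- If the `α`-balanced Beck–Fiala conjecture holds (every `α`-balanced 0-1 matrix `M`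
satisfies `disc(M) ≤ C√t`, where `t` is the sum of the first row), then there is a constant
`k = k(α)` such that every majority matching-pennies game defined by an `α`-balanced 0-1
matrix has a `0.4`-Nash equilibrium in which every player plays action `1` with probability
`(k+1)/(2k)` or `(k−1)/(2k)`. -/
theorem stmt4 (α : ℝ) (hα : 1 ≤ α)
    (hBF : ∃ C : ℝ, 0 < C ∧ ∀ (n m : ℕ) (M : Fin (n + 1) → Fin (m + 1) → ℝ),
      Entries01 M → BalancedMat α M →
      ∃ χ : Fin (m + 1) → ℝ, (∀ j, χ j = 1 ∨ χ j = -1) ∧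
        ∀ i, |∑ j, M i j * χ j| ≤ C * Real.sqrt (∑ j, M 0 j)) :
    ∃ k : ℕ, 0 < k ∧ ∀ (n m : ℕ) (M : Fin (n + 1) → Fin (m + 1) → ℝ),
      Entries01 M → BalancedMat α M →
      ∃ (ρ : Fin (n + 1) → ℝ) (σ : Fin (m + 1) → ℝ),
        (∀ i, ρ i = ((k : ℝ) + 1) / (2 * k) ∨ ρ i = ((k : ℝ) - 1) / (2 * k)) ∧
        (∀ j, σ j = ((k : ℝ) + 1) / (2 * k) ∨ σ j = ((k : ℝ) - 1) / (2 * k)) ∧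
        IsENashMMP M 0.4 ρ σ := by
  obtain ⟨C, hC, hBF⟩ := hBF
  obtain ⟨k, hk⟩ := exists_nat_ge (1000 * (C ^ 2 * α + 1))
  have hB0 : 0 ≤ C ^ 2 * α := by positivity
  have hk1 : (1000:ℝ) ≤ k := by linarith
  have hkpos : (0:ℝ) < k := by linarith
  have hδ0 : 0 ≤ 1 / (k:ℝ) := by positivity
  have hδ1 : 1 / (k:ℝ) ≤ 1 / 2 := by
    apply one_div_le_one_div_of_le <;> linarith
  have hδB : 1 / (k:ℝ) * (C ^ 2 * α + 1) ≤ 1 / 1000 := by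
    rw [one_div_mul_eq_div, div_le_iff₀ hkpos]; linarith
  refine ⟨k, by exact_mod_cast hkpos, ?_⟩
  intro n m M hM hbal
  obtain ⟨b1, b2, b3, b4⟩ := hbal
  obtain ⟨χ, hχ, hd⟩ := hBF n m M hM ⟨b1, b2, b3, b4⟩
  obtain ⟨ψ, hψ, he⟩ := hBF m n (fun j i => M i j) (fun j i => hM i j)
    ⟨b2, b1, fun j i => b4 i j, fun j i => b3 i j⟩
  have hnn : ∀ i j, 0 ≤ M i j := by
    intro i j; rcases hM i j with h | h <;> rw [h] <;> norm_num
  have sqb : ∀ x r s : ℝ, 0 ≤ r → r ≤ α * s → |x| ≤ C * Real.sqrt r → x ^ 2 ≤ C ^ 2 * α * s := by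
    intro x r s hr hrs hx
    have : |x| ^ 2 ≤ (C * Real.sqrt r) ^ 2 := by gcongr
    rw [sq_abs, mul_pow, Real.sq_sqrt hr] at this
    have h2 : C ^ 2 * r ≤ C ^ 2 * (α * s) := by gcongr
    linarith
  have hrow : ∀ i, |∑ c : Fin (m + 1) → Bool, prProf (fun j => (1 + 1 / (k:ℝ) * χ j) / 2) c *
      Real.sign (∑ j, M i j * pm (c j))| ≤ 0.2 := fun i =>
    row_bound _ (C ^ 2 * α) hδ0 hδ1 _ (fun j => M i j) χ (hM i) hχ
      (sqb _ _ _ (Finset.sum_nonneg fun j _ => hnn 0 j) (b1 0 i) (hd i)) hB0 hδB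
  have hcol : ∀ j, |∑ b : Fin (n + 1) → Bool, prProf (fun i => (1 + 1 / (k:ℝ) * ψ i) / 2) b *
      Real.sign (∑ i, M i j * pm (b i))| ≤ 0.2 := fun j =>
    row_bound _ (C ^ 2 * α) hδ0 hδ1 _ (fun i => M i j) ψ (fun i => hM i j) hψ
      (sqb _ _ _ (Finset.sum_nonneg fun i _ => hnn i 0) (b2 0 j) (he j)) hB0 hδB
  have hval : ∀ y : ℝ, (y = 1 ∨ y = -1) → ((1 + 1 / (k:ℝ) * y) / 2 = ((k : ℝ) + 1) / (2 * k) ∨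
      (1 + 1 / (k:ℝ) * y) / 2 = ((k : ℝ) - 1) / (2 * k)) := by
    intro y hy
    rcases hy with rfl | rfl
    · left; field_simp
    · right; field_simp; ring
  have hIcc : ∀ y : ℝ, (y = 1 ∨ y = -1) → (1 + 1 / (k:ℝ) * y) / 2 ∈ Set.Icc (0:ℝ) 1 := by
    intro y hy
    rcases hy with rfl | rfl <;> constructor <;> linarith
  have gain : ∀ p q e : ℝ, p ∈ Set.Icc (0:ℝ) 1 → q ∈ Set.Icc (0:ℝ) 1 → |e| ≤ 0.2 →
      |(q - p) * e| ≤ 0.2 := by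
    intro p q e hp hq he
    rw [abs_mul]
    have : |q - p| ≤ 1 := by
      rw [abs_le]; constructor <;> linarith [hp.1, hp.2, hq.1, hq.2]
    calc |q - p| * |e| ≤ 1 * 0.2 := by gcongr
      _ = 0.2 := by norm_num
  refine ⟨fun i => (1 + 1 / (k:ℝ) * ψ i) / 2, fun j => (1 + 1 / (k:ℝ) * χ j) / 2,
    fun i => hval _ (hψ i), fun j => hval _ (hχ j), fun i => hIcc _ (hψ i),
    fun j => hIcc _ (hχ j), ?_, ?_⟩
  · intro i q hq
    rw [expRow_eq, expRow_eq, Function.update_self]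
    have := (abs_le.mp (gain _ q _ (hIcc _ (hψ i)) hq (hrow i))).2
    linarith
  · intro j q hq
    rw [expCol_eq, expCol_eq, Function.update_self]
    have := (abs_le.mp (gain _ q _ (hIcc _ (hχ j)) hq (hcol j))).1
    linarith
end

section
/- For every k ∈ ℕ there exists an n-player binary-action game with n = (2^k − 1)·2^{2^{k−1}} players and payoffs in {0,1} such that: (a) the individually rational level of every player is at least 1/2, and (b) for every probability distribution μ on the pure action profiles {0,1}^n whose support has size at most (1/4)·2^k, some player has expected payoff at most 1/4 under μ. Consequently, every distribution over action profiles whose support has size less than (1/4)·log₂ n is not 1/4-individually rational in this game. -/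
open Finset

/-- The number of players in the construction: `n = (2^k − 1)·2^(2^(k−1))`. -/
def numPlayers (k : ℕ) : ℕ := (2 ^ k - 1) * 2 ^ (2 ^ (k - 1))

/-- The state space `F_2^(m+1)`. -/
abbrev VV (m : ℕ) := Fin (m + 1) → ZMod 2

/-- Players: a nonzero direction together with a function on the quotient. -/
abbrev PP (m : ℕ) := {w : VV m // w ≠ 0} × ((Fin m → ZMod 2) → ZMod 2)

lemma card_PP (m : ℕ) : Fintype.card (PP m) = numPlayers (m + 1) := by
  simp [numPlayers, Fintype.card_subtype_compl, ZMod.card]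

lemma zmod2_cases (z : ZMod 2) : z = 0 ∨ z = 1 := by
  revert z; decide

lemma exists_one {m : ℕ} (w : {w : VV m // w ≠ 0}) : ∃ j, w.1 j = 1 := by
  obtain ⟨j, hj⟩ := Function.ne_iff.mp w.2
  exact ⟨j, (zmod2_cases _).resolve_left hj⟩

/-- A coordinate where `w` is one. -/
noncomputable def JJ {m : ℕ} (w : {w : VV m // w ≠ 0}) : Fin (m + 1) := (exists_one w).choose

lemma JJ_spec {m : ℕ} (w : {w : VV m // w ≠ 0}) : w.1 (JJ w) = 1 := (exists_one w).choose_spec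

/-- The payoff function of a player on states. -/
noncomputable def HH {m : ℕ} (q : PP m) (x : VV m) : ZMod 2 :=
  q.2 ((JJ q.1).removeNth (x + x (JJ q.1) • q.1.1)) + x (JJ q.1)

lemma VV_add_self {m : ℕ} (w : VV m) : w + w = 0 := by
  funext i; exact CharTwo.add_self_eq_zero _

lemma HH_add {m : ℕ} (q : PP m) (x : VV m) : HH q (x + q.1.1) = HH q x + 1 := by
  unfold HH
  have h1 : (x + q.1.1) (JJ q.1) = x (JJ q.1) + 1 := by simp [JJ_spec]
  have h2 : x + q.1.1 + (x (JJ q.1) + 1) • q.1.1 = x + x (JJ q.1) • q.1.1 := by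
    rw [add_smul, one_smul]
    calc _ = x + x (JJ q.1) • q.1.1 + (q.1.1 + q.1.1) := by abel
      _ = _ := by rw [VV_add_self, add_zero]
  rw [h1, h2, add_assoc]

lemma exists_HH {m : ℕ} (w : {w : VV m // w ≠ 0}) (T : Finset (VV m)) :
    ∃ g, ∀ x ∈ T, HH (w, g) x = 1 → x + w.1 ∈ T := by
  classical
  refine ⟨fun r => if (JJ w).insertNth (α := fun _ => ZMod 2) 0 r ∈ T then 0 else 1, ?_⟩
  intro x hx h
  have key : (JJ w).insertNth (α := fun _ => ZMod 2) 0
      ((JJ w).removeNth (x + x (JJ w) • w.1)) = x + x (JJ w) • w.1 := by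
    have : (0 : ZMod 2) = (x + x (JJ w) • w.1) (JJ w) := by
      simp [JJ_spec, CharTwo.add_self_eq_zero]
    conv_lhs => rw [this]
    exact Fin.insertNth_self_removeNth _ _
  simp only [HH] at h
  rw [key] at h
  rcases zmod2_cases (x (JJ w)) with h0 | h0
  · simp [h0, hx] at h
  · rw [h0, one_smul] at h
    by_contra hc
    simp [hc] at h

/-- The state reached by a profile. -/
def stt {m n : ℕ} (e : Fin n ≃ PP m) (a : Fin n → Fin 2) : VV m :=
  ∑ i, if a i = 1 then (e i).1.1 else 0

/-- The payoff. -/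
noncomputable def uu {m n : ℕ} (e : Fin n ≃ PP m) (i : Fin n) (a : Fin n → Fin 2) : ℝ :=
  if HH (e i) (stt e a) = 1 then 1 else 0

lemma stt_update {m n : ℕ} (e : Fin n ≃ PP m) (a : Fin n → Fin 2) (i : Fin n) :
    stt e (Function.update a i 1) = stt e (Function.update a i 0) + (e i).1.1 := by
  classical
  unfold stt
  rw [← Finset.add_sum_erase _ _ (mem_univ i),
    ← Finset.add_sum_erase univ
      (fun j => if Function.update a i 0 j = 1 then (e j).1.1 else 0) (mem_univ i)]
  have : ∀ b : Fin 2, ∑ x ∈ univ.erase i, (if Function.update a i b x = 1 then (e x).1.1 else 0)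
      = ∑ x ∈ univ.erase i, (if a x = 1 then (e x).1.1 else 0) := by
    intro b
    refine Finset.sum_congr rfl fun x hx => ?_
    rw [Function.update_of_ne (Finset.ne_of_mem_erase hx)]
  rw [this, this]
  simp [add_comm]

lemma uu_half {m n : ℕ} (e : Fin n ≃ PP m) (i : Fin n) (a : Fin n → Fin 2) :
    (1 : ℝ) / 2 ≤ ∑ b : Fin 2, (1 / 2 : ℝ) * uu e i (Function.update a i b) := by
  rw [Fin.sum_univ_two]
  unfold uu
  rw [stt_update, HH_add]
  rcases zmod2_cases (HH (e i) (stt e (Function.update a i 0))) with h | h <;> simp [h]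

lemma uu_bad {m n : ℕ} (e : Fin n ≃ PP m) (μ : (Fin n → Fin 2) → ℝ) (h0 : ∀ a, 0 ≤ μ a)
    (h1 : ∑ a, μ a = 1) (S : Finset (Fin n → Fin 2)) (hS : ∀ a, μ a ≠ 0 → a ∈ S)
    (hc : 4 * S.card ≤ 2 ^ (m + 1)) : ∃ i, ∑ a, μ a * uu e i a < 1 / 4 := by
  classical
  set T := S.image (stt e) with hT
  have hTc : T.card ≤ S.card := Finset.card_image_le
  choose g hg using fun w : {w : VV m // w ≠ 0} => exists_HH w T
  by_contra! hcon
  have hW : (Fintype.card {w : VV m // w ≠ 0} : ℝ) = 2 ^ (m + 1) - 1 := by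
    have : Fintype.card {w : VV m // w ≠ 0} = 2 ^ (m + 1) - 1 := by
      simp [Fintype.card_subtype_compl, ZMod.card]
    rw [this, Nat.cast_sub Nat.one_le_two_pow]; simp
  have low : (2 ^ (m + 1) - 1 : ℝ) * (1 / 4) ≤
      ∑ w : {w : VV m // w ≠ 0}, ∑ a, μ a * uu e (e.symm (w, g w)) a := by
    rw [← hW, ← nsmul_eq_mul, ← Finset.card_univ]
    exact Finset.card_nsmul_le_sum _ _ _ fun w _ => hcon _
  have up : ∑ w : {w : VV m // w ≠ 0}, ∑ a, μ a * uu e (e.symm (w, g w)) a ≤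
      ∑ a, μ a * ((T.card : ℝ) - 1) := by
    rw [Finset.sum_comm]
    refine Finset.sum_le_sum fun a _ => ?_
    rw [← Finset.mul_sum]
    by_cases ha : μ a = 0
    · simp [ha]
    refine mul_le_mul_of_nonneg_left ?_ (h0 a)
    have haT : stt e a ∈ T := Finset.mem_image_of_mem _ (hS a ha)
    have : ∑ w : {w : VV m // w ≠ 0}, uu e (e.symm (w, g w)) a ≤
        ((univ.filter fun w : {w : VV m // w ≠ 0} => stt e a + w.1 ∈ T).card : ℝ) := by
      rw [Finset.card_filter]
      push_cast
      refine Finset.sum_le_sum fun w _ => ?_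
      unfold uu
      rw [Equiv.apply_symm_apply]
      by_cases hh : HH (w, g w) (stt e a) = 1
      · simp [hh, hg w _ haT hh]
      · rw [if_neg hh]; split_ifs <;> norm_num
    refine this.trans ?_
    have h2 : (univ.filter fun w : {w : VV m // w ≠ 0} => stt e a + w.1 ∈ T).card ≤
        (T.erase (stt e a)).card := by
      refine Finset.card_le_card_of_injOn (fun w => stt e a + w.1) ?_ ?_
      · intro w hw
        have hw' : stt e a + w.1 ∈ T := by simpa using hw
        have := w.2
        simpa [this] using hw'
      · intro w _ w' _ h
        exact Subtype.ext (add_left_cancel h)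
    rw [Finset.card_erase_of_mem haT] at h2
    have h3 : 1 ≤ T.card := Finset.card_pos.mpr ⟨_, haT⟩
    have h4 : ((T.card - 1 : ℕ) : ℝ) = (T.card : ℝ) - 1 := by push_cast [h3]; ring
    rw [← h4]
    exact_mod_cast h2
  rw [← Finset.sum_mul, h1, one_mul] at up
  have h5 : (4 * T.card : ℝ) ≤ 2 ^ (m + 1) := by
    exact_mod_cast (Nat.mul_le_mul_left 4 hTc).trans hc
  linarith

lemma log_bound (m c : ℕ) (h : (c : ℝ) < (1 / 4) * Real.logb 2 (numPlayers (m + 1))) :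
    4 * c ≤ 2 ^ (m + 1) := by
  have hm : m + 1 ≤ 2 ^ m := Nat.lt_two_pow_self
  have hle : numPlayers (m + 1) ≤ 2 ^ (2 ^ (m + 1)) := by
    unfold numPlayers
    calc _ ≤ 2 ^ (m + 1) * 2 ^ 2 ^ (m + 1 - 1) := Nat.mul_le_mul_right _ (Nat.sub_le _ _)
      _ = 2 ^ (m + 1 + 2 ^ m) := by rw [pow_add 2 (m + 1)]; simp
      _ ≤ _ := Nat.pow_le_pow_right (by norm_num) (by rw [pow_succ 2 m]; omega)
  have hpos : 0 < numPlayers (m + 1) := by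
    unfold numPlayers
    have : 1 < 2 ^ (m + 1) := Nat.one_lt_two_pow (by omega)
    exact Nat.mul_pos (by omega) (by positivity)
  have : Real.logb 2 (numPlayers (m + 1)) ≤ 2 ^ (m + 1) := by
    rw [Real.logb_le_iff_le_rpow (by norm_num) (by exact_mod_cast hpos)]
    have : ((2 : ℝ) ^ ((2 : ℝ) ^ (m + 1))) = ((2 ^ (2 ^ (m + 1)) : ℕ) : ℝ) := by
      rw [show ((2 : ℝ) ^ (m + 1)) = ((2 ^ (m + 1) : ℕ) : ℝ) by push_cast; rfl, Real.rpow_natCast]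
      push_cast; rfl
    rw [this]
    exact_mod_cast hle
  have : (4 * c : ℝ) ≤ 2 ^ (m + 1) := by linarith
  exact_mod_cast this

/-- For every `k` there is an `n`-player binary-action game, `n = (2^k − 1)·2^(2^(k−1))`,
with payoffs in `{0,1}` such that: (a) the individually rational level of every player is at
least `1/2` (witnessed by a mixed strategy guaranteeing `1/2` against every pure opponent
profile); (b) for every distribution `μ` over pure profiles whose support has size at most
`2^k/4`, some player gets expected payoff at most `1/4` under `μ`; and consequently (c) every
distribution whose support has size less than `(1/4)·log₂ n` is not `1/4`-individually
rational: some player `i` has expected payoff under `μ` smaller than `v_i − 1/4`, witnessed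
by a mixed strategy of `i` whose payoff exceeds `E_μ[u_i] + 1/4` against every pure opponent
profile. -/
theorem stmt6 (k : ℕ) :
    ∃ u : Fin (numPlayers k) → ((Fin (numPlayers k) → Fin 2) → ℝ),
      (∀ i a, u i a = 0 ∨ u i a = 1) ∧
      (∀ i : Fin (numPlayers k), ∃ p : Fin 2 → ℝ, (∀ b, 0 ≤ p b) ∧ (∑ b, p b = 1) ∧
        ∀ a : Fin (numPlayers k) → Fin 2,
          (1 : ℝ) / 2 ≤ ∑ b, p b * u i (Function.update a i b)) ∧
      (∀ μ : (Fin (numPlayers k) → Fin 2) → ℝ, (∀ a, 0 ≤ μ a) → (∑ a, μ a = 1) →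
        ∀ S : Finset (Fin (numPlayers k) → Fin 2), (∀ a, μ a ≠ 0 → a ∈ S) →
          4 * S.card ≤ 2 ^ k →
          ∃ i, ∑ a, μ a * u i a ≤ 1 / 4) ∧
      (∀ μ : (Fin (numPlayers k) → Fin 2) → ℝ, (∀ a, 0 ≤ μ a) → (∑ a, μ a = 1) →
        ∀ S : Finset (Fin (numPlayers k) → Fin 2), (∀ a, μ a ≠ 0 ↔ a ∈ S) →
          (S.card : ℝ) < (1 / 4) * Real.logb 2 (numPlayers k) →
          ∃ i : Fin (numPlayers k), ∃ p : Fin 2 → ℝ, (∀ b, 0 ≤ p b) ∧ (∑ b, p b = 1) ∧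
            ∀ a : Fin (numPlayers k) → Fin 2,
              (∑ a', μ a' * u i a') < (∑ b, p b * u i (Function.update a i b)) - 1 / 4) := by
  rcases k with _ | m
  · have h0 : numPlayers 0 = 0 := by simp [numPlayers]
    have hE : ∀ i : Fin (numPlayers 0), False := fun i => by
      have := i.2; omega
    refine ⟨fun i => (hE i).elim, fun i => (hE i).elim, fun i => (hE i).elim, ?_, ?_⟩
    · intro μ _ h1 S hS hc
      have hS0 : S = ∅ := Finset.card_eq_zero.mp (by simp at hc; omega)
      have : ∑ a, μ a = 0 := Finset.sum_eq_zero fun a _ => by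
        by_contra h
        have := hS a h
        simp [hS0] at this
      rw [this] at h1; norm_num at h1
    · intro μ _ _ S _ hc
      have hl : Real.logb 2 (numPlayers 0 : ℝ) = 0 := by rw [h0]; simp
      rw [hl] at hc
      have : (0 : ℝ) ≤ S.card := Nat.cast_nonneg _
      linarith
  · have e : Fin (numPlayers (m + 1)) ≃ PP m := (Fintype.equivFinOfCardEq (card_PP m)).symm
    have hp : ∑ b : Fin 2, (1 / 2 : ℝ) = 1 := by norm_num
    refine ⟨uu e, ?_, ?_, ?_, ?_⟩
    · intro i a
      unfold uu
      split_ifs <;> simp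
    · intro i
      exact ⟨fun _ => 1 / 2, fun _ => by norm_num, hp, uu_half e i⟩
    · intro μ h0 h1 S hS hc
      obtain ⟨i, hi⟩ := uu_bad e μ h0 h1 S hS hc
      exact ⟨i, hi.le⟩
    · intro μ h0 h1 S hS hc
      obtain ⟨i, hi⟩ := uu_bad e μ h0 h1 S (fun a => (hS a).mp) (log_bound m _ hc)
      refine ⟨i, fun _ => 1 / 2, fun _ => by norm_num, hp, fun a => ?_⟩
      have := uu_half e i a
      linarith
end

section
/- Fix k ∈ ℕ and consider the game with player set {(s,p) : 0 ≠ s ∈ {0,1}^k, p ∈ {0,1}^{2^{k−1}}}, where p encodes a set V_{s,p} ⊆ {0,1}^k containing exactly one element of each pair {x, x ⊕ s} (x ∈ {0,1}^k). Each player has actions {0,1}; for a pure profile a, define f(a) = ⊕ of s over all players (s,p) with a_{(s,p)} = 1 (XOR in {0,1}^k), and let player (s,p)'s payoff be 1 if f(a) ∈ V_{s,p} and 0 otherwise. Then for every player (s',p') and every pure action profile a_{−(s',p')} of the other players, exactly one of the two actions of (s',p') yields payoff 1 and the other yields payoff 0; that is, u_{(s',p')}(0, a_{−(s',p')}) + u_{(s',p')}(1,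 a_{−(s',p')}) = 1. -/
open Finset

/-- Coordinatewise addition modulo 2 (XOR) on `{0,1}^k`. -/
def xorv {k : ℕ} (x s : Fin k → Bool) : Fin k → Bool := fun i => xor (x i) (s i)

/-- The players of the game: pairs `(s, V)` where `0 ≠ s ∈ {0,1}^k` and `V ⊆ {0,1}^k`
contains exactly one element of each pair `{x, x ⊕ s}` (i.e. `x ∈ V ↔ x ⊕ s ∉ V`).
Such sets `V` are exactly the sets encoded by the vectors `p ∈ {0,1}^{2^{k−1}}`. -/
def Players (k : ℕ) : Type :=
  { sV : (Fin k → Bool) × Finset (Fin k → Bool) //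
      sV.1 ≠ (fun _ => false) ∧ ∀ x, x ∈ sV.2 ↔ xorv x sV.1 ∉ sV.2 }

instance (k : ℕ) : Fintype (Players k) := by unfold Players; infer_instance

instance (k : ℕ) : DecidableEq (Players k) := by unfold Players; infer_instance

/-- `f(a) ∈ {0,1}^k` is the XOR of `s` over all players `(s, V)` playing action `1` in the
pure profile `a`; coordinatewise, it is the parity of the number of such players whose `s`
has a `1` in that coordinate. -/
def fXor {k : ℕ} (a : Players k → Bool) : Fin k → Bool := fun i =>
  decide (Odd (Finset.univ.filter fun pl : Players k => a pl = true ∧ pl.val.1 i = true).card)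

/-- The payoff of player `(s, V)`: `1` if `f(a) ∈ V` and `0` otherwise. -/
def payoffXor {k : ℕ} (pl : Players k) (a : Players k → Bool) : ℝ :=
  if fXor a ∈ pl.val.2 then 1 else 0

theorem fXor_update {k : ℕ} (pl : Players k) (a : Players k → Bool) :
    fXor (Function.update a pl true) = xorv (fXor (Function.update a pl false)) pl.val.1 := by
  funext i
  unfold xorv fXor
  cases h : pl.val.1 i with
  | false =>
    have : (Finset.univ.filter fun q : Players k =>
        Function.update a pl true q = true ∧ q.val.1 i = true) =
        (Finset.univ.filter fun q : Players k =>
        Function.update a pl false q = true ∧ q.val.1 i = true) := by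
      ext q
      by_cases hq : q = pl
      · subst hq; simp [h]
      · simp [hq]
    rw [this]; simp
  | true =>
    have : (Finset.univ.filter fun q : Players k =>
        Function.update a pl true q = true ∧ q.val.1 i = true) =
        insert pl (Finset.univ.filter fun q : Players k =>
        Function.update a pl false q = true ∧ q.val.1 i = true) := by
      ext q
      by_cases hq : q = pl
      · subst hq; simp [h]
      · simp [hq]
    rw [this, Finset.card_insert_of_notMem (by simp)]
    simp [Nat.odd_add_one, -Nat.not_odd_iff_even]

/-- In the XOR game, for every player and every pure profile of the other players, exactly
one of the player's two actions yields payoff `1` and the other yields payoff `0`: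
`u_{(s',p')}(0, a₋) + u_{(s',p')}(1, a₋) = 1`. -/
theorem stmt7 (k : ℕ) (pl : Players k) (a : Players k → Bool) :
    payoffXor pl (Function.update a pl false) + payoffXor pl (Function.update a pl true) = 1 := by
  have h := pl.property.2 (fXor (Function.update a pl false))
  unfold payoffXor
  rw [fXor_update]
  by_cases h1 : fXor (Function.update a pl false) ∈ pl.val.2
  · rw [if_pos h1, if_neg (h.1 h1)]; norm_num
  · rw [if_neg h1, if_pos (by by_contra h2; exact h1 (h.2 h2))]; norm_num
end

section
/- Let k ∈ ℕ and let ν be a probability distribution on {0,1}^k whose support has size at most 2^k/4. Then there exists s ∈ {0,1}^k with s ≠ 0 such that Pr_{x∼ν}(x ⊕ s ∉ supp(ν)) ≥ 3/4. -/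
open Finset

/-- If `ν` is a probability distribution on `{0,1}^k` whose support `S` has size at most
`2^k/4`, then there is a nonzero `s ∈ {0,1}^k` with `Pr_{x∼ν}(x ⊕ s ∉ supp ν) ≥ 3/4`. -/
theorem stmt8 (k : ℕ) (ν : (Fin k → Bool) → ℝ)
    (hν0 : ∀ x, 0 ≤ ν x) (hν1 : ∑ x, ν x = 1)
    (S : Finset (Fin k → Bool)) (hS : ∀ x, ν x ≠ 0 ↔ x ∈ S)
    (hcard : 4 * S.card ≤ 2 ^ k) :
    ∃ s : Fin k → Bool, s ≠ (fun _ => false) ∧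
      (3 : ℝ) / 4 ≤ ∑ x ∈ Finset.univ.filter (fun x => xorv x s ∉ S), ν x := by
  by_contra hcon
  push Not at hcon
  have hlt : ∀ s : Fin k → Bool,
      ∑ x ∈ Finset.univ.filter (fun x => xorv x s ∉ S), ν x < 3 / 4 := by
    intro s
    by_cases hs : s = fun _ => false
    · have h0 : ∑ x ∈ Finset.univ.filter (fun x => xorv x s ∉ S), ν x = 0 := by
        apply Finset.sum_eq_zero
        intro x hx
        have hx2 := (Finset.mem_filter.mp hx).2
        have hxs : xorv x s = x := by
          funext i
          simp [xorv, hs]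
        rw [hxs] at hx2
        by_contra hne
        exact hx2 ((hS x).1 hne)
      rw [h0]
      norm_num
    · exact hcon s hs
  have hsum : ∑ s : Fin k → Bool,
      ∑ x ∈ Finset.univ.filter (fun x => xorv x s ∉ S), ν x
      < ∑ _s : Fin k → Bool, (3 / 4 : ℝ) :=
    Finset.sum_lt_sum_of_nonempty Finset.univ_nonempty (fun s _ => hlt s)
  have hcount : ∀ x : Fin k → Bool,
      ∑ s : Fin k → Bool, (if xorv x s ∉ S then ν x else 0)
        = ((2 : ℝ) ^ k - S.card) * ν x := by
    intro x
    have hinv : Function.Involutive (xorv x) := by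
      intro s
      funext i
      simp [xorv]
    have h1 : ∑ s : Fin k → Bool, (if xorv x s ∉ S then ν x else 0)
        = ∑ y : Fin k → Bool, (if y ∉ S then ν x else 0) :=
      Equiv.sum_comp hinv.toPerm (fun y => if y ∉ S then ν x else 0)
    have h2 : (Finset.univ.filter (fun y : Fin k → Bool => y ∉ S)) = Sᶜ := by
      ext y
      simp
    have h3 : ((Sᶜ).card : ℝ) = (2 : ℝ) ^ k - S.card := by
      have := Finset.card_add_card_compl S
      simp only [Fintype.card_pi, Fintype.card_bool, Finset.prod_const, Finset.card_univ,
        Fintype.card_fin] at this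
      have h : (S.card : ℝ) + (Sᶜ).card = 2 ^ k := by exact_mod_cast this
      linarith
    rw [h1, ← Finset.sum_filter, h2, Finset.sum_const, nsmul_eq_mul, h3]
  have heq : ∑ s : Fin k → Bool,
      ∑ x ∈ Finset.univ.filter (fun x => xorv x s ∉ S), ν x = (2 : ℝ) ^ k - S.card := by
    simp only [Finset.sum_filter]
    rw [Finset.sum_comm]
    simp only [hcount]
    rw [← Finset.mul_sum, hν1, mul_one]
  rw [heq] at hsum
  simp only [Finset.sum_const, Finset.card_univ, Fintype.card_pi, Fintype.card_bool,
    Finset.prod_const, Fintype.card_fin, nsmul_eq_mul, Nat.cast_pow, Nat.cast_ofNat] at hsum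
  have hc : (4 : ℝ) * S.card ≤ 2 ^ k := by exact_mod_cast hcard
  linarith
end

section
/- For every ε, δ ∈ (0,1), every m ≥ 2, and every natural number k with k ≥ 2·(m·ln m − ln δ)/ε², every n-player m-action game (with payoffs in [0,1]) admits a k-uniform distribution over pure action profiles that is an (ε,δ)-weak approximate correlated equilibrium. -/
open Finset

/-- Theorem of the alternative (a form of the minimax theorem), by separation. -/
lemma ville_alt {K A : Type} [Fintype K] [Fintype A] [DecidableEq K] (R : K → A → ℝ)
    (h : ∀ w : K → ℝ, (∀ k, 0 ≤ w k) → ∃ x ∈ stdSimplex ℝ A, ∑ k, w k * ∑ a, x a * R k a ≤ 0) :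
    ∃ x ∈ stdSimplex ℝ A, ∀ k, ∑ a, x a * R k a ≤ 0 := by
  by_contra hcon
  push Not at hcon
  let T : (A → ℝ) →ₗ[ℝ] (K → ℝ) :=
    { toFun := fun x k => ∑ a, x a * R k a
      map_add' := by
        intro x y; ext k; simp [add_mul, Finset.sum_add_distrib]
      map_smul' := by
        intro c x; ext k; simp [Finset.mul_sum, mul_assoc] }
  have hT : ∀ x k, T x k = ∑ a, x a * R k a := fun x k => rfl
  have hcont : Continuous T := T.continuous_of_finiteDimensional
  have hcomp : IsCompact (T '' stdSimplex ℝ A) := (isCompact_stdSimplex ℝ A).image hcont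
  have hconv : Convex ℝ (T '' stdSimplex ℝ A) := (convex_stdSimplex ℝ A).linear_image T
  have hdisj : Disjoint (Set.Iic (0 : K → ℝ)) (T '' stdSimplex ℝ A) := by
    rw [Set.disjoint_left]
    rintro y hy ⟨x, hx, rfl⟩
    obtain ⟨k, hk⟩ := hcon x hx
    have := hy k
    rw [hT] at this
    simp at this
    linarith
  obtain ⟨g, s, t, h1, h2, h3⟩ := geometric_hahn_banach_closed_compact (convex_Iic (0 : K → ℝ))
    isClosed_Iic hconv hcomp hdisj
  have hs : 0 < s := by simpa using h1 0 (by simp)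
  have hg : ∀ y, g y = ∑ k, g (Pi.single k 1) * y k := by
    intro y
    conv_lhs => rw [pi_eq_sum_univ' y]
    rw [map_sum]
    refine Finset.sum_congr rfl fun k _ => ?_
    rw [map_smul, smul_eq_mul, mul_comm]
  have hw : ∀ k, 0 ≤ g (Pi.single k 1) := by
    intro k
    by_contra hneg
    push Not at hneg
    have := h1 ((s / g (Pi.single k 1)) • Pi.single k 1) (by
      rw [Set.mem_Iic]
      have hc : s / g (Pi.single k 1) ≤ 0 := (div_neg_of_pos_of_neg hs hneg).le
      intro j
      by_cases hj : j = k
      · subst hj; simpa using hc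
      · simp [hj])
    rw [map_smul, smul_eq_mul, div_mul_cancel₀ _ hneg.ne] at this
    exact lt_irrefl _ this
  obtain ⟨x, hx, hle⟩ := h _ hw
  have := h3 (T x) ⟨x, hx, rfl⟩
  rw [hg] at this
  simp only [hT] at this
  linarith

/-- Stationary distributions. -/
lemma exists_stationary {m : ℕ} (hm : 0 < m) (l : (Fin m → Fin m) → ℝ) (hl : ∀ f, 0 ≤ l f) :
    ∃ p ∈ stdSimplex ℝ (Fin m), ∀ h : Fin m → ℝ,
      ∑ f, l f * ∑ a, p a * (h (f a) - h a) = 0 := by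
  haveI : Nonempty (Fin m) := ⟨⟨0, hm⟩⟩
  let R : Fin m → Fin m → ℝ := fun b a =>
    ∑ f, l f * ((if f a = b then (1:ℝ) else 0) - (if a = b then 1 else 0))
  have key : ∀ (w : Fin m → ℝ) (p : Fin m → ℝ), ∑ b, w b * ∑ a, p a * R b a
      = ∑ a, p a * ∑ f, l f * (w (f a) - w a) := by
    intro w p
    simp only [R, Finset.mul_sum]
    rw [Finset.sum_comm]
    refine Finset.sum_congr rfl fun a _ => ?_
    rw [Finset.sum_comm]
    refine Finset.sum_congr rfl fun f _ => ?_
    have : ∀ b, w b * (p a * (l f * ((if f a = b then (1:ℝ) else 0) - (if a = b then 1 else 0))))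
       = (if f a = b then p a * (l f * w b) else 0) - (if a = b then p a * (l f * w b) else 0) := by
      intro b; split_ifs <;> ring
    simp only [this, Finset.sum_sub_distrib]
    simp
    ring
  obtain ⟨p, hp, hR⟩ := ville_alt R (by
    intro w _
    obtain ⟨a₀, ha₀⟩ := Finite.exists_max w
    refine ⟨Pi.single a₀ 1, single_mem_stdSimplex ℝ a₀, ?_⟩
    rw [key, Finset.sum_eq_single a₀]
    · simp only [Pi.single_eq_same, one_mul]
      exact Finset.sum_nonpos fun f _ => mul_nonpos_of_nonneg_of_nonpos (hl f) (by linarith [ha₀ (f a₀)])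
    · intro b _ hb; simp [hb]
    · simp)
  have hsum : ∑ b, ∑ a, p a * R b a = 0 := by
    have := key (fun _ => 1) p
    simpa using this
  have hzero : ∀ b, ∑ a, p a * R b a = 0 := by
    intro b
    exact (Finset.sum_eq_zero_iff_of_nonpos (fun b _ => hR b)).1 hsum b (Finset.mem_univ _)
  refine ⟨p, hp, fun h => ?_⟩
  have := key h p
  simp only [hzero, mul_zero, Finset.sum_const_zero] at this
  rw [this]
  simp only [Finset.mul_sum]
  rw [Finset.sum_comm]
  refine Finset.sum_congr rfl fun a _ => Finset.sum_congr rfl fun f _ => by ring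

lemma prod_mem_stdSimplex {T A : Type} [Fintype T] [DecidableEq T] [Fintype A] (p : T → A → ℝ)
    (hp : ∀ i, p i ∈ stdSimplex ℝ A) : (fun a : T → A => ∏ i, p i (a i)) ∈ stdSimplex ℝ (T → A) := by
  refine ⟨fun a => Finset.prod_nonneg fun i _ => (hp i).1 _, ?_⟩
  rw [← Fintype.prod_sum]
  exact Finset.prod_eq_one fun i _ => (hp i).2

/-- Existence of correlated equilibria. -/
lemma exists_CE {m n : ℕ} (hm : 0 < m) (u : Fin n → (Fin n → Fin m) → ℝ) :
    ∃ x ∈ stdSimplex ℝ (Fin n → Fin m), ∀ i (f : Fin m → Fin m),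
      ∑ a, x a * (u i (Function.update a i (f (a i))) - u i a) ≤ 0 := by
  obtain ⟨x, hx, h⟩ := ville_alt (K := Fin n × (Fin m → Fin m)) (A := Fin n → Fin m)
    (fun q a => u q.1 (Function.update a q.1 (q.2 (a q.1))) - u q.1 a) (by
    intro w hw
    choose p hp hst using fun i => exists_stationary hm (fun f => w (i, f)) (fun f => hw (i, f))
    refine ⟨_, prod_mem_stdSimplex p hp, ?_⟩
    rw [Fintype.sum_prod_type]
    refine le_of_eq (Finset.sum_eq_zero fun i _ => ?_)
    have hsplit : ∀ f : Fin m → Fin m,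
        ∑ a : Fin n → Fin m, (∏ j, p j (a j)) * (u i (Function.update a i (f (a i))) - u i a)
        = ∑ c : {j // j ≠ i} → Fin m, (∏ j : {j // j ≠ i}, p j (c j)) * ∑ b, p i b *
          (u i ((Equiv.funSplitAt i (Fin m)).symm (f b, c))
            - u i ((Equiv.funSplitAt i (Fin m)).symm (b, c))) := by
      intro f
      rw [← Equiv.sum_comp (Equiv.funSplitAt i (Fin m)).symm, Fintype.sum_prod_type,
        Finset.sum_comm]
      refine Finset.sum_congr rfl fun c _ => ?_
      rw [Finset.mul_sum]
      refine Finset.sum_congr rfl fun b _ => ?_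
      have e1 : ((Equiv.funSplitAt i (Fin m)).symm (b, c)) i = b := by
        simp [Equiv.funSplitAt, Equiv.piSplitAt]
      have e2 : Function.update ((Equiv.funSplitAt i (Fin m)).symm (b, c)) i (f b)
          = (Equiv.funSplitAt i (Fin m)).symm (f b, c) := by
        ext j
        by_cases hj : j = i
        · subst hj; simp [Equiv.funSplitAt, Equiv.piSplitAt]
        · simp [Equiv.funSplitAt, Equiv.piSplitAt, hj]
      have e3 : ∏ j, p j ((Equiv.funSplitAt i (Fin m)).symm (b, c) j)
          = p i b * ∏ j : {j // j ≠ i}, p j (c j) := by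
        rw [Fintype.prod_eq_mul_prod_subtype_ne _ i, e1]
        congr 1
        refine Finset.prod_congr rfl fun j _ => ?_
        have := j.2
        simp [Equiv.funSplitAt, Equiv.piSplitAt, this]
      rw [e1, e2, e3]
      ring
    simp only [hsplit]
    simp only [Finset.mul_sum (s := (Finset.univ : Finset ({j // j ≠ i} → Fin m)))]
    rw [Finset.sum_comm]
    refine Finset.sum_eq_zero fun c _ => ?_
    have := hst i (fun b => u i ((Equiv.funSplitAt i (Fin m)).symm (b, c)))
    rw [← mul_zero (∏ j : {j // j ≠ i}, p j (c j)), ← this, Finset.mul_sum]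
    exact Finset.sum_congr rfl fun f _ => by ring)
  exact ⟨x, hx, fun i f => h (i, f)⟩

lemma exp_chord (s X : ℝ) (h1 : -1 ≤ X) (h2 : X ≤ 1) :
    Real.exp (s * X) ≤ Real.cosh s + X * Real.sinh s := by
  have := convexOn_exp.2 (Set.mem_univ s) (Set.mem_univ (-s))
    (show 0 ≤ (1 + X) / 2 by linarith) (show 0 ≤ (1 - X) / 2 by linarith) (by ring)
  rw [Real.cosh_eq, Real.sinh_eq]
  simp only [smul_eq_mul] at this
  have e : (1 + X) / 2 * s + (1 - X) / 2 * -s = s * X := by ring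
  rw [e] at this
  linarith

lemma mgf_le {A : Type} [Fintype A] (x : A → ℝ) (hx : x ∈ stdSimplex ℝ A) (X : A → ℝ)
    (hX : ∀ a, X a ∈ Set.Icc (-1:ℝ) 1) (hE : ∑ a, x a * X a ≤ 0) (s : ℝ) (hs : 0 ≤ s) :
    ∑ a, x a * Real.exp (s * X a) ≤ Real.exp (s ^ 2 / 2) := by
  calc ∑ a, x a * Real.exp (s * X a) ≤ ∑ a, x a * (Real.cosh s + X a * Real.sinh s) :=
        Finset.sum_le_sum fun a _ =>
          mul_le_mul_of_nonneg_left (exp_chord s _ (hX a).1 (hX a).2) (hx.1 a)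
    _ = Real.cosh s * ∑ a, x a + Real.sinh s * ∑ a, x a * X a := by
        simp only [Finset.mul_sum, ← Finset.sum_add_distrib]
        exact Finset.sum_congr rfl fun a _ => by ring
    _ ≤ Real.cosh s := by
        rw [hx.2]
        have := mul_nonpos_of_nonneg_of_nonpos (Real.sinh_nonneg_iff.2 hs) hE
        linarith
    _ ≤ _ := Real.cosh_le_exp_half_sq s

open Classical in
/-- Hoeffding's inequality for a finite product distribution. -/
lemma hoeffding_fin {A : Type} [Fintype A] (x : A → ℝ) (hx : x ∈ stdSimplex ℝ A) (X : A → ℝ)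
    (hX : ∀ a, X a ∈ Set.Icc (-1:ℝ) 1) (hE : ∑ a, x a * X a ≤ 0) (ε : ℝ) (hε : 0 ≤ ε) (k : ℕ) :
    ∑ ω : Fin k → A, (∏ t, x (ω t)) * (if k * ε < ∑ t, X (ω t) then 1 else 0)
      ≤ Real.exp (-(k * ε ^ 2 / 2)) := by
  calc _ ≤ ∑ ω : Fin k → A, (∏ t, x (ω t)) *
          (Real.exp (-(k * ε ^ 2)) * ∏ t, Real.exp (ε * X (ω t))) := by
        refine Finset.sum_le_sum fun ω _ =>
          mul_le_mul_of_nonneg_left ?_ (Finset.prod_nonneg fun t _ => hx.1 _)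
        rw [← Real.exp_sum, ← Real.exp_add, ← Finset.mul_sum]
        split_ifs with h
        · apply Real.one_le_exp
          nlinarith
        · positivity
    _ = Real.exp (-(k * ε ^ 2)) * (∑ a, x a * Real.exp (ε * X a)) ^ k := by
        have : (∑ a, x a * Real.exp (ε * X a)) ^ k
            = ∏ _t : Fin k, ∑ a, x a * Real.exp (ε * X a) := by simp
        rw [this, Fintype.prod_sum, Finset.mul_sum]
        refine Finset.sum_congr rfl fun ω _ => ?_
        rw [Finset.prod_mul_distrib]; ring
    _ ≤ Real.exp (-(k * ε ^ 2)) * (Real.exp (ε ^ 2 / 2)) ^ k := by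
        refine mul_le_mul_of_nonneg_left (pow_le_pow_left₀ ?_ (mgf_le x hx X hX hE ε hε) k)
          (Real.exp_pos _).le
        exact Finset.sum_nonneg fun a _ => mul_nonneg (hx.1 a) (Real.exp_pos _).le
    _ = _ := by
        rw [← Real.exp_nat_mul, ← Real.exp_add]
        congr 1; ring

/-- Every `n`-player `m`-action game with payoffs in `[0,1]` admits a `k`-uniform
distribution over pure action profiles (every probability an integer multiple of `1/k`)
that is an `(ε,δ)`-weak approximate correlated equilibrium, provided
`k ≥ 2(m·ln m − ln δ)/ε²`: at least `(1−δ)n` players have regret at most `ε` with respect to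
every switching function `f : [m] → [m]`. -/
theorem stmt10 (ε δ : ℝ) (hε : ε ∈ Set.Ioo (0:ℝ) 1) (hδ : δ ∈ Set.Ioo (0:ℝ) 1)
    (m : ℕ) (hm : 2 ≤ m) (k : ℕ)
    (hk : 2 * ((m : ℝ) * Real.log m - Real.log δ) / ε ^ 2 ≤ (k : ℝ))
    (n : ℕ) (u : Fin n → (Fin n → Fin m) → ℝ)
    (hu : ∀ i a, u i a ∈ Set.Icc (0:ℝ) 1) :
    ∃ μ : (Fin n → Fin m) → ℝ,
      (∀ a, 0 ≤ μ a) ∧ (∑ a, μ a = 1) ∧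
      (∀ a, ∃ c : ℕ, μ a = (c : ℝ) / k) ∧
      ∃ S : Finset (Fin n), (1 - δ) * n ≤ S.card ∧
        ∀ i ∈ S, ∀ f : Fin m → Fin m,
          (∑ a, μ a * u i (Function.update a i (f (a i)))) - ε ≤ ∑ a, μ a * u i a := by
  classical
  obtain ⟨hε0, hε1⟩ := hε
  obtain ⟨hδ0, hδ1⟩ := hδ
  have hm0 : 0 < m := by omega
  have hmR : (1:ℝ) < m := by exact_mod_cast (by omega : 1 < m)
  have hlogm : 0 < Real.log m := Real.log_pos hmR
  have hlogδ : Real.log δ < 0 := Real.log_neg hδ0 hδ1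
  have hkpos : (0:ℝ) < k := by
    refine lt_of_lt_of_le ?_ hk
    have : 0 < (m:ℝ) * Real.log m := by positivity
    apply div_pos _ (by positivity)
    linarith
  obtain ⟨x, hx, hCE⟩ := exists_CE hm0 u
  let X : Fin n → (Fin m → Fin m) → (Fin n → Fin m) → ℝ :=
    fun i f a => u i (Function.update a i (f (a i))) - u i a
  have hX : ∀ i f a, X i f a ∈ Set.Icc (-1:ℝ) 1 := by
    intro i f a
    have h1 := hu i a
    have h2 := hu i (Function.update a i (f (a i)))
    exact ⟨by linarith [h1.2, h2.1], by linarith [h1.1, h2.2]⟩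
  let W : (Fin k → Fin n → Fin m) → ℝ := fun ω => ∏ t, x (ω t)
  have hW : W ∈ stdSimplex ℝ (Fin k → Fin n → Fin m) :=
    prod_mem_stdSimplex (fun _ => x) (fun _ => hx)
  let bad : (Fin k → Fin n → Fin m) → Fin n → Prop :=
    fun ω i => ∃ f, k * ε < ∑ t, X i f (ω t)
  have hbound : (m:ℝ) ^ m * Real.exp (-(k * ε ^ 2 / 2)) ≤ δ := by
    have e1 : (m:ℝ) ^ m = Real.exp (m * Real.log m) := by
      rw [Real.exp_nat_mul, Real.exp_log (by linarith)]
    rw [e1, ← Real.exp_add]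
    rw [← Real.le_log_iff_exp_le hδ0]
    rw [div_le_iff₀ (by positivity)] at hk
    linarith
  have hplayer : ∀ i, ∑ ω, W ω * (if bad ω i then 1 else 0) ≤ δ := by
    intro i
    calc ∑ ω, W ω * (if bad ω i then 1 else 0)
        ≤ ∑ ω, ∑ f, W ω * (if k * ε < ∑ t, X i f (ω t) then 1 else 0) := by
          refine Finset.sum_le_sum fun ω _ => ?_
          rw [← Finset.mul_sum]
          refine mul_le_mul_of_nonneg_left ?_ (hW.1 ω)
          have hnn : ∀ f ∈ (Finset.univ : Finset (Fin m → Fin m)),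
              (0:ℝ) ≤ (if k * ε < ∑ t, X i f (ω t) then 1 else 0) := by
            intro f _; split_ifs <;> norm_num
          split_ifs with h
          · obtain ⟨f, hf⟩ := h
            refine le_trans ?_ (Finset.single_le_sum hnn (Finset.mem_univ f))
            rw [if_pos hf]
          · exact Finset.sum_nonneg hnn
      _ = ∑ f, ∑ ω, W ω * (if k * ε < ∑ t, X i f (ω t) then 1 else 0) := Finset.sum_comm
      _ ≤ ∑ _f : Fin m → Fin m, Real.exp (-(k * ε ^ 2 / 2)) := by
          refine Finset.sum_le_sum fun f _ => ?_
          convert hoeffding_fin x hx (X i f) (hX i f) (hCE i f) ε hε0.le k using 3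
      _ = (m:ℝ) ^ m * Real.exp (-(k * ε ^ 2 / 2)) := by simp
      _ ≤ δ := hbound
  have hex : ∃ ω, ∑ i, (if bad ω i then (1:ℝ) else 0) ≤ δ * n := by
    by_contra hcon
    push Not at hcon
    have h1 : ∑ ω, W ω * ∑ i, (if bad ω i then (1:ℝ) else 0) ≤ δ * n := by
      simp only [Finset.mul_sum]
      rw [Finset.sum_comm]
      calc _ ≤ ∑ _i : Fin n, δ := Finset.sum_le_sum fun i _ => hplayer i
        _ = δ * n := by simp [mul_comm]
    have h2 : ∃ ω, 0 < W ω := by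
      by_contra hno
      push Not at hno
      have := Finset.sum_nonpos (fun ω (_ : ω ∈ Finset.univ) => hno ω)
      rw [hW.2] at this
      linarith
    obtain ⟨ω₀, hω₀⟩ := h2
    have h3 : ∑ ω, W ω * (δ * n) < ∑ ω, W ω * ∑ i, (if bad ω i then (1:ℝ) else 0) :=
      Finset.sum_lt_sum (fun ω _ => mul_le_mul_of_nonneg_left (hcon ω).le (hW.1 ω))
        ⟨ω₀, Finset.mem_univ _, mul_lt_mul_of_pos_left (hcon ω₀) hω₀⟩
    rw [← Finset.sum_mul, hW.2, one_mul] at h3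
    linarith
  obtain ⟨ω, hω⟩ := hex
  have hμ : ∀ h : (Fin n → Fin m) → ℝ,
      ∑ a, ((Finset.univ.filter (fun t => ω t = a)).card : ℝ) / k * h a
        = (∑ t, h (ω t)) / k := by
    intro h
    rw [Finset.sum_div]
    have : ∀ a, ((Finset.univ.filter (fun t => ω t = a)).card : ℝ) / k * h a
        = ∑ t, if ω t = a then h a / k else 0 := by
      intro a
      rw [← Finset.sum_filter, Finset.sum_const, nsmul_eq_mul]; ring
    simp only [this]
    rw [Finset.sum_comm]
    simp
  refine ⟨fun a => ((Finset.univ.filter (fun t => ω t = a)).card : ℝ) / k,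
    fun a => by positivity, ?_, fun a => ⟨_, rfl⟩, Finset.univ.filter (fun i => ¬ bad ω i), ?_, ?_⟩
  · have := hμ (fun _ => 1)
    simp only [mul_one] at this
    rw [this]
    simp [hkpos.ne']
  · have h1 := Finset.card_filter_add_card_filter_not (s := (Finset.univ : Finset (Fin n))) (bad ω)
    rw [Finset.sum_boole] at hω
    have h2 : ((Finset.univ.filter (bad ω)).card : ℝ)
        + ((Finset.univ.filter (fun i => ¬ bad ω i)).card : ℝ) = n := by
      rw [← Nat.cast_add, h1]; simp
    linarith
  · intro i hi f
    have hnb : ¬ bad ω i := (Finset.mem_filter.1 hi).2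
    have hf : ∑ t, X i f (ω t) ≤ k * ε := by
      by_contra hc
      exact hnb ⟨f, not_le.1 hc⟩
    rw [hμ (fun a => u i (Function.update a i (f (a i)))), hμ (fun a => u i a)]
    simp only [X, Finset.sum_sub_distrib] at hf
    rw [sub_le_iff_le_add, div_add' _ _ _ hkpos.ne']
    refine div_le_div_of_nonneg_right ?_ hkpos.le
    linarith
end
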